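/- arXiv:1608.04880 — 9 statements merged into one kernel-verified Lean document; each statement's English description precedes it below -/
import Mathlib

section
/- Consider the pest-population ODE system in male abundance: dI/dt = b(1 - I/K)F - (ν_I + μ_I)I, dY/dt = rν_I I - (ν_Y + μ_Y)Y + δF, dF/dt = ν_Y Y - (δ + μ_F)F, dM/dt = (1 - r)ν_I I - μ_M M. This system defines a positive dynamical system on the nonnegative orthant ℝ⁴₊: for every initial condition in ℝ⁴₊ there exists a unique solution defined for all t ≥ 0 that remains in ℝ⁴₊, and the set Ω_K = {(I,Y,F,M) ∈ ℝ⁴₊ : I ≤ K} is an absorbing set. -/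
open Filter Topology Set

noncomputable section

/-- `x` is a (forward) solution of `x' = f x` for `t ≥ 0` remaining in `S`. -/
def IsSolOn (f : (Fin 4 → ℝ) → (Fin 4 → ℝ)) (S : Set (Fin 4 → ℝ))
    (x : ℝ → Fin 4 → ℝ) : Prop :=
  (∀ t : ℝ, 0 ≤ t → HasDerivAt x (f (x t)) t) ∧ ∀ t : ℝ, 0 ≤ t → x t ∈ S

/-- The nonnegative orthant ℝ⁴₊. -/
def Orthant : Set (Fin 4 → ℝ) := {x | ∀ i, 0 ≤ x i}

/-- `f` defines a positive dynamical system on `S`: for every initial condition in `S`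
there is a unique forward solution, defined for all `t ≥ 0`, remaining in `S`. -/
def PositiveDynSys (f : (Fin 4 → ℝ) → (Fin 4 → ℝ)) (S : Set (Fin 4 → ℝ)) : Prop :=
  ∀ x₀ ∈ S, ∃ x : ℝ → Fin 4 → ℝ, x 0 = x₀ ∧ IsSolOn f S x ∧
    ∀ y : ℝ → Fin 4 → ℝ, y 0 = x₀ → IsSolOn f S y → ∀ t : ℝ, 0 ≤ t → y t = x t

/-- The vector field of the male-abundance system. -/
def mAbund (b K r νI μI νY μY δ μF μM : ℝ) : (Fin 4 → ℝ) → (Fin 4 → ℝ) := fun x =>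
  ![b * (1 - x 0 / K) * x 2 - (νI + μI) * x 0,
    r * νI * x 0 - (νY + μY) * x 1 + δ * x 2,
    νY * x 1 - (δ + μF) * x 2,
    (1 - r) * νI * x 0 - μM * x 3]

lemma nonneg_inv (u u' : ℝ → ℝ) (a : ℝ) (h : ∀ t, a ≤ t → HasDerivAt u (u' t) t)
    (h0 : 0 ≤ u a) (hp : ∀ t, a ≤ t → u t ≤ 0 → 0 ≤ u' t) : ∀ t, a ≤ t → 0 ≤ u t := by
  intro t ht
  by_contra hneg
  push Not at hneg
  have hc : ContinuousOn u (Icc a t) := fun s hs => (h s hs.1).continuousAt.continuousWithinAt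
  have hcl : IsCompact (Icc a t ∩ u ⁻¹' Ici 0) :=
    isCompact_Icc.of_isClosed_subset (hc.preimage_isClosed_of_isClosed isClosed_Icc isClosed_Ici)
      inter_subset_left
  obtain ⟨s, ⟨hs, hs0⟩, hmax⟩ := hcl.exists_isGreatest ⟨a, ⟨le_refl a, ht⟩, h0⟩
  have hs0 : 0 ≤ u s := hs0
  have hlt : ∀ w, s < w → w ≤ t → u w < 0 := by
    intro w hw hwt
    by_contra hc
    push Not at hc
    have := hmax (a := w) ⟨⟨by linarith [hs.1], hwt⟩, hc⟩
    linarith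
  have hmono : MonotoneOn u (Icc s t) := by
    apply monotoneOn_of_deriv_nonneg (convex_Icc s t) (hc.mono (Icc_subset_Icc_left hs.1))
    · intro w hw
      rw [interior_Icc] at hw
      exact (h w (by linarith [hs.1, hw.1])).differentiableAt.differentiableWithinAt
    · intro w hw
      rw [interior_Icc] at hw
      have haw : a ≤ w := by linarith [hs.1, hw.1]
      rw [(h w haw).deriv]
      exact hp w haw (hlt w hw.1 hw.2.le).le
  have := hmono ⟨le_refl s, hs.2⟩ ⟨hs.2, le_refl t⟩ hs.2
  linarith

lemma global_sol {E : Type*} [NormedAddCommGroup E] [NormedSpace ℝ E] [CompleteSpace E]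
    (g : E → E) (L C : NNReal) (hL : LipschitzWith L g) (hC : ∀ x, ‖g x‖ ≤ C) (x₀ : E) :
    ∃ x : ℝ → E, x 0 = x₀ ∧ ∀ t, HasDerivAt x (g (x t)) t := by
  have key : ∀ n : ℕ, ∃ α : ℝ → E, α 0 = x₀ ∧
      ∀ t ∈ Ioo (-((n : ℝ) + 1)) (n + 1), HasDerivAt α (g (α t)) t := by
    intro n
    have hn : (0 : ℝ) ≤ (n : ℝ) + 1 := by positivity
    have hpl : IsPicardLindelof (fun _ => g) (tmin := -((n : ℝ) + 1)) (tmax := n + 1)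
        ⟨0, by constructor <;> linarith⟩ x₀ (C * (n + 1)) 0 C L := by
      refine ⟨fun t _ => hL.lipschitzOnWith, fun x _ => continuousOn_const,
        fun t _ x _ => hC x, ?_⟩
      simp
    obtain ⟨α, h0, hα⟩ := hpl.exists_eq_forall_mem_Icc_hasDerivWithinAt₀
    exact ⟨α, h0, fun t ht => (hα t (Ioo_subset_Icc_self ht)).hasDerivAt (Icc_mem_nhds ht.1 ht.2)⟩
  choose α h0 hα using key
  have huniq : ∀ n m : ℕ, n ≤ m → EqOn (α n) (α m) (Ioo (-((n : ℝ) + 1)) (n + 1)) := by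
    intro n m hnm
    have hnm' : (n : ℝ) ≤ m := by exact_mod_cast hnm
    have hn : (0 : ℝ) < (n : ℝ) + 1 := by positivity
    refine ODE_solution_unique_of_mem_Ioo (v := fun _ => g) (s := fun _ => univ) (K := L) (t₀ := 0)
      (fun t _ => hL.lipschitzOnWith) ⟨by linarith, by linarith⟩
      (fun t ht => ⟨hα n t ht, mem_univ _⟩)
      (fun t ht => ⟨hα m t ⟨by linarith [ht.1], by linarith [ht.2]⟩, mem_univ _⟩) ?_
    rw [h0, h0]
  have hmem : ∀ t : ℝ, t ∈ Ioo (-((⌈|t|⌉₊ : ℝ) + 1)) (⌈|t|⌉₊ + 1) := by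
    intro t
    have := Nat.le_ceil |t|
    have h1 := abs_le.1 this
    exact ⟨by linarith [h1.1], by linarith [h1.2]⟩
  refine ⟨fun t => α ⌈|t|⌉₊ t, h0 _, fun t => ?_⟩
  obtain ⟨N, hN⟩ : ∃ N : ℕ, N = ⌈|t|⌉₊ + 1 := ⟨_, rfl⟩
  have hle : ⌈|t|⌉₊ ≤ N := by omega
  have hev : (fun s => α ⌈|s|⌉₊ s) =ᶠ[𝓝 t] α N := by
    filter_upwards [Ioo_mem_nhds (hmem t).1 (hmem t).2] with s hs
    apply huniq _ _ _ (hmem s)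
    apply Nat.ceil_le.2
    rw [hN, abs_le]
    push_cast
    exact ⟨by linarith [hs.1], by linarith [hs.2]⟩
  have hN' : ((⌈|t|⌉₊ : ℕ) : ℝ) ≤ N := by exact_mod_cast hle
  have h1 := hα N t ⟨by linarith [(hmem t).1], by linarith [(hmem t).2]⟩
  have h2 := h1.congr_of_eventuallyEq hev
  have h3 : α ⌈|t|⌉₊ t = α N t := huniq _ _ hle (hmem t)
  simpa only [h3] using h2

lemma mAbund_contDiff (b K r νI μI νY μY δ μF μM : ℝ) :
    ContDiff ℝ 1 (mAbund b K r νI μI νY μY δ μF μM) := by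
  rw [contDiff_pi]
  intro i
  fin_cases i <;> simp [mAbund] <;> fun_prop

/-- clipping to a box -/
def clipBox (R : Fin 4 → ℝ) (x : Fin 4 → ℝ) : Fin 4 → ℝ := fun i => max 0 (min (R i) (x i))

lemma clipBox_lip (R : Fin 4 → ℝ) : LipschitzWith 1 (clipBox R) := by
  refine LipschitzWith.of_dist_le_mul fun x y => ?_
  rw [NNReal.coe_one, one_mul, dist_pi_le_iff dist_nonneg]
  intro i
  have h : LipschitzWith 1 (fun z : Fin 4 → ℝ => max 0 (min (R i) (z i))) :=
    ((LipschitzWith.eval i).const_min (R i)).const_max 0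
  simpa [clipBox] using h.dist_le_mul x y

lemma box_sol (f : (Fin 4 → ℝ) → (Fin 4 → ℝ)) (hf : ContDiff ℝ 1 f) (R : Fin 4 → ℝ)
    (hR : ∀ i, 0 ≤ R i)
    (hlo : ∀ x ∈ Icc 0 R, ∀ i, x i = 0 → 0 ≤ f x i)
    (hhi : ∀ x ∈ Icc 0 R, ∀ i, x i = R i → f x i ≤ 0) (x₀ : Fin 4 → ℝ) (hx₀ : x₀ ∈ Icc 0 R) :
    ∃ x : ℝ → Fin 4 → ℝ, x 0 = x₀ ∧ (∀ t : ℝ, 0 ≤ t → HasDerivAt x (f (x t)) t) ∧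
      ∀ t : ℝ, 0 ≤ t → x t ∈ Icc 0 R := by
  have hmem : ∀ x, clipBox R x ∈ Icc 0 R := fun x =>
    ⟨fun i => le_max_left _ _, fun i => max_le (hR i) (min_le_left _ _)⟩
  have hcpt : IsCompact (Icc 0 R) := isCompact_Icc
  obtain ⟨L, hL⟩ := LocallyLipschitzOn.exists_lipschitzOnWith_of_compact hcpt
    (hf.locallyLipschitz.locallyLipschitzOn (s := Icc 0 R))
  obtain ⟨C, hC⟩ := hcpt.exists_bound_of_continuousOn hf.continuous.continuousOn
  have hlip : LipschitzWith L (f ∘ clipBox R) := by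
    have := hL.comp (clipBox_lip R).lipschitzOnWith (s := univ) (fun x _ => hmem x)
    rwa [mul_one, lipschitzOnWith_univ] at this
  obtain ⟨x, hx0, hx⟩ := global_sol (f ∘ clipBox R) L C.toNNReal hlip
    (fun x => (hC _ (hmem x)).trans (Real.le_coe_toNNReal C)) x₀
  have hxi : ∀ i t, HasDerivAt (fun s => x s i) (f (clipBox R (x t)) i) t :=
    fun i t => (hasDerivAt_pi.1 (hx t)) i
  have hin : ∀ t : ℝ, 0 ≤ t → x t ∈ Icc 0 R := by
    intro t ht
    constructor
    · intro i
      refine nonneg_inv (fun s => x s i) _ 0 (fun s _ => hxi i s) (by simpa [hx0] using hx₀.1 i)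
        (fun s _ hs => hlo _ (hmem _) i ?_) t ht
      exact max_eq_left ((min_le_right _ _).trans hs)
    · intro i
      have := nonneg_inv (fun s => R i - x s i) _ 0 (fun s _ => (hxi i s).const_sub (R i))
        (by simpa [hx0] using hx₀.2 i)
        (fun s _ hs => neg_nonneg.2 (hhi _ (hmem _) i ?_)) t ht
      · simpa using this
      · have : R i ≤ x s i := by simpa using hs
        simp [clipBox, min_eq_left this, hR i]
  refine ⟨x, hx0, fun t ht => ?_, hin⟩
  have h1 := hx t
  have h2 : clipBox R (x t) = x t := by
    funext i
    have a1 := (hin t ht).1 i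
    have a2 := (hin t ht).2 i
    simp only [Pi.zero_apply] at a1
    simp [clipBox, min_eq_right a2, a1]
  simpa [h2] using h1

lemma sol_unique (f : (Fin 4 → ℝ) → (Fin 4 → ℝ)) (hf : ContDiff ℝ 1 f) (x y : ℝ → Fin 4 → ℝ)
    (hx : ∀ t : ℝ, 0 ≤ t → HasDerivAt x (f (x t)) t)
    (hy : ∀ t : ℝ, 0 ≤ t → HasDerivAt y (f (y t)) t) (h0 : y 0 = x 0) :
    ∀ t : ℝ, 0 ≤ t → y t = x t := by
  intro t ht
  have hcx : ContinuousOn x (Icc 0 t) := fun s hs => (hx s hs.1).continuousAt.continuousWithinAt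
  have hcy : ContinuousOn y (Icc 0 t) := fun s hs => (hy s hs.1).continuousAt.continuousWithinAt
  have hcpt : IsCompact (x '' Icc 0 t ∪ y '' Icc 0 t) :=
    (isCompact_Icc.image_of_continuousOn hcx).union (isCompact_Icc.image_of_continuousOn hcy)
  obtain ⟨L, hL⟩ := LocallyLipschitzOn.exists_lipschitzOnWith_of_compact hcpt
    (hf.locallyLipschitz.locallyLipschitzOn)
  exact ODE_solution_unique_of_mem_Icc_right (v := fun _ => f)
    (s := fun _ => x '' Icc 0 t ∪ y '' Icc 0 t) (fun _ _ => hL) hcy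
    (fun s hs => (hy s hs.1).hasDerivWithinAt)
    (fun s hs => Or.inr (mem_image_of_mem _ (Ico_subset_Icc_self hs))) hcx
    (fun s hs => (hx s hs.1).hasDerivWithinAt)
    (fun s hs => Or.inl (mem_image_of_mem _ (Ico_subset_Icc_self hs))) h0 ⟨ht, le_refl t⟩

/-- The male-abundance pest population system defines a positive dynamical system on the
nonnegative orthant ℝ⁴₊, and `Ω_K = {x ∈ ℝ⁴₊ : I ≤ K}` is an absorbing set: every forward
solution in ℝ⁴₊ eventually enters and remains in `Ω_K`. -/
theorem maleAbundance_positiveDynSys_and_absorbing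
    (b K γ r νI μI νY μY δ μF μM : ℝ)
    (hb : 0 < b) (hK : 0 < K) (hγ : 0 < γ) (hr : 0 < r) (hr1 : r < 1)
    (hνI : 0 < νI) (hμI : 0 < μI) (hνY : 0 < νY) (hμY : 0 < μY)
    (hδ : 0 < δ) (hμF : 0 < μF) (hμM : 0 < μM) :
    PositiveDynSys (mAbund b K r νI μI νY μY δ μF μM) Orthant ∧
    ∀ x : ℝ → Fin 4 → ℝ, IsSolOn (mAbund b K r νI μI νY μY δ μF μM) Orthant x →
      ∃ T : ℝ, 0 ≤ T ∧ ∀ t : ℝ, T ≤ t → x t ∈ Orthant ∧ x t 0 ≤ K := by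
  have hf := mAbund_contDiff b K r νI μI νY μY δ μF μM
  constructor
  · intro x₀ hx₀
    obtain ⟨R0, hR0⟩ : ∃ R0, R0 = max K (x₀ 0) := ⟨_, rfl⟩
    have hK0 : K ≤ R0 := hR0 ▸ le_max_left _ _
    have hx0 : x₀ 0 ≤ R0 := hR0 ▸ le_max_right _ _
    have hR0p : 0 < R0 := lt_of_lt_of_le hK hK0
    -- scale s : Y-bound (δ + μF) s, F-bound νY s
    have hden : 0 < νY * μF + μY * (δ + μF) := by positivity
    obtain ⟨s, hs1, hs2, hs3⟩ : ∃ s : ℝ, r * νI * R0 ≤ (νY * μF + μY * (δ + μF)) * s ∧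
        x₀ 1 ≤ (δ + μF) * s ∧ x₀ 2 ≤ νY * s := by
      have e1 : ∀ᶠ s : ℝ in atTop, r * νI * R0 ≤ (νY * μF + μY * (δ + μF)) * s :=
        (tendsto_id.const_mul_atTop hden).eventually_ge_atTop _
      have e2 : ∀ᶠ s : ℝ in atTop, x₀ 1 ≤ (δ + μF) * s :=
        (tendsto_id.const_mul_atTop (by positivity)).eventually_ge_atTop _
      have e3 : ∀ᶠ s : ℝ in atTop, x₀ 2 ≤ νY * s :=
        (tendsto_id.const_mul_atTop hνY).eventually_ge_atTop _
      exact (e1.and (e2.and e3)).exists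
    obtain ⟨R3, hm1, hm2⟩ : ∃ R3 : ℝ, (1 - r) * νI * R0 ≤ μM * R3 ∧ x₀ 3 ≤ R3 := by
      have e1 : ∀ᶠ s : ℝ in atTop, (1 - r) * νI * R0 ≤ μM * s :=
        (tendsto_id.const_mul_atTop hμM).eventually_ge_atTop _
      exact (e1.and (eventually_ge_atTop (x₀ 3))).exists
    have hr' : 0 < 1 - r := by linarith
    have p0 := hx₀ 0
    have p1 := hx₀ 1
    have p2 := hx₀ 2
    have p3 := hx₀ 3
    obtain ⟨x, h0, hd, hin⟩ := box_sol _ hf ![R0, (δ + μF) * s, νY * s, R3]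
      (by
        intro i
        fin_cases i <;> simp <;> linarith)
      (by
        rintro x ⟨hx, hx'⟩ i hi
        have q0 := hx 0
        have q1 := hx 1
        have q2 := hx 2
        have q3 := hx 3
        simp only [Pi.zero_apply] at q0 q1 q2 q3
        fin_cases i <;> simp [mAbund] at hi ⊢ <;> rw [hi]
        · simp; positivity
        · have : 0 ≤ r * νI * x 0 + δ * x 2 := by positivity
          linarith
        · have : 0 ≤ νY * x 1 := by positivity
          linarith
        · have : 0 ≤ (1 - r) * νI * x 0 := by positivity
          linarith)
      (by
        rintro x ⟨hx, hx'⟩ i hi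
        have q0 := hx 0
        have q1 := hx 1
        have q2 := hx 2
        have q3 := hx 3
        have t0 := hx' 0
        have t1 := hx' 1
        have t2 := hx' 2
        simp at q0 q1 q2 q3 t0 t1 t2
        have u0 : r * νI * x 0 ≤ r * νI * R0 := by gcongr
        have u3 : (1 - r) * νI * x 0 ≤ (1 - r) * νI * R0 := by gcongr
        have u1 : νY * x 1 ≤ νY * ((δ + μF) * s) := by gcongr
        have u2 : δ * x 2 ≤ δ * (νY * s) := by gcongr
        fin_cases i <;> simp [mAbund] at hi ⊢ <;> rw [hi]
        · have h1 : 1 ≤ R0 / K := (one_le_div hK).2 hK0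
          have h2 : b * (1 - R0 / K) * x 2 ≤ 0 :=
            mul_nonpos_of_nonpos_of_nonneg
              (mul_nonpos_of_nonneg_of_nonpos hb.le (by linarith)) q2
          have h3 : 0 ≤ (νI + μI) * R0 := by positivity
          linarith
        · nlinarith
        · nlinarith
        · linarith)
      x₀ (by
        constructor
        · intro i; exact hx₀ i
        · intro i
          fin_cases i <;> simp <;> assumption)
    refine ⟨x, h0, ⟨hd, fun t ht i => (hin t ht).1 i⟩, fun y hy0 hy => ?_⟩
    exact sol_unique _ hf x y hd hy.1 (by rw [hy0, h0])
  · intro x hx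
    have hd : ∀ t : ℝ, 0 ≤ t → HasDerivAt (fun s => x s 0)
        (b * (1 - x t 0 / K) * x t 2 - (νI + μI) * x t 0) t := fun t ht =>
      (hasDerivAt_pi.1 (hx.1 t ht)) 0
    have hneg : ∀ t : ℝ, 0 ≤ t → K ≤ x t 0 →
        b * (1 - x t 0 / K) * x t 2 - (νI + μI) * x t 0 ≤ - ((νI + μI) * K) := by
      intro t ht hKt
      have h1 : 1 ≤ x t 0 / K := (one_le_div hK).2 hKt
      have h2 : b * (1 - x t 0 / K) * x t 2 ≤ 0 :=
        mul_nonpos_of_nonpos_of_nonneg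
          (mul_nonpos_of_nonneg_of_nonpos hb.le (by linarith)) (hx.2 t ht 2)
      have h3 : (νI + μI) * K ≤ (νI + μI) * x t 0 := by gcongr
      linarith
    have hc : 0 < (νI + μI) * K := by positivity
    obtain ⟨T, hT, hTK⟩ : ∃ T : ℝ, 0 ≤ T ∧ x T 0 ≤ K := by
      by_contra hcon
      push Not at hcon
      have key := nonneg_inv (fun t => x 0 0 - (νI + μI) * K * t - x t 0) _ 0
        (fun t ht => (((hasDerivAt_id t).const_mul ((νI + μI) * K)).const_sub (x 0 0)).sub (hd t ht))
        (by simp) (fun t ht _ => by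
          have := hneg t ht (hcon t ht).le
          linarith)
      have hx00 := hx.2 0 le_rfl 0
      have h1 := key (x 0 0 / ((νI + μI) * K)) (by positivity)
      have h2 := hcon (x 0 0 / ((νI + μI) * K)) (by positivity)
      have h3 : (νI + μI) * K * (x 0 0 / ((νI + μI) * K)) = x 0 0 := by field_simp
      rw [h3] at h1
      linarith
    refine ⟨T, hT, fun t ht => ⟨hx.2 t (hT.trans ht), ?_⟩⟩
    have := nonneg_inv (fun s => K - x s 0) _ T
      (fun s hs => (hd s (hT.trans hs)).const_sub K) (by simpa using hTK)
      (fun s hs hs' => by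
        have := hneg s (hT.trans hs) (by linarith)
        linarith) t ht
    simpa using this
end
end

section
/- For the male-abundance system dI/dt = b(1 - I/K)F - (ν_I + μ_I)I, dY/dt = rν_I I - (ν_Y + μ_Y)Y + δF, dF/dt = ν_Y Y - (δ + μ_F)F, dM/dt = (1 - r)ν_I I - μ_M M: if the basic offspring number N₀ = brν_Iν_Y / ((μ_I+ν_I)((ν_Y+μ_Y)(δ+μ_F) - δν_Y)) satisfies N₀ ≤ 1, then the trivial equilibrium TE = (0,0,0,0) is globally asymptotically stable on ℝ⁴₊. -/
open Filter Topology Set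

noncomputable section

/-- Lyapunov stability of `p` relative to forward solutions in `S`. -/
def StableOn (f : (Fin 4 → ℝ) → (Fin 4 → ℝ)) (S : Set (Fin 4 → ℝ)) (p : Fin 4 → ℝ) : Prop :=
  ∀ ε > 0, ∃ d > 0, ∀ x : ℝ → Fin 4 → ℝ, IsSolOn f S x → dist (x 0) p < d →
    ∀ t : ℝ, 0 ≤ t → dist (x t) p < ε

/-- `p` is a globally asymptotically stable equilibrium of `f` on `S`: it is an
equilibrium, Lyapunov stable, and attracts every forward solution in `S`. -/
def GASOn (f : (Fin 4 → ℝ) → (Fin 4 → ℝ)) (S : Set (Fin 4 → ℝ)) (p : Fin 4 → ℝ) : Prop :=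
  f p = 0 ∧ StableOn f S p ∧
    ∀ x : ℝ → Fin 4 → ℝ, IsSolOn f S x → Tendsto x atTop (𝓝 p)

lemma norm_sq_le_q (x : Fin 4 → ℝ) : ‖x‖ ^ 2 ≤ x 0 ^ 2 + x 1 ^ 2 + x 2 ^ 2 + x 3 ^ 2 := by
  have h : ‖x‖ ≤ Real.sqrt (x 0 ^ 2 + x 1 ^ 2 + x 2 ^ 2 + x 3 ^ 2) := by
    rw [pi_norm_le_iff_of_nonneg (Real.sqrt_nonneg _)]
    intro i
    rw [Real.norm_eq_abs]
    apply Real.abs_le_sqrt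
    have := sq_nonneg (x 0)
    have := sq_nonneg (x 1)
    have := sq_nonneg (x 2)
    have := sq_nonneg (x 3)
    fin_cases i <;> simp only [Fin.zero_eta, Fin.mk_one, Fin.reduceFinMk] <;> linarith
  calc ‖x‖ ^ 2 ≤ (Real.sqrt (x 0 ^ 2 + x 1 ^ 2 + x 2 ^ 2 + x 3 ^ 2)) ^ 2 := by gcongr
    _ = _ := Real.sq_sqrt (by positivity)

lemma antitone_aux (g g' : ℝ → ℝ) (hg : ∀ t, 0 ≤ t → HasDerivAt g (g' t) t) (k : ℝ)
    (hk : ∀ t, 0 ≤ t → g' t ≤ -k) {s t : ℝ} (hs : 0 ≤ s) (hst : s ≤ t) :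
    g t ≤ g s - k * (t - s) := by
  have hh : ∀ u, 0 ≤ u → HasDerivAt (fun u => g u + k * u) (g' u + k) u := by
    intro u hu
    have h := (hg u hu).add ((hasDerivAt_id u).const_mul k)
    rw [mul_one] at h
    exact h
  have : AntitoneOn (fun u => g u + k * u) (Ici 0) := by
    apply antitoneOn_of_deriv_nonpos (convex_Ici 0)
    · intro u hu
      exact (hh u hu).continuousAt.continuousWithinAt
    · intro u hu
      rw [interior_Ici] at hu
      exact (hh u (le_of_lt hu)).differentiableAt.differentiableWithinAt
    · intro u hu
      rw [interior_Ici] at hu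
      rw [(hh u (le_of_lt hu)).deriv]
      linarith [hk u (le_of_lt hu)]
  have := this (mem_Ici.2 hs) (mem_Ici.2 (hs.trans hst)) hst
  simp only at this
  linarith

lemma GAS_of_lyap (f : (Fin 4 → ℝ) → (Fin 4 → ℝ)) (S : Set (Fin 4 → ℝ))
    (W Wd : (Fin 4 → ℝ) → ℝ) (hf0 : f 0 = 0) (hW : ContinuousAt W 0) (hW0 : W 0 = 0)
    (m c : ℝ) (hm : 0 < m) (hc : 0 < c) (hmW : ∀ y ∈ S, m * ‖y‖ ^ 2 ≤ W y)
    (hd : ∀ x, IsSolOn f S x → ∀ t : ℝ, 0 ≤ t → HasDerivAt (fun t => W (x t)) (Wd (x t)) t)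
    (hWd : ∀ y ∈ S, Wd y ≤ -(c * ‖y‖ ^ 2)) : GASOn f S 0 := by
  have key : ∀ ε > 0, ∀ x, IsSolOn f S x → ∀ T, 0 ≤ T → W (x T) < m * ε ^ 2 →
      ∀ t, T ≤ t → dist (x t) 0 < ε := by
    intro ε hε x hx T hT hlt t ht
    have h1 := antitone_aux _ _ (hd x hx) 0 (fun t ht => by
      have := hWd _ (hx.2 t ht)
      have : 0 ≤ c * ‖x t‖ ^ 2 := by positivity
      linarith) hT ht
    have h2 := hmW _ (hx.2 t (hT.trans ht))
    rw [dist_zero_right]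
    have h3 : m * ‖x t‖ ^ 2 < m * ε ^ 2 := by linarith
    exact lt_of_pow_lt_pow_left₀ 2 hε.le (lt_of_mul_lt_mul_left h3 hm.le)
  have nbd : ∀ η > 0, ∃ d > 0, ∀ y, dist y 0 < d → W y < η := by
    intro η hη
    obtain ⟨d, hd0, h⟩ := Metric.continuousAt_iff.1 hW η hη
    refine ⟨d, hd0, fun y hy => ?_⟩
    have := h hy
    rw [hW0, Real.dist_eq, sub_zero] at this
    exact (le_abs_self _).trans_lt this
  refine ⟨hf0, ?_, ?_⟩
  · intro ε hε
    obtain ⟨d, hd0, h⟩ := nbd (m * ε ^ 2) (by positivity)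
    exact ⟨d, hd0, fun x hx hx0 t ht => key ε hε x hx 0 le_rfl (h _ hx0) t ht⟩
  · intro x hx
    rw [Metric.tendsto_atTop]
    intro ε hε
    obtain ⟨d, hd0, h⟩ := nbd (m * ε ^ 2) (by positivity)
    suffices ∃ T, 0 ≤ T ∧ W (x T) < m * ε ^ 2 by
      obtain ⟨T, hT, hlt⟩ := this
      exact ⟨T, fun t ht => key ε hε x hx T hT hlt t ht⟩
    by_contra! hcon
    have hk : ∀ t, 0 ≤ t → Wd (x t) ≤ -(c * d ^ 2) := by
      intro t ht
      have h1 : d ≤ ‖x t‖ := by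
        by_contra! h2
        have := h (x t) (by rwa [dist_zero_right])
        linarith [hcon t ht]
      have h2 : c * d ^ 2 ≤ c * ‖x t‖ ^ 2 := by gcongr
      linarith [hWd _ (hx.2 t ht)]
    have hp : 0 < c * d ^ 2 := by positivity
    have hW00 : 0 ≤ W (x 0) := le_trans (by positivity) (hcon 0 le_rfl)
    have ht : 0 ≤ W (x 0) / (c * d ^ 2) := by positivity
    have h1 := antitone_aux _ _ (hd x hx) _ hk le_rfl ht
    have h2 := hcon _ ht
    have h3 : 0 < m * ε ^ 2 := by positivity
    rw [sub_zero, mul_div_cancel₀ _ hp.ne'] at h1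
    linarith

/-- If the basic offspring number `N₀ ≤ 1`, the trivial equilibrium `TE = (0,0,0,0)`
is globally asymptotically stable on ℝ⁴₊ for the male-abundance system. -/
theorem TE_GAS_of_basicOffspring_le_one
    (b K γ r νI μI νY μY δ μF μM N0 : ℝ)
    (hb : 0 < b) (hK : 0 < K) (hγ : 0 < γ) (hr : 0 < r) (hr1 : r < 1)
    (hνI : 0 < νI) (hμI : 0 < μI) (hνY : 0 < νY) (hμY : 0 < μY)
    (hδ : 0 < δ) (hμF : 0 < μF) (hμM : 0 < μM)
    (hN0 : N0 = b * r * νI * νY / ((μI + νI) * ((νY + μY) * (δ + μF) - δ * νY)))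
    (hle : N0 ≤ 1) :
    GASOn (mAbund b K r νI μI νY μY δ μF μM) Orthant 0 := by
  have hD : 0 < (νY + μY) * (δ + μF) - δ * νY := by
    have : (νY + μY) * (δ + μF) - δ * νY = νY * μF + μY * (δ + μF) := by ring
    rw [this]; positivity
  have hN : b * r * νI * νY ≤ (μI + νI) * ((νY + μY) * (δ + μF) - δ * νY) := by
    rw [hN0, div_le_one (by positivity)] at hle
    exact hle
  obtain ⟨p, hpd⟩ : ∃ p, p = r * νI := ⟨_, rfl⟩
  obtain ⟨s, hsd⟩ : ∃ s, s = (1 - r) * νI := ⟨_, rfl⟩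
  obtain ⟨a, had⟩ : ∃ a, a = νI + μI := ⟨_, rfl⟩
  have hp : 0 < p := by rw [hpd]; positivity
  have ha : 0 < a := by rw [had]; positivity
  obtain ⟨B, hBd⟩ : ∃ B, B = (νY * p ^ 2 / μY + s ^ 2 / μM + 1) / (2 * a) := ⟨_, rfl⟩
  have hB : 0 < B := by rw [hBd]; positivity
  have hBa : 2 * B * a = νY * p ^ 2 / μY + s ^ 2 / μM + 1 := by rw [hBd]; field_simp
  obtain ⟨A, hAd⟩ : ∃ A, A = 2 * B * K / p := ⟨_, rfl⟩
  have hA : 0 < A := by rw [hAd]; positivity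
  have hAp : A * p = 2 * B * K := by rw [hAd]; field_simp
  obtain ⟨φ, hφd⟩ : ∃ φ, φ = a * (νY + μY) / νY := ⟨_, rfl⟩
  have hφ : 0 < φ := by rw [hφd]; positivity
  have hφν : φ * νY = a * (νY + μY) := by rw [hφd]; field_simp
  have hκ : p * b + a * δ - φ * (δ + μF) ≤ 0 := by
    have : (p * b + a * δ - φ * (δ + μF)) * νY ≤ 0 := by
      have e : (p * b + a * δ - φ * (δ + μF)) * νY
        = p * b * νY + a * δ * νY - (φ * νY) * (δ + μF) := by ring
      rw [e, hφν, hpd, had]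
      linarith
    exact nonpos_of_mul_nonpos_left this hνY
  let f := mAbund b K r νI μI νY μY δ μF μM
  let W : (Fin 4 → ℝ) → ℝ := fun x =>
    A * (p * x 0 + a * x 1 + φ * x 2) + B * x 0 ^ 2 + νY * x 1 ^ 2 + δ * x 2 ^ 2 + x 3 ^ 2
  let Wd : (Fin 4 → ℝ) → ℝ := fun x =>
    A * (p * f x 0 + a * f x 1 + φ * f x 2) + B * (2 * x 0 * f x 0) + νY * (2 * x 1 * f x 1)
      + δ * (2 * x 2 * f x 2) + 2 * x 3 * f x 3
  obtain ⟨m, hm, hmB, hmY, hmF, hm1⟩ : ∃ m > 0, m ≤ B ∧ m ≤ νY ∧ m ≤ δ ∧ m ≤ 1 :=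
    ⟨min (min B νY) (min δ 1), by positivity, by simp, by simp, by simp, by simp⟩
  obtain ⟨c, hc, hc1, hcY, hcF, hcM⟩ :
      ∃ c > 0, c ≤ 1 ∧ c ≤ νY * μY ∧ c ≤ 2 * (δ * μF) ∧ c ≤ μM :=
    ⟨min (min 1 (νY * μY)) (min (2 * (δ * μF)) μM), by positivity, by simp, by simp, by simp,
      by simp⟩
  refine GAS_of_lyap f Orthant W Wd ?_ ?_ ?_ m c hm hc ?_ ?_ ?_
  · ext i
    fin_cases i <;> simp [f, mAbund]
  · apply Continuous.continuousAt
    fun_prop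
  · simp [W]
  · intro y hy
    have h0 := hy 0
    have h1 := hy 1
    have h2 := hy 2
    have hq := mul_le_mul_of_nonneg_left (norm_sq_le_q y) hm.le
    have e0 := mul_le_mul_of_nonneg_right hmB (sq_nonneg (y 0))
    have e1 := mul_le_mul_of_nonneg_right hmY (sq_nonneg (y 1))
    have e2 := mul_le_mul_of_nonneg_right hmF (sq_nonneg (y 2))
    have e3 := mul_le_mul_of_nonneg_right hm1 (sq_nonneg (y 3))
    have : 0 ≤ A * (p * y 0 + a * y 1 + φ * y 2) := by positivity
    simp only [W]
    linarith
  · intro x hx t ht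
    have hi : ∀ i, HasDerivAt (fun t => x t i) (f (x t) i) t := hasDerivAt_pi.1 (hx.1 t ht)
    have hsq : ∀ i, HasDerivAt (fun t => x t i ^ 2) (2 * x t i * f (x t) i) t := by
      intro i
      have h := (hi i).pow 2
      have e : ((2 : ℕ) : ℝ) * x t i ^ (2 - 1) * f (x t) i = 2 * x t i * f (x t) i := by simp
      rw [e] at h
      exact h
    exact ((((((((hi 0).const_mul p).add ((hi 1).const_mul a)).add
      ((hi 2).const_mul φ)).const_mul A).add ((hsq 0).const_mul B)).add
      ((hsq 1).const_mul νY)).add ((hsq 2).const_mul δ)).add (hsq 3)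
  · intro y hy
    have h0 : 0 ≤ y 0 := hy 0
    have h1 : 0 ≤ y 1 := hy 1
    have h2 : 0 ≤ y 2 := hy 2
    have h3 : 0 ≤ y 3 := hy 3
    have hq := mul_le_mul_of_nonneg_left (norm_sq_le_q y) hc.le
    have e0 := mul_le_mul_of_nonneg_right hc1 (sq_nonneg (y 0))
    have e1 := mul_le_mul_of_nonneg_right hcY (sq_nonneg (y 1))
    have e2 := mul_le_mul_of_nonneg_right hcF (sq_nonneg (y 2))
    have e3 := mul_le_mul_of_nonneg_right hcM (sq_nonneg (y 3))
    simp only [Wd, f, mAbund, Matrix.cons_val]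
    rw [← hpd, ← hsd, ← had]
    generalize y 0 = I at *
    generalize y 1 = Y at *
    generalize y 2 = F at *
    generalize y 3 = M at *
    have t1 : A * (p * (b * (1 - I / K) * F - a * I) + a * (p * I - (νY + μY) * Y + δ * F)
        + φ * (νY * Y - (δ + μF) * F)) ≤ - (2 * B * b * (I * F)) := by
      have e : A * (p * (b * (1 - I / K) * F - a * I) + a * (p * I - (νY + μY) * Y + δ * F)
        + φ * (νY * Y - (δ + μF) * F)) = A * ((p * b + a * δ - φ * (δ + μF)) * F)
          + A * ((φ * νY - a * (νY + μY)) * Y) - (A * p) * b * (I / K) * F := by ring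
      rw [e, hφν, hAp]
      have e4 : 2 * B * K * b * (I / K) * F = 2 * B * b * (I * F) := by field_simp
      have : A * ((p * b + a * δ - φ * (δ + μF)) * F) ≤ 0 :=
        mul_nonpos_of_nonneg_of_nonpos hA.le (mul_nonpos_of_nonpos_of_nonneg hκ h2)
      rw [e4]
      linarith
    have t2 : B * (2 * I * (b * (1 - I / K) * F - a * I)) ≤ 2 * B * b * (I * F)
        - (νY * p ^ 2 / μY + s ^ 2 / μM + 1) * I ^ 2 := by
      rw [← hBa]
      have : 0 ≤ 2 * B * b * I * (I / K) * F := by positivity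
      linarith
    have t3 : νY * (2 * Y * (p * I - (νY + μY) * Y + δ * F)) +
        δ * (2 * F * (νY * Y - (δ + μF) * F)) ≤ νY * p ^ 2 / μY * I ^ 2
          - νY * μY * Y ^ 2 - 2 * (δ * μF) * F ^ 2 := by
      have g : νY * p ^ 2 / μY * I ^ 2 - νY * μY * Y ^ 2 - 2 * (δ * μF) * F ^ 2
        - (νY * (2 * Y * (p * I - (νY + μY) * Y + δ * F)) +
        δ * (2 * F * (νY * Y - (δ + μF) * F)))
        = νY / μY * (p * I - μY * Y) ^ 2 + 2 * (νY * Y - δ * F) ^ 2 := by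
        field_simp
        ring
      have : 0 ≤ νY / μY * (p * I - μY * Y) ^ 2 + 2 * (νY * Y - δ * F) ^ 2 := by positivity
      linarith
    have t4 : 2 * M * (s * I - μM * M) ≤ s ^ 2 / μM * I ^ 2 - μM * M ^ 2 := by
      have g : s ^ 2 / μM * I ^ 2 - μM * M ^ 2 - 2 * M * (s * I - μM * M)
        = (s * I - μM * M) ^ 2 / μM := by
        field_simp
        ring
      have : 0 ≤ (s * I - μM * M) ^ 2 / μM := by positivity
      linarith
    linarith
end
end

section
/- For the male-abundance system dI/dt = b(1 - I/K)F - (ν_I + μ_I)I, dY/dt = rν_I I - (ν_Y + μ_Y)Y + δF, dF/dt = ν_Y Y - (δ + μ_F)F, dM/dt = (1 - r)ν_I I - μ_M M: if N₀ = brν_Iν_Y / ((μ_I+ν_I)((ν_Y+μ_Y)(δ+μ_F) - δν_Y)) > 1, then TE = (0,0,0,0) is unstable and the system admits a positive equilibrium EE* = (I*,Y*,F*,M*) with I* = (1 - 1/N₀)K, Y* = rν_I(δ+μ_F)K(1 - 1/N₀)/((ν_Y+μ_Y)(δ+μ_F) - δν_Y), F* = rν_Iν_Y K(1 - 1/N₀)/((ν_Y+μ_Y)(δ+μ_F)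 - δν_Y), M* = (1-r)ν_I K(1 - 1/N₀)/μ_M, which is globally asymptotically stable on ℝ⁴₊ \ {x ∈ ℝ⁴₊ : I = Y = F = 0}. -/
open Filter Topology Set

noncomputable section

section AuxSection

lemma aux_anti {u u' : ℝ → ℝ} {a b : ℝ} (hab : a ≤ b)
    (h : ∀ t ∈ Icc a b, HasDerivAt u (u' t) t) (h' : ∀ t ∈ Icc a b, u' t ≤ 0) : u b ≤ u a := by
  have := antitoneOn_of_deriv_nonpos (convex_Icc a b)
    (fun t ht => (h t ht).continuousAt.continuousWithinAt)
    (fun t ht => (h t (interior_subset ht)).differentiableAt.differentiableWithinAt)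
    (fun t ht => by rw [(h t (interior_subset ht)).deriv]; exact h' t (interior_subset ht))
  exact this (left_mem_Icc.2 hab) (right_mem_Icc.2 hab) hab

lemma aux_stay {u u' : ℝ → ℝ} {t0 c : ℝ} (h : ∀ t, t0 ≤ t → HasDerivAt u (u' t) t)
    (h0 : u t0 ≤ c) (h' : ∀ t, t0 ≤ t → c < u t → u' t ≤ 0) : ∀ t, t0 ≤ t → u t ≤ c := by
  intro t ht
  have key : ∀ ε > 0, u t ≤ c + ε * (1 + (t - t0)) := by
    intro ε hε
    refine image_le_of_deriv_right_lt_deriv_boundary' (f := u) (f' := u') (a := t0) (b := t)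
      (B := fun s => c + ε * (1 + (s - t0))) (B' := fun _ => ε)
      (fun s hs => (h s hs.1).continuousAt.continuousWithinAt)
      (fun s hs => (h s hs.1).hasDerivWithinAt) (by simp; linarith) (by fun_prop) ?_ ?_
      (right_mem_Icc.2 ht)
    · intro s _
      have : HasDerivAt (fun s => c + ε * (1 + (s - t0))) (ε * 1) s :=
        (((((hasDerivAt_id s).sub_const t0).const_add 1)).const_mul ε).const_add c
      simpa using this.hasDerivWithinAt
    · intro s hs hu
      have : c < u s := by
        rw [hu]; have := hs.1
        have : 0 < ε * (1 + (s - t0)) := by apply mul_pos hε; linarith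
        linarith
      linarith [h' s hs.1 this]
  have hpos : 0 < 1 + (t - t0) := by linarith
  refine le_of_forall_pos_le_add fun η hη => ?_
  have := key (η / (1 + (t - t0))) (by positivity)
  rwa [div_mul_cancel₀ _ hpos.ne'] at this

lemma aux_decay {u u' : ℝ → ℝ} {t0 a k : ℝ} (hk : 0 < k)
    (h : ∀ t, t0 ≤ t → HasDerivAt u (u' t) t)
    (h' : ∀ t, t0 ≤ t → u' t ≤ a - k * u t) : ∀ ε > 0, ∀ᶠ t in atTop, u t ≤ a / k + ε := by
  intro ε hε
  have key : ∀ t, t0 ≤ t → (u t - a / k) * Real.exp (k * t) ≤ (u t0 - a / k) * Real.exp (k * t0) := by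
    intro t ht
    refine aux_anti (u := fun t => (u t - a / k) * Real.exp (k * t))
      (u' := fun t => u' t * Real.exp (k * t) + (u t - a / k) * (Real.exp (k * t) * (k * 1))) ht
      (fun s hs => ?_) (fun s hs => ?_)
    · exact ((h s hs.1).sub_const _).mul (((hasDerivAt_id s).const_mul k).exp)
    · have h1 := h' s hs.1
      have h2 : u' s * Real.exp (k * s) + (u s - a / k) * (Real.exp (k * s) * (k * 1))
        = (u' s - (a - k * u s)) * Real.exp (k * s) := by field_simp; ring
      rw [h2]
      exact mul_nonpos_of_nonpos_of_nonneg (by linarith) (Real.exp_pos _).le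
  have hlim : Tendsto (fun t => (u t0 - a / k) * Real.exp (k * t0) * Real.exp (-(k * t))) atTop
      (𝓝 ((u t0 - a / k) * Real.exp (k * t0) * 0)) := by
    refine Tendsto.const_mul _ (Real.tendsto_exp_neg_atTop_nhds_zero.comp ?_)
    exact tendsto_id.const_mul_atTop hk
  rw [mul_zero] at hlim
  filter_upwards [hlim.eventually (gt_mem_nhds hε), eventually_ge_atTop t0] with t h1 h2
  have h3 := mul_le_mul_of_nonneg_right (key t h2) (Real.exp_pos (-(k * t))).le
  rw [mul_assoc, ← Real.exp_add, add_neg_cancel, Real.exp_zero, mul_one] at h3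
  linarith

/-- strict positivity of a family with strictly inward field -/
lemma aux_inv {n : ℕ} {g g' : Fin n → ℝ → ℝ} {t0 : ℝ}
    (h : ∀ i t, t0 ≤ t → HasDerivAt (g i) (g' i t) t) (h0 : ∀ i, 0 < g i t0)
    (h' : ∀ t, t0 ≤ t → (∀ j, 0 ≤ g j t) → ∀ i, g i t = 0 → 0 < g' i t) :
    ∀ t, t0 ≤ t → ∀ i, 0 < g i t := by
  by_contra! hcon
  obtain ⟨t1, ht1, i1, hi1⟩ := hcon
  set B : Set ℝ := {t | t0 ≤ t ∧ ∃ i, g i t ≤ 0} with hB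
  have hne : B.Nonempty := ⟨t1, ht1, i1, hi1⟩
  have hbd : BddBelow B := ⟨t0, fun t ht => ht.1⟩
  set τ := sInf B with hτ
  have hτ0 : t0 ≤ τ := le_csInf hne fun t ht => ht.1
  have hbefore : ∀ t, t0 ≤ t → t < τ → ∀ i, 0 < g i t := by
    intro t ht htτ i
    by_contra hc
    exact absurd (csInf_le hbd (show t ∈ B from ⟨ht, i, not_lt.1 hc⟩)) (not_le.2 htτ)
  have hex : ∃ i, g i τ ≤ 0 := by
    by_contra! hc
    have hev : ∀ᶠ t in 𝓝 τ, ∀ i, 0 < g i t :=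
      eventually_all.2 fun i => (h i τ hτ0).continuousAt.eventually (lt_mem_nhds (hc i))
    obtain ⟨ε, hε, hb⟩ := Metric.eventually_nhds_iff.1 hev
    have : τ + ε ≤ τ := by
      refine le_csInf hne fun t ht => ?_
      by_contra hlt
      obtain ⟨i, hi⟩ := ht.2
      have h1 : τ ≤ t := csInf_le hbd ht
      have := hb (y := t) (by rw [Real.dist_eq, abs_lt]; constructor <;> linarith) i
      linarith
    linarith
  obtain ⟨i, hi⟩ := hex
  have hlt : t0 < τ := by
    rcases hτ0.lt_or_eq with h1 | h1
    · exact h1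
    · rw [← h1] at hi; exact absurd (h0 i) (not_lt.2 hi)
  have hnn : ∀ j, 0 ≤ g j τ := by
    intro j
    have hc : Tendsto (g j) (𝓝[<] τ) (𝓝 (g j τ)) :=
      (h j τ hτ0).continuousAt.tendsto.mono_left nhdsWithin_le_nhds
    refine ge_of_tendsto hc ?_
    filter_upwards [Ioo_mem_nhdsLT hlt] with t ht
    exact (hbefore t ht.1.le ht.2 j).le
  have hz : g i τ = 0 := le_antisymm hi (hnn i)
  have hpos := h' τ hτ0 hnn i hz
  have hs := (h i τ hτ0).hasDerivWithinAt (s := Iio τ)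
  rw [hasDerivWithinAt_iff_tendsto_slope' (by simp)] at hs
  have h1 : ∀ᶠ t in 𝓝[<] τ, 0 < slope (g i) τ t := hs.eventually (lt_mem_nhds hpos)
  have h2 := h1.and (Ioo_mem_nhdsLT hlt)
  obtain ⟨t, h3, h4⟩ := h2.exists
  rw [slope_def_field, hz] at h3
  have := hbefore t h4.1.le h4.2 i
  have : (g i t - 0) / (t - τ) < 0 := div_neg_of_pos_of_neg (by linarith) (by linarith [h4.2])
  linarith

lemma aux_exists {g : (Fin 4 → ℝ) → (Fin 4 → ℝ)} {C L : NNReal} (hL : LipschitzWith L g)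
    (hC : ∀ x, ‖g x‖ ≤ C) (x0 : Fin 4 → ℝ) :
    ∃ x : ℝ → Fin 4 → ℝ, x 0 = x0 ∧ ∀ t, HasDerivAt x (g (x t)) t := by
  have hloc : ∀ a : ℝ, ∃ γ : ℝ → Fin 4 → ℝ, γ 0 = x0 ∧
      ∀ t ∈ Ioo (-a) a, HasDerivAt γ (g (γ t)) t := by
    intro a
    rcases le_or_gt a 0 with ha | ha
    · exact ⟨fun _ => x0, rfl, fun t ht => absurd (ht.1.trans ht.2) (by linarith)⟩
    let A : NNReal := C * ⟨a, ha.le⟩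
    have hpl : IsPicardLindelof (fun _ => g) (tmin := -a) (tmax := a) ⟨0, by constructor <;> linarith⟩
        x0 A 0 C L := IsPicardLindelof.of_time_independent (fun x _ => hC x) hL.lipschitzOnWith
          (by simp only [sub_zero, zero_sub, neg_neg, max_self, NNReal.coe_zero]; exact le_rfl)
    obtain ⟨γ, h1, h2⟩ := hpl.exists_eq_forall_mem_Icc_hasDerivWithinAt₀
    exact ⟨γ, h1, fun t ht => (h2 t (Ioo_subset_Icc_self ht)).hasDerivAt (Icc_mem_nhds ht.1 ht.2)⟩
  choose γ h0 hγ using hloc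
  have hagree : ∀ a a', 0 < a → a ≤ a' → EqOn (γ a) (γ a') (Ioo (-a) a) := by
    intro a a' ha haa
    refine ODE_solution_unique_of_mem_Ioo (v := fun _ => g) (s := fun _ => univ) (t₀ := 0) (K := L)
      (fun t _ => hL.lipschitzOnWith) ⟨by linarith, ha⟩ (fun t ht => ⟨hγ a t ht, mem_univ _⟩)
      (fun t ht => ⟨hγ a' t ⟨by linarith [ht.1], by linarith [ht.2]⟩, mem_univ _⟩) (by rw [h0, h0])
  refine ⟨fun t => γ (|t| + 1) t, h0 _, fun t => ?_⟩
  have ht : |t| < |t| + 1 := by linarith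
  have ht' := abs_lt.1 ht
  refine (hγ (|t| + 1) t ht').congr_of_eventuallyEq ?_
  filter_upwards [Ioo_mem_nhds ht'.1 ht'.2] with s hs
  have hs' : s ∈ Ioo (-(|s| + 1)) (|s| + 1) := abs_lt.1 (by linarith)
  rcases le_total (|s| + 1) (|t| + 1) with h1 | h1
  · exact hagree _ _ (by positivity) h1 hs'
  · exact (hagree _ _ (by positivity) h1 hs).symm

lemma aux_clamp_exists {f : (Fin 4 → ℝ) → (Fin 4 → ℝ)} (hf : ContDiff ℝ 1 f)
    {lo hi x0 : Fin 4 → ℝ} (hlh : ∀ i, lo i ≤ hi i) (hx0 : ∀ i, lo i ≤ x0 i ∧ x0 i ≤ hi i)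
    (hlo : ∀ x : Fin 4 → ℝ, (∀ i, lo i ≤ x i ∧ x i ≤ hi i) → ∀ i, x i = lo i → 0 ≤ f x i)
    (hhi : ∀ x : Fin 4 → ℝ, (∀ i, lo i ≤ x i ∧ x i ≤ hi i) → ∀ i, x i = hi i → f x i ≤ 0) :
    ∃ x : ℝ → Fin 4 → ℝ, x 0 = x0 ∧ ∀ t, 0 ≤ t → HasDerivAt x (f (x t)) t ∧
      ∀ i, lo i ≤ x t i ∧ x t i ≤ hi i := by
  have hbox : IsCompact (Icc lo hi) := isCompact_Icc
  obtain ⟨L, hL⟩ := LocallyLipschitzOn.exists_lipschitzOnWith_of_compact hbox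
    (hf.locallyLipschitz.locallyLipschitzOn)
  obtain ⟨C, hC⟩ := hbox.exists_bound_of_continuousOn hf.continuous.continuousOn
  let cl : (Fin 4 → ℝ) → (Fin 4 → ℝ) := fun x i => max (lo i) (min (hi i) (x i))
  have hclm : ∀ x, cl x ∈ Icc lo hi := fun x =>
    ⟨fun i => le_max_left _ _, fun i => max_le (hlh i) (min_le_left _ _)⟩
  have hcl : LipschitzWith 1 cl := by
    refine LipschitzWith.of_dist_le_mul fun x y => ?_
    rw [NNReal.coe_one, one_mul]
    refine (dist_pi_le_iff dist_nonneg).2 fun i => ?_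
    refine le_trans ?_ (dist_le_pi_dist x y i)
    rw [Real.dist_eq, Real.dist_eq]
    refine (abs_max_sub_max_le_max _ _ _ _).trans ?_
    rw [sub_self, abs_zero]
    refine max_le (abs_nonneg _) ((abs_min_sub_min_le_max _ _ _ _).trans ?_)
    rw [sub_self, abs_zero]
    exact max_le (abs_nonneg _) le_rfl
  have hg : LipschitzWith (L * 1) (f ∘ cl) := by
    rw [← lipschitzOnWith_univ]
    exact hL.comp hcl.lipschitzOnWith (fun x _ => hclm x)
  obtain ⟨x, hx, hd⟩ := aux_exists hg (C := ⟨max C 0, le_max_right _ _⟩)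
    (fun y => (hC _ (hclm y)).trans (le_max_left _ _)) x0
  have hdi : ∀ i t, HasDerivAt (fun t => x t i) (f (cl (x t)) i) t := fun i t =>
    hasDerivAt_pi.1 (hd t) i
  have hup : ∀ t, 0 ≤ t → ∀ i, x t i ≤ hi i := by
    intro t ht i
    refine aux_stay (t0 := 0) (fun t _ => hdi i t) (by rw [hx]; exact (hx0 i).2) (fun s _ hs => ?_) t ht
    refine hhi _ (fun j => ⟨(hclm _).1 j, (hclm _).2 j⟩) i ?_
    change max (lo i) (min (hi i) (x s i)) = hi i
    rw [min_eq_left hs.le, max_eq_right (hlh i)]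
  have hdn : ∀ t, 0 ≤ t → ∀ i, lo i ≤ x t i := by
    intro t ht i
    have := aux_stay (u := fun t => - x t i) (t0 := 0) (c := - lo i) (fun t _ => (hdi i t).neg)
      (by simp only [hx]; linarith [(hx0 i).1]) (fun s _ hs => ?_) t ht
    · linarith
    · have h1 := hlo (cl (x s)) (fun j => ⟨(hclm _).1 j, (hclm _).2 j⟩) i ?_
      · linarith
      change max (lo i) (min (hi i) (x s i)) = lo i
      exact max_eq_left ((min_le_right _ _).trans (by linarith))
  refine ⟨x, hx, fun t ht => ⟨?_, fun i => ⟨hdn t ht i, hup t ht i⟩⟩⟩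
  have : cl (x t) = x t := by
    funext i
    change max (lo i) (min (hi i) (x t i)) = x t i
    rw [min_eq_right (hup t ht i), max_eq_right (hdn t ht i)]
  have h1 := hd t
  simp only [Function.comp, this] at h1
  exact h1

structure AuxPar where
  (b j ν a k1 δ νY k2 m μ p0 p1 p2 p3 : ℝ)
  hb : 0 < b
  hj : 0 < j
  hν : 0 < ν
  ha : 0 < a
  hk1 : 0 < k1
  hδ : 0 < δ
  hνY : 0 < νY
  hk2 : 0 < k2
  hm : 0 < m
  hμ : 0 < μ
  h0 : 0 < p0
  h1 : 0 < p1
  h2 : 0 < p2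
  h3 : 0 < p3
  hjp : j * p0 < 1
  hD : δ * νY < k1 * k2
  e0 : b * (1 - j * p0) * p2 = ν * p0
  e1 : a * p0 + δ * p2 = k1 * p1
  e2 : νY * p1 = k2 * p2
  e3 : m * p0 = μ * p3

structure AuxSol (P : AuxPar) (I Y F M : ℝ → ℝ) : Prop where
  dI : ∀ t, 0 ≤ t → HasDerivAt I (P.b * (1 - P.j * I t) * F t - P.ν * I t) t
  dY : ∀ t, 0 ≤ t → HasDerivAt Y (P.a * I t - P.k1 * Y t + P.δ * F t) t
  dF : ∀ t, 0 ≤ t → HasDerivAt F (P.νY * Y t - P.k2 * F t) t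
  dM : ∀ t, 0 ≤ t → HasDerivAt M (P.m * I t - P.μ * M t) t
  nI : ∀ t, 0 ≤ t → 0 ≤ I t
  nY : ∀ t, 0 ≤ t → 0 ≤ Y t
  nF : ∀ t, 0 ≤ t → 0 ≤ F t
  nM : ∀ t, 0 ≤ t → 0 ≤ M t
  nz : ∀ t, 0 ≤ t → ¬ (I t = 0 ∧ Y t = 0 ∧ F t = 0)

structure AuxSub (P : AuxPar) (v0 v1 v2 v3 : ℝ) : Prop where
  p0 : 0 < v0
  p1 : 0 < v1
  p2 : 0 < v2
  p3 : 0 < v3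
  hj : P.j * v0 < 1
  r0 : 0 < P.b * (1 - P.j * v0) * v2 - P.ν * v0
  r1 : 0 < P.a * v0 - P.k1 * v1 + P.δ * v2
  r2 : 0 < P.νY * v1 - P.k2 * v2
  r3 : 0 < P.m * v0 - P.μ * v3

structure AuxSup (P : AuxPar) (v0 v1 v2 v3 : ℝ) : Prop where
  hj : P.j * v0 < 1
  r0 : P.b * (1 - P.j * v0) * v2 - P.ν * v0 < 0
  r1 : P.a * v0 - P.k1 * v1 + P.δ * v2 < 0
  r2 : P.νY * v1 - P.k2 * v2 < 0
  r3 : P.m * v0 - P.μ * v3 < 0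

variable {P : AuxPar} {I Y F M : ℝ → ℝ}

lemma aux_zero {u : ℝ → ℝ} {u' t : ℝ} (ht : 0 < t) (hn : ∀ s, 0 ≤ s → 0 ≤ u s)
    (hd : HasDerivAt u u' t) (h0 : u t = 0) : u' = 0 := by
  refine IsLocalMin.hasDerivAt_eq_zero (f := u) (a := t) ?_ hd
  filter_upwards [lt_mem_nhds ht] with s hs
  rw [h0]; exact hn s hs.le

lemma AuxSol.pos (S : AuxSol P I Y F M) {t : ℝ} (ht : 0 < t) :
    0 < I t ∧ 0 < Y t ∧ 0 < F t ∧ 0 < M t := by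
  have h0 := ht.le
  have hIF : I t = 0 → F t = 0 := fun h => by
    have := aux_zero ht S.nI (S.dI t h0) h
    rw [h] at this
    simpa [P.hb.ne'] using this
  have hFY : F t = 0 → Y t = 0 := fun h => by
    have := aux_zero ht S.nF (S.dF t h0) h
    rw [h] at this
    simpa [P.hνY.ne'] using this
  have hYI : Y t = 0 → I t = 0 := fun h => by
    have := aux_zero ht S.nY (S.dY t h0) h
    rw [h] at this
    have h1 := mul_nonneg P.hδ.le (S.nF t h0)
    have h2 := mul_nonneg P.ha.le (S.nI t h0)
    have h3 : P.a * I t = 0 := by linarith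
    simpa [P.ha.ne'] using h3
  have nz := S.nz t h0
  have hI : I t ≠ 0 := fun h => nz ⟨h, hFY (hIF h), hIF h⟩
  have hF : F t ≠ 0 := fun h => hI (hYI (hFY h))
  have hY : Y t ≠ 0 := fun h => hI (hYI h)
  have hM : M t ≠ 0 := fun h => by
    have := aux_zero ht S.nM (S.dM t h0) h
    rw [h] at this
    apply hI
    simpa [P.hm.ne'] using this
  exact ⟨(S.nI t h0).lt_of_ne' hI, (S.nY t h0).lt_of_ne' hY, (S.nF t h0).lt_of_ne' hF,
    (S.nM t h0).lt_of_ne' hM⟩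

lemma AuxSol.sub_inv (S : AuxSol P I Y F M) {v0 v1 v2 v3 : ℝ} (hv : AuxSub P v0 v1 v2 v3)
    {t0 : ℝ} (ht0 : 0 ≤ t0) (h0 : v0 < I t0) (h1 : v1 < Y t0) (h2 : v2 < F t0) (h3 : v3 < M t0) :
    ∀ t, t0 ≤ t → v0 < I t ∧ v1 < Y t ∧ v2 < F t ∧ v3 < M t := by
  have key := aux_inv (n := 4) (t0 := t0)
    (g := ![fun t => I t - v0, fun t => Y t - v1, fun t => F t - v2, fun t => M t - v3])
    (g' := ![fun t => P.b * (1 - P.j * I t) * F t - P.ν * I t,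
      fun t => P.a * I t - P.k1 * Y t + P.δ * F t, fun t => P.νY * Y t - P.k2 * F t,
      fun t => P.m * I t - P.μ * M t])
    (by
      simp only [Fin.forall_fin_succ]
      exact ⟨fun t ht => (S.dI t (ht0.trans ht)).sub_const _,
        fun t ht => (S.dY t (ht0.trans ht)).sub_const _,
        fun t ht => (S.dF t (ht0.trans ht)).sub_const _,
        fun t ht => (S.dM t (ht0.trans ht)).sub_const _, fun i => i.elim0⟩)
    (by simp [Fin.forall_fin_succ, h0, h1, h2, h3])
    (by
      intro t ht hnn
      simp [Fin.forall_fin_succ] at hnn ⊢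
      obtain ⟨g0, g1, g2, g3⟩ := hnn
      have a0 := P.hb; have a1 := P.ha; have a2 := P.hδ; have a3 := P.hνY; have a4 := P.hm
      refine ⟨fun h => ?_, fun h => ?_, fun h => ?_, fun h => ?_⟩
      · have e : I t = v0 := by linarith
        rw [e]
        have : 0 ≤ P.b * (1 - P.j * v0) := mul_nonneg a0.le (by linarith [hv.hj])
        linarith [mul_le_mul_of_nonneg_left g2 this, hv.r0]
      · have e : Y t = v1 := by linarith
        rw [e]
        linarith [mul_le_mul_of_nonneg_left g0 a1.le, mul_le_mul_of_nonneg_left g2 a2.le, hv.r1]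
      · have e : F t = v2 := by linarith
        rw [e]
        linarith [mul_le_mul_of_nonneg_left g1 a3.le, hv.r2]
      · have e : M t = v3 := by linarith
        rw [e]
        linarith [mul_le_mul_of_nonneg_left g0 a4.le, hv.r3])
  intro t ht
  have := key t ht
  simpa [Fin.forall_fin_succ] using this

lemma AuxSol.sup_inv (S : AuxSol P I Y F M) {v0 v1 v2 v3 : ℝ} (hv : AuxSup P v0 v1 v2 v3)
    {t0 : ℝ} (ht0 : 0 ≤ t0) (h0 : I t0 < v0) (h1 : Y t0 < v1) (h2 : F t0 < v2) (h3 : M t0 < v3) :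
    ∀ t, t0 ≤ t → I t < v0 ∧ Y t < v1 ∧ F t < v2 ∧ M t < v3 := by
  have key := aux_inv (n := 4) (t0 := t0)
    (g := ![fun t => v0 - I t, fun t => v1 - Y t, fun t => v2 - F t, fun t => v3 - M t])
    (g' := ![fun t => -(P.b * (1 - P.j * I t) * F t - P.ν * I t),
      fun t => -(P.a * I t - P.k1 * Y t + P.δ * F t), fun t => -(P.νY * Y t - P.k2 * F t),
      fun t => -(P.m * I t - P.μ * M t)])
    (by
      simp only [Fin.forall_fin_succ]
      exact ⟨fun t ht => (S.dI t (ht0.trans ht)).const_sub _,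
        fun t ht => (S.dY t (ht0.trans ht)).const_sub _,
        fun t ht => (S.dF t (ht0.trans ht)).const_sub _,
        fun t ht => (S.dM t (ht0.trans ht)).const_sub _, fun i => i.elim0⟩)
    (by simp [Fin.forall_fin_succ, h0, h1, h2, h3])
    (by
      intro t ht hnn
      simp [Fin.forall_fin_succ] at hnn ⊢
      obtain ⟨g0, g1, g2, g3⟩ := hnn
      have a0 := P.hb; have a1 := P.ha; have a2 := P.hδ; have a3 := P.hνY; have a4 := P.hm
      refine ⟨fun h => ?_, fun h => ?_, fun h => ?_, fun h => ?_⟩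
      · have e : I t = v0 := by linarith
        rw [e]
        have : 0 ≤ P.b * (1 - P.j * v0) := mul_nonneg a0.le (by linarith [hv.hj])
        linarith [mul_le_mul_of_nonneg_left g2 this, hv.r0]
      · have e : Y t = v1 := by linarith
        rw [e]
        linarith [mul_le_mul_of_nonneg_left g0 a1.le, mul_le_mul_of_nonneg_left g2 a2.le, hv.r1]
      · have e : F t = v2 := by linarith
        rw [e]
        linarith [mul_le_mul_of_nonneg_left g1 a3.le, hv.r2]
      · have e : M t = v3 := by linarith
        rw [e]
        linarith [mul_le_mul_of_nonneg_left g0 a4.le, hv.r3])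
  intro t ht
  have := key t ht
  simpa [Fin.forall_fin_succ] using this

lemma AuxSub.smul {v0 v1 v2 v3 : ℝ} (hv : AuxSub P v0 v1 v2 v3) {s : ℝ} (hs : 0 < s) (hs1 : s ≤ 1) :
    AuxSub P (s * v0) (s * v1) (s * v2) (s * v3) := by
  obtain ⟨p0, p1, p2, p3, hj, r0, r1, r2, r3⟩ := hv
  have hjv : P.j * (s * v0) ≤ P.j * v0 := by
    have : s * v0 ≤ 1 * v0 := mul_le_mul_of_nonneg_right hs1 p0.le
    exact mul_le_mul_of_nonneg_left (by linarith) P.hj.le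
  refine ⟨by positivity, by positivity, by positivity, by positivity, by linarith, ?_, ?_, ?_, ?_⟩
  · have h1 : P.b * s * v2 * (P.j * (s * v0)) ≤ P.b * s * v2 * (P.j * v0) :=
      mul_le_mul_of_nonneg_left hjv (by have := P.hb; positivity)
    have h2 := mul_pos hs r0
    nlinarith
  · have h2 := mul_pos hs r1
    nlinarith
  · have h2 := mul_pos hs r2
    nlinarith
  · have h2 := mul_pos hs r3
    nlinarith

lemma AuxPar.dir (P : AuxPar) : ∃ w0 w1 w2 w3 : ℝ, 0 < w0 ∧ 0 < w1 ∧ 0 < w2 ∧ 0 < w3 ∧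
    P.b * (1 - P.j * P.p0) * w2 - (P.b * P.j * P.p2 + P.ν) * w0 < 0 ∧
    P.a * w0 - P.k1 * w1 + P.δ * w2 < 0 ∧ P.νY * w1 - P.k2 * w2 < 0 ∧
    P.m * w0 - P.μ * w3 < 0 := by
  obtain ⟨b, j, ν, a, k1, δ, νY, k2, m, μ, p0, p1, p2, p3, hb, hj, hν, ha, hk1, hδ, hνY, hk2, hm,
    hμ, h0, h1, h2, h3, hjp, hD, e0, e1, e2, e3⟩ := P
  simp only
  have he : 0 < δ * νY + k1 * k2 := by positivity
  obtain ⟨η, hη, hη'⟩ : ∃ η, 0 < η ∧ η * (δ * νY + k1 * k2) = p0 * p2 * j :=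
    ⟨p0 * p2 * j / (δ * νY + k1 * k2), by positivity, by field_simp⟩
  refine ⟨p0, p1 + η * (2 * δ * k2), p2 + η * (δ * νY + k1 * k2), p3 + 1, h0, by positivity,
    by positivity, by positivity, ?_, ?_, ?_, ?_⟩
  · rw [hη']
    have h4 : 0 < b * j * p2 * p0 * (j * p0) := by positivity
    nlinarith
  · have h4 : 0 < η * δ * (k1 * k2 - δ * νY) := by
      have : 0 < k1 * k2 - δ * νY := by linarith
      positivity
    nlinarith
  · have h4 : 0 < η * k2 * (k1 * k2 - δ * νY) := by
      have : 0 < k1 * k2 - δ * νY := by linarith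
      positivity
    nlinarith
  · nlinarith

lemma AuxPar.good (P : AuxPar) : ∃ w0 w1 w2 w3 : ℝ, 0 < w0 ∧ 0 < w1 ∧ 0 < w2 ∧ 0 < w3 ∧
    ∀ ε > 0, ∃ θ > 0, θ * w0 < ε ∧ θ * w1 < ε ∧ θ * w2 < ε ∧ θ * w3 < ε ∧
      AuxSub P (P.p0 - θ * w0) (P.p1 - θ * w1) (P.p2 - θ * w2) (P.p3 - θ * w3) ∧
      AuxSup P (P.p0 + θ * w0) (P.p1 + θ * w1) (P.p2 + θ * w2) (P.p3 + θ * w3) := by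
  obtain ⟨w0, w1, w2, w3, q0, q1, q2, q3, J0, J1, J2, J3⟩ := P.dir
  refine ⟨w0, w1, w2, w3, q0, q1, q2, q3, fun ε hε => ?_⟩
  have sm : ∀ c d : ℝ, 0 < d → ∀ᶠ θ in 𝓝[>] (0:ℝ), θ * c < d := by
    intro c d hd
    have : Tendsto (fun θ : ℝ => θ * c) (𝓝[>] 0) (𝓝 (0 * c)) :=
      ((continuous_id.mul continuous_const).tendsto 0).mono_left nhdsWithin_le_nhds
    rw [zero_mul] at this
    exact this.eventually (gt_mem_nhds hd)
  have hall := (sm w0 ε hε).and ((sm w1 ε hε).and ((sm w2 ε hε).and ((sm w3 ε hε).and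
    ((sm w0 _ P.h0).and ((sm w1 _ P.h1).and ((sm w2 _ P.h2).and ((sm w3 _ P.h3).and
    ((sm (P.j * w0) (1 - P.j * P.p0) (by linarith [P.hjp])).and
    ((sm (P.b * P.j * w0 * w2)
      (-(P.b * (1 - P.j * P.p0) * w2 - (P.b * P.j * P.p2 + P.ν) * w0)) (by linarith)).and
      self_mem_nhdsWithin)))))))))
  obtain ⟨θ, c0, c1, c2, c3, d0, d1, d2, d3, hj, hq, hθ⟩ := hall.exists
  have hθ : 0 < θ := hθ
  have J0' := mul_pos_of_neg_of_neg J0 (neg_lt_zero.2 hθ)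
  have J1' := mul_pos_of_neg_of_neg J1 (neg_lt_zero.2 hθ)
  have J2' := mul_pos_of_neg_of_neg J2 (neg_lt_zero.2 hθ)
  have J3' := mul_pos_of_neg_of_neg J3 (neg_lt_zero.2 hθ)
  have hq' := mul_lt_mul_of_pos_left hq hθ
  have hx : 0 < P.b * P.j * w0 * w2 * θ * θ := by have := P.hb; have := P.hj; positivity
  have e0 := P.e0; have e1 := P.e1; have e2 := P.e2; have e3 := P.e3
  have hjw : 0 < P.j * w0 * θ := by have := P.hj; positivity
  refine ⟨θ, hθ, c0, c1, c2, c3, ⟨by linarith, by linarith, by linarith, by linarith, ?_, ?_, ?_, ?_, ?_⟩,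
    ⟨?_, ?_, ?_, ?_, ?_⟩⟩
  · linarith [P.hjp]
  · linarith
  · linarith
  · linarith
  · linarith
  · linarith [P.hjp]
  · linarith
  · linarith
  · linarith
  · linarith

lemma AuxSol.persist (S : AuxSol P I Y F M) : ∃ s > 0, ∀ t, 1 ≤ t → s < I t := by
  obtain ⟨w0, w1, w2, w3, _, _, _, _, h⟩ := P.good
  obtain ⟨θ, _, _, _, _, _, hv, _⟩ := h 1 one_pos
  generalize P.p0 - θ * w0 = v0, P.p1 - θ * w1 = v1, P.p2 - θ * w2 = v2, P.p3 - θ * w3 = v3 at hv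
  obtain ⟨a0, a1, a2, a3⟩ := S.pos one_pos
  have sm : ∀ c d : ℝ, 0 < d → ∀ᶠ θ in 𝓝[>] (0:ℝ), θ * c < d := by
    intro c d hd
    have : Tendsto (fun θ : ℝ => θ * c) (𝓝[>] 0) (𝓝 (0 * c)) :=
      ((continuous_id.mul continuous_const).tendsto 0).mono_left nhdsWithin_le_nhds
    rw [zero_mul] at this
    exact this.eventually (gt_mem_nhds hd)
  obtain ⟨s, b0, b1, b2, b3, b4, hs⟩ := ((sm v0 _ a0).and ((sm v1 _ a1).and ((sm v2 _ a2).and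
    ((sm v3 _ a3).and ((sm 1 1 one_pos).and self_mem_nhdsWithin))))).exists
  have hs : 0 < s := hs
  have hv' := hv.smul hs (by linarith)
  exact ⟨s * v0, hv'.p0, fun t ht => (S.sub_inv hv' zero_le_one b0 b1 b2 b3 t ht).1⟩

lemma AuxSol.I_le (S : AuxSol P I Y F M) : ∃ T, 0 ≤ T ∧ ∀ t, T ≤ t → P.j * I t ≤ 1 := by
  have hj := P.hj
  have hdec : ∀ t, 0 ≤ t → 1 ≤ P.j * I t →
      P.j * (P.b * (1 - P.j * I t) * F t - P.ν * I t) ≤ - P.ν := by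
    intro t ht h
    have h1 : 0 ≤ P.j * P.b * (P.j * I t - 1) * F t :=
      mul_nonneg (mul_nonneg (mul_nonneg hj.le P.hb.le) (by linarith)) (S.nF t ht)
    have h2 := mul_le_mul_of_nonneg_left h P.hν.le
    nlinarith
  obtain ⟨T, hT, hT1⟩ : ∃ T, 0 ≤ T ∧ P.j * I T ≤ 1 := by
    by_contra! hc
    have key : ∀ t, 0 ≤ t → P.j * I t + P.ν * t ≤ P.j * I 0 + P.ν * 0 := by
      intro t ht
      refine aux_anti (u := fun t => P.j * I t + P.ν * t)
        (u' := fun t => P.j * (P.b * (1 - P.j * I t) * F t - P.ν * I t) + P.ν * 1) ht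
        (fun s hs => ((S.dI s hs.1).const_mul _).add ((hasDerivAt_id s).const_mul _)) (fun s hs => ?_)
      have := hdec s hs.1 (hc s hs.1).le
      linarith
    have h0 := S.nI 0 le_rfl
    have ht : 0 ≤ P.j * I 0 / P.ν := div_nonneg (mul_nonneg hj.le h0) P.hν.le
    have h1 := key _ ht
    rw [mul_div_cancel₀ _ P.hν.ne'] at h1
    linarith [hc _ ht]
  refine ⟨T, hT, aux_stay (u := fun t => P.j * I t) (fun t ht => (S.dI t (hT.trans ht)).const_mul _)
    hT1 (fun t ht h => ?_)⟩
  have := hdec t (hT.trans ht) h.le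
  linarith [P.hν]

lemma AuxSol.YF_le (S : AuxSol P I Y F M) : ∃ C T, 0 ≤ T ∧ ∀ t, T ≤ t → Y t ≤ C ∧ F t ≤ C := by
  obtain ⟨T, hT, hI⟩ := S.I_le
  have hj := P.hj
  have hνY := P.hνY
  have hk1 := P.hk1
  have hk2 := P.hk2
  have hδ := P.hδ
  have ha := P.ha
  have hD : 0 < P.k1 * P.k2 - P.δ * P.νY := by linarith [P.hD]
  -- the functional p Y + q F
  set p := 2 * P.νY * P.k2 with hp
  set q := P.δ * P.νY + P.k1 * P.k2 with hq
  have hp0 : 0 < p := by positivity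
  have hq0 : 0 < q := by positivity
  set l1 := P.νY * (P.k1 * P.k2 - P.δ * P.νY) with hl1
  set l2 := P.k2 * (P.k1 * P.k2 - P.δ * P.νY) with hl2
  have hl1p : 0 < l1 := by positivity
  have hl2p : 0 < l2 := by positivity
  obtain ⟨l, hl, hlp, hlq⟩ : ∃ l, 0 < l ∧ l * p ≤ l1 ∧ l * q ≤ l2 :=
    ⟨min (l1 / p) (l2 / q), by positivity,
      (mul_le_mul_of_nonneg_right (min_le_left _ _) hp0.le).trans (by rw [div_mul_cancel₀ _ hp0.ne']),
      (mul_le_mul_of_nonneg_right (min_le_right _ _) hq0.le).trans (by rw [div_mul_cancel₀ _ hq0.ne'])⟩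
  set A := p * P.a / P.j with hA
  have hd := aux_decay (u := fun t => p * Y t + q * F t)
    (u' := fun t => p * (P.a * I t - P.k1 * Y t + P.δ * F t) + q * (P.νY * Y t - P.k2 * F t))
    (t0 := T) (a := A) (k := l) hl
    (fun t ht => ((S.dY t (hT.trans ht)).const_mul _).add ((S.dF t (hT.trans ht)).const_mul _))
    (fun t ht => by
      have h1 : p * P.a * I t ≤ A := by
        rw [hA, le_div_iff₀ hj]
        have := mul_le_mul_of_nonneg_left (hI t ht) (show 0 ≤ p * P.a by positivity)
        linarith
      have h2 := mul_le_mul_of_nonneg_right hlp (S.nY t (hT.trans ht))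
      have h3 := mul_le_mul_of_nonneg_right hlq (S.nF t (hT.trans ht))
      have h4 : p * P.k1 - q * P.νY = l1 := by rw [hp, hq, hl1]; ring
      have h5 : q * P.k2 - p * P.δ = l2 := by rw [hp, hq, hl2]; ring
      have h6 : (p * P.k1 - q * P.νY) * Y t = l1 * Y t := by rw [h4]
      have h7 : (q * P.k2 - p * P.δ) * F t = l2 * F t := by rw [h5]
      linarith) 1 one_pos
  obtain ⟨T', hT'⟩ := eventually_atTop.1 hd
  refine ⟨max ((A / l + 1) / p) ((A / l + 1) / q), max T T', le_max_of_le_left hT, fun t ht => ?_⟩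
  have h0 : 0 ≤ t := hT.trans ((le_max_left _ _).trans ht)
  have h1 := hT' t ((le_max_right _ _).trans ht)
  have h2 := mul_nonneg hp0.le (S.nY t h0)
  have h3 := mul_nonneg hq0.le (S.nF t h0)
  constructor
  · refine le_max_of_le_left ((le_div_iff₀ hp0).2 ?_)
    linarith
  · refine le_max_of_le_right ((le_div_iff₀ hq0).2 ?_)
    linarith

lemma aux_limsup {u : ℝ → ℝ} {c C : ℝ} (hc : ∀ᶠ t in atTop, c ≤ u t) (hC : ∀ᶠ t in atTop, u t ≤ C) :
    ∃ L, c ≤ L ∧ L ≤ C ∧ (∀ ε > 0, ∀ᶠ t in atTop, u t ≤ L + ε) ∧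
      ∀ B, (∀ ε > 0, ∀ᶠ t in atTop, u t ≤ B + ε) → L ≤ B := by
  set s : Set ℝ := {A | ∀ᶠ t in atTop, u t ≤ A} with hs
  have hbd : BddBelow s := ⟨c, fun A hA => by
    obtain ⟨t, h1, h2⟩ := (hc.and hA).exists
    exact h1.trans h2⟩
  have hne : s.Nonempty := ⟨C, hC⟩
  refine ⟨sInf s, le_csInf hne fun A hA => ?_, csInf_le hbd hC, fun ε hε => ?_, fun B hB => ?_⟩
  · obtain ⟨t, h1, h2⟩ := (hc.and hA).exists
    exact h1.trans h2
  · obtain ⟨A, hA, hlt⟩ := exists_lt_of_csInf_lt hne (show sInf s < sInf s + ε by linarith)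
    filter_upwards [hA] with t ht
    linarith
  · exact le_of_forall_pos_le_add fun ε hε => csInf_le hbd (hB ε hε)

lemma aux_liminf {u : ℝ → ℝ} {c C : ℝ} (hc : ∀ᶠ t in atTop, c ≤ u t) (hC : ∀ᶠ t in atTop, u t ≤ C) :
    ∃ L, c ≤ L ∧ L ≤ C ∧ (∀ ε > 0, ∀ᶠ t in atTop, L - ε ≤ u t) ∧
      ∀ B, (∀ ε > 0, ∀ᶠ t in atTop, B - ε ≤ u t) → B ≤ L := by
  obtain ⟨L, h1, h2, h3, h4⟩ := aux_limsup (u := fun t => - u t) (c := -C) (C := -c)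
    (hC.mono fun t h => by linarith) (hc.mono fun t h => by linarith)
  refine ⟨-L, by linarith, by linarith, fun ε hε => (h3 ε hε).mono fun t h => by linarith,
    fun B hB => ?_⟩
  have := h4 (-B) fun ε hε => (hB ε hε).mono fun t h => by linarith
  linarith

lemma aux_asym_le {u u' : ℝ → ℝ} {A c k : ℝ} (hk : 0 < k) (hc : 0 < c)
    (hd : ∀ t, 0 ≤ t → HasDerivAt u (u' t) t)
    (h : ∀ η > 0, ∀ᶠ t in atTop, u' t ≤ A + c * η - k * u t) :
    ∀ ε > 0, ∀ᶠ t in atTop, u t ≤ A / k + ε := by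
  intro ε hε
  obtain ⟨T, hT⟩ := eventually_atTop.1 (h (k * (ε / 2) / c) (by positivity))
  have := aux_decay (u := u) (u' := u') (t0 := max T 0) hk
    (fun t ht => hd t ((le_max_right _ _).trans ht))
    (fun t ht => hT t ((le_max_left _ _).trans ht)) (ε / 2) (by positivity)
  filter_upwards [this] with t ht
  have e : (A + c * (k * (ε / 2) / c)) / k = A / k + ε / 2 := by field_simp
  rw [e] at ht
  linarith

lemma aux_asym_ge {u u' : ℝ → ℝ} {A c k : ℝ} (hk : 0 < k) (hc : 0 < c)
    (hd : ∀ t, 0 ≤ t → HasDerivAt u (u' t) t)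
    (h : ∀ η > 0, ∀ᶠ t in atTop, A - c * η - k * u t ≤ u' t) :
    ∀ ε > 0, ∀ᶠ t in atTop, A / k - ε ≤ u t := by
  intro ε hε
  have := aux_asym_le (u := fun t => - u t) (u' := fun t => - u' t) (A := -A) hk hc
    (fun t ht => (hd t ht).neg) (fun η hη => (h η hη).mono fun t ht => by linarith) ε hε
  filter_upwards [this] with t ht
  rw [neg_div] at ht
  linarith

lemma AuxSol.upper (S : AuxSol P I Y F M) : ∀ ε > 0, ∀ᶠ t in atTop,
    I t ≤ P.p0 + ε ∧ Y t ≤ P.p1 + ε ∧ F t ≤ P.p2 + ε ∧ M t ≤ P.p3 + ε := by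
  obtain ⟨T, hT, hI⟩ := S.I_le
  obtain ⟨C, T', hT', hYF⟩ := S.YF_le
  have hj := P.hj; have hνY := P.hνY; have hk1 := P.hk1; have hk2 := P.hk2; have hδ := P.hδ
  have ha := P.ha; have hb := P.hb; have hν := P.hν; have hm := P.hm; have hμ := P.hμ
  have e0 := P.e0; have e1 := P.e1; have e2 := P.e2; have e3 := P.e3
  have hp0 := P.h0; have hp2 := P.h2
  have hge := eventually_ge_atTop (0 : ℝ)
  have hIe : ∀ᶠ t in atTop, P.j * I t ≤ 1 := (eventually_ge_atTop T).mono hI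
  obtain ⟨LI, i1, i2, i3, i4⟩ := aux_limsup (u := I) (c := 0) (C := 1 / P.j) (hge.mono S.nI)
    (hIe.mono fun t h => by rw [le_div_iff₀ hj]; linarith)
  obtain ⟨LY, y1, y2, y3, y4⟩ := aux_limsup (u := Y) (c := 0) (C := C) (hge.mono S.nY)
    ((eventually_ge_atTop T').mono fun t h => (hYF t h).1)
  obtain ⟨LF, f1, f2, f3, f4⟩ := aux_limsup (u := F) (c := 0) (C := C) (hge.mono S.nF)
    ((eventually_ge_atTop T').mono fun t h => (hYF t h).2)
  have hkI : 0 < P.b * LF * P.j + P.ν := by positivity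
  have A1 : LY ≤ (P.a * LI + P.δ * LF) / P.k1 := by
    refine y4 _ (aux_asym_le hk1 (show 0 < P.a + P.δ by positivity) S.dY fun η hη => ?_)
    filter_upwards [i3 η hη, f3 η hη] with t h1 h2
    linarith [mul_le_mul_of_nonneg_left h1 ha.le, mul_le_mul_of_nonneg_left h2 hδ.le]
  have A2 : LF ≤ (P.νY * LY) / P.k2 := by
    refine f4 _ (aux_asym_le hk2 hνY S.dF fun η hη => ?_)
    filter_upwards [y3 η hη] with t h1
    linarith [mul_le_mul_of_nonneg_left h1 hνY.le]
  have A0 : LI ≤ (P.b * LF) / (P.b * LF * P.j + P.ν) := by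
    refine i4 _ (aux_asym_le hkI hb S.dI fun η hη => ?_)
    filter_upwards [f3 η hη, hIe, hge] with t h1 h2 h3
    have h4 := mul_le_mul_of_nonneg_left h1 (mul_nonneg hb.le (sub_nonneg.2 h2))
    have h5 : 0 ≤ P.b * η * (P.j * I t) := mul_nonneg (by positivity) (mul_nonneg hj.le (S.nI t h3))
    nlinarith
  rw [le_div_iff₀ hk1] at A1
  rw [le_div_iff₀ hk2] at A2
  rw [le_div_iff₀ hkI] at A0
  have hD : 0 < P.k1 * P.k2 - P.δ * P.νY := by linarith [P.hD]
  have B1 : (P.k1 * P.k2 - P.δ * P.νY) * LF ≤ P.a * P.νY * LI := by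
    linarith [mul_le_mul_of_nonneg_left A2 hk1.le, mul_le_mul_of_nonneg_left A1 hνY.le]
  have B2 : (P.k1 * P.k2 - P.δ * P.νY) * P.p2 = P.a * P.νY * P.p0 := by
    linear_combination (-P.k1) * e2 - P.νY * e1
  have B3 : P.p0 * LF ≤ P.p2 * LI := by
    have h1 : P.a * P.νY * (P.p0 * LF) ≤ P.a * P.νY * (P.p2 * LI) := by
      have h2 := mul_le_mul_of_nonneg_left B1 hp2.le
      have h3 : P.a * P.νY * (P.p0 * LF) = P.p2 * ((P.k1 * P.k2 - P.δ * P.νY) * LF) := by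
        linear_combination (-LF) * B2
      linarith
    exact le_of_mul_le_mul_left h1 (by positivity)
  have hjL : P.j * LI ≤ 1 := by rw [le_div_iff₀ hj] at i2; linarith
  have CI : LI ≤ P.p0 := by
    rcases i1.eq_or_lt with h | h
    · rw [← h]; exact hp0.le
    have h1 := mul_le_mul_of_nonneg_left B3 (mul_nonneg hb.le (sub_nonneg.2 hjL))
    have h2 := mul_le_mul_of_nonneg_left A0 hp0.le
    have h3 : (P.b * P.p2 * P.j * LI) * LI ≤ (P.b * P.p2 * P.j * LI) * P.p0 := by
      have h4 : LI * (P.b * (1 - P.j * P.p0) * P.p2) = LI * (P.ν * P.p0) := by rw [e0]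
      linarith
    exact le_of_mul_le_mul_left h3 (by positivity)
  have CF : LF ≤ P.p2 := by
    refine le_of_mul_le_mul_left (B1.trans ?_) hD
    rw [B2]
    exact mul_le_mul_of_nonneg_left CI (by positivity)
  have CY : LY ≤ P.p1 := by
    refine le_of_mul_le_mul_left (a := P.k1) ?_ hk1
    linarith [mul_le_mul_of_nonneg_left CI ha.le, mul_le_mul_of_nonneg_left CF hδ.le]
  have CM : ∀ ε > 0, ∀ᶠ t in atTop, M t ≤ P.m * P.p0 / P.μ + ε := by
    refine aux_asym_le hμ hm S.dM fun η hη => ?_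
    filter_upwards [i3 η hη] with t h1
    have h2 : I t ≤ P.p0 + η := by linarith
    linarith [mul_le_mul_of_nonneg_left h2 hm.le]
  rw [e3, mul_div_cancel_left₀ _ hμ.ne'] at CM
  intro ε hε
  filter_upwards [i3 ε hε, y3 ε hε, f3 ε hε, CM ε hε] with t h1 h2 h3 h4
  exact ⟨by linarith, by linarith, by linarith, h4⟩

lemma AuxSol.lower (S : AuxSol P I Y F M) : ∀ ε > 0, ∀ᶠ t in atTop,
    P.p0 - ε ≤ I t ∧ P.p1 - ε ≤ Y t ∧ P.p2 - ε ≤ F t ∧ P.p3 - ε ≤ M t := by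
  obtain ⟨T, hT, hI⟩ := S.I_le
  obtain ⟨C, T', hT', hYF⟩ := S.YF_le
  obtain ⟨s, hs, hsI⟩ := S.persist
  have hj := P.hj; have hνY := P.hνY; have hk1 := P.hk1; have hk2 := P.hk2; have hδ := P.hδ
  have ha := P.ha; have hb := P.hb; have hν := P.hν; have hm := P.hm; have hμ := P.hμ
  have e0 := P.e0; have e1 := P.e1; have e2 := P.e2; have e3 := P.e3
  have hp0 := P.h0; have hp2 := P.h2
  have hge := eventually_ge_atTop (0 : ℝ)
  have hIe : ∀ᶠ t in atTop, P.j * I t ≤ 1 := (eventually_ge_atTop T).mono hI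
  obtain ⟨LI, i1, i2, i3, i4⟩ := aux_liminf (u := I) (c := s) (C := 1 / P.j)
    ((eventually_ge_atTop 1).mono fun t h => (hsI t h).le)
    (hIe.mono fun t h => by rw [le_div_iff₀ hj]; linarith)
  obtain ⟨LY, y1, y2, y3, y4⟩ := aux_liminf (u := Y) (c := 0) (C := C) (hge.mono S.nY)
    ((eventually_ge_atTop T').mono fun t h => (hYF t h).1)
  obtain ⟨LF, f1, f2, f3, f4⟩ := aux_liminf (u := F) (c := 0) (C := C) (hge.mono S.nF)
    ((eventually_ge_atTop T').mono fun t h => (hYF t h).2)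
  have hkI : 0 < P.b * LF * P.j + P.ν := by positivity
  have A1 : (P.a * LI + P.δ * LF) / P.k1 ≤ LY := by
    refine y4 _ (aux_asym_ge hk1 (show 0 < P.a + P.δ by positivity) S.dY fun η hη => ?_)
    filter_upwards [i3 η hη, f3 η hη] with t h1 h2
    linarith [mul_le_mul_of_nonneg_left h1 ha.le, mul_le_mul_of_nonneg_left h2 hδ.le]
  have A2 : (P.νY * LY) / P.k2 ≤ LF := by
    refine f4 _ (aux_asym_ge hk2 hνY S.dF fun η hη => ?_)
    filter_upwards [y3 η hη] with t h1
    linarith [mul_le_mul_of_nonneg_left h1 hνY.le]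
  have A0 : (P.b * LF) / (P.b * LF * P.j + P.ν) ≤ LI := by
    refine i4 _ (aux_asym_ge hkI hb S.dI fun η hη => ?_)
    filter_upwards [f3 η hη, hIe, hge] with t h1 h2 h3
    have h4 := mul_le_mul_of_nonneg_left h1 (mul_nonneg hb.le (sub_nonneg.2 h2))
    have h5 : 0 ≤ P.b * η * (P.j * I t) := mul_nonneg (by positivity) (mul_nonneg hj.le (S.nI t h3))
    nlinarith
  rw [div_le_iff₀ hk1] at A1
  rw [div_le_iff₀ hk2] at A2
  rw [div_le_iff₀ hkI] at A0
  have hLI : 0 < LI := by linarith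
  have hD : 0 < P.k1 * P.k2 - P.δ * P.νY := by linarith [P.hD]
  have B1 : P.a * P.νY * LI ≤ (P.k1 * P.k2 - P.δ * P.νY) * LF := by
    linarith [mul_le_mul_of_nonneg_left A2 hk1.le, mul_le_mul_of_nonneg_left A1 hνY.le]
  have B2 : (P.k1 * P.k2 - P.δ * P.νY) * P.p2 = P.a * P.νY * P.p0 := by
    linear_combination (-P.k1) * e2 - P.νY * e1
  have B3 : P.p2 * LI ≤ P.p0 * LF := by
    have h1 : P.a * P.νY * (P.p2 * LI) ≤ P.a * P.νY * (P.p0 * LF) := by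
      have h2 := mul_le_mul_of_nonneg_left B1 hp2.le
      have h3 : P.a * P.νY * (P.p0 * LF) = P.p2 * ((P.k1 * P.k2 - P.δ * P.νY) * LF) := by
        linear_combination (-LF) * B2
      linarith
    exact le_of_mul_le_mul_left h1 (by positivity)
  have hjL : P.j * LI ≤ 1 := by rw [le_div_iff₀ hj] at i2; linarith
  have CI : P.p0 ≤ LI := by
    have h1 := mul_le_mul_of_nonneg_left B3 (mul_nonneg hb.le (sub_nonneg.2 hjL))
    have h2 := mul_le_mul_of_nonneg_left A0 hp0.le
    have h3 : (P.b * P.p2 * P.j * LI) * P.p0 ≤ (P.b * P.p2 * P.j * LI) * LI := by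
      have h4 : LI * (P.b * (1 - P.j * P.p0) * P.p2) = LI * (P.ν * P.p0) := by rw [e0]
      linarith
    exact le_of_mul_le_mul_left h3 (by positivity)
  have CF : P.p2 ≤ LF := by
    refine le_of_mul_le_mul_left (le_trans ?_ B1) hD
    rw [B2]
    exact mul_le_mul_of_nonneg_left CI (by positivity)
  have CY : P.p1 ≤ LY := by
    refine le_of_mul_le_mul_left (a := P.k1) ?_ hk1
    linarith [mul_le_mul_of_nonneg_left CI ha.le, mul_le_mul_of_nonneg_left CF hδ.le]
  have CM : ∀ ε > 0, ∀ᶠ t in atTop, P.m * P.p0 / P.μ - ε ≤ M t := by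
    refine aux_asym_ge hμ hm S.dM fun η hη => ?_
    filter_upwards [i3 η hη] with t h1
    have h2 : P.p0 - η ≤ I t := by linarith
    linarith [mul_le_mul_of_nonneg_left h2 hm.le]
  rw [e3, mul_div_cancel_left₀ _ hμ.ne'] at CM
  intro ε hε
  filter_upwards [i3 ε hε, y3 ε hε, f3 ε hε, CM ε hε] with t h1 h2 h3 h4
  exact ⟨by linarith, by linarith, by linarith, h4⟩

end AuxSection

/-- If `N₀ > 1` then `TE = (0,0,0,0)` is unstable, and the male-abundance system admits
the positive equilibrium `EE* = (I*, Y*, F*, M*)`, which is globally asymptotically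
stable on ℝ⁴₊ \ {x ∈ ℝ⁴₊ : I = Y = F = 0}. -/
theorem endemicEquilibrium_GAS_of_basicOffspring_gt_one
    (b K γ r νI μI νY μY δ μF μM N0 Istar Ystar Fstar Mstar : ℝ)
    (hb : 0 < b) (hK : 0 < K) (hγ : 0 < γ) (hr : 0 < r) (hr1 : r < 1)
    (hνI : 0 < νI) (hμI : 0 < μI) (hνY : 0 < νY) (hμY : 0 < μY)
    (hδ : 0 < δ) (hμF : 0 < μF) (hμM : 0 < μM)
    (hN0 : N0 = b * r * νI * νY / ((μI + νI) * ((νY + μY) * (δ + μF) - δ * νY)))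
    (hgt : 1 < N0)
    (hI : Istar = (1 - 1 / N0) * K)
    (hY : Ystar = r * νI * (δ + μF) * (1 - 1 / N0) * K /
      ((νY + μY) * (δ + μF) - δ * νY))
    (hF : Fstar = r * νI * νY * (1 - 1 / N0) * K /
      ((νY + μY) * (δ + μF) - δ * νY))
    (hM : Mstar = (1 - r) * νI * (1 - 1 / N0) * K / μM) :
    ¬ StableOn (mAbund b K r νI μI νY μY δ μF μM) Orthant 0 ∧
    mAbund b K r νI μI νY μY δ μF μM ![Istar, Ystar, Fstar, Mstar] = 0 ∧
    (∀ i, 0 < ![Istar, Ystar, Fstar, Mstar] i) ∧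
    GASOn (mAbund b K r νI μI νY μY δ μF μM)
      (Orthant \ {x | x 0 = 0 ∧ x 1 = 0 ∧ x 2 = 0})
      ![Istar, Ystar, Fstar, Mstar] := by
  have hD0 : 0 < (νY + μY) * (δ + μF) - δ * νY := by nlinarith [mul_pos hνY hμF, mul_pos hμY hδ, mul_pos hμY hμF]
  set D := (νY + μY) * (δ + μF) - δ * νY with hD
  have hN0p : 0 < N0 := by linarith
  set q := 1 - 1 / N0 with hq
  have hq0 : 0 < q := by
    rw [hq, sub_pos, div_lt_one hN0p]; exact hgt
  have hq1 : q < 1 := by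
    have : 0 < 1 / N0 := by positivity
    linarith
  have hr1' : 0 < 1 - r := by linarith
  have hIp : 0 < Istar := by rw [hI]; positivity
  have hYp : 0 < Ystar := by rw [hY]; positivity
  have hFp : 0 < Fstar := by rw [hF]; positivity
  have hMp : 0 < Mstar := by rw [hM]; positivity
  have hDF : D * Fstar = r * νI * νY * q * K := by rw [hF]; field_simp
  have hDY : D * Ystar = r * νI * (δ + μF) * q * K := by rw [hY]; field_simp
  have hIK : 1 / K * Istar = q := by rw [hI]; field_simp
  have hN0' : (1 - q) * (b * r * νI * νY) = (μI + νI) * D := by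
    have h1 : 1 - q = 1 / N0 := by rw [hq]; ring
    rw [h1, hN0]; field_simp
  have E0 : b * (1 - 1 / K * Istar) * Fstar = (νI + μI) * Istar := by
    rw [hIK]
    refine mul_left_cancel₀ hD0.ne' ?_
    rw [hI]
    linear_combination b * (1 - q) * hDF + q * K * hN0'
  have E1 : r * νI * Istar + δ * Fstar = (νY + μY) * Ystar := by
    refine mul_left_cancel₀ hD0.ne' ?_
    rw [hI]
    linear_combination δ * hDF - (νY + μY) * hDY + r * νI * q * K * hD
  have E2 : νY * Ystar = (δ + μF) * Fstar := by
    refine mul_left_cancel₀ hD0.ne' ?_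
    linear_combination νY * hDY - (δ + μF) * hDF
  have E3 : (1 - r) * νI * Istar = μM * Mstar := by
    rw [hM, hI]; field_simp
  let P : AuxPar := ⟨b, 1 / K, νI + μI, r * νI, νY + μY, δ, νY, δ + μF, (1 - r) * νI, μM,
    Istar, Ystar, Fstar, Mstar, hb, by positivity, by positivity, by positivity, by positivity, hδ,
    hνY, by positivity, by positivity, hμM, hIp, hYp, hFp, hMp, by rw [hIK]; exact hq1,
    by linarith, E0, E1, E2, E3⟩
  set f := mAbund b K r νI μI νY μY δ μF μM with hf
  set S : Set (Fin 4 → ℝ) := Orthant \ {x | x 0 = 0 ∧ x 1 = 0 ∧ x 2 = 0} with hS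
  set p : Fin 4 → ℝ := ![Istar, Ystar, Fstar, Mstar] with hp
  have hdiv : ∀ y : ℝ, y / K = 1 / K * y := fun y => by ring
  have f0 : ∀ x, f x 0 = b * (1 - 1 / K * x 0) * x 2 - (νI + μI) * x 0 := fun x => by
    rw [← hdiv]; rfl
  have f1 : ∀ x, f x 1 = r * νI * x 0 - (νY + μY) * x 1 + δ * x 2 := fun x => by
    simp [hf, mAbund]
  have f2 : ∀ x, f x 2 = νY * x 1 - (δ + μF) * x 2 := fun x => by
    simp [hf, mAbund]
  have f3 : ∀ x, f x 3 = (1 - r) * νI * x 0 - μM * x 3 := fun x => by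
    simp [hf, mAbund]
  have pe0 : p 0 = Istar := rfl
  have pe1 : p 1 = Ystar := rfl
  have pe2 : p 2 = Fstar := rfl
  have pe3 : p 3 = Mstar := rfl
  have all4 : ∀ Q : Fin 4 → Prop, Q 0 → Q 1 → Q 2 → Q 3 → ∀ i, Q i := by
    intro Q a b c d i
    fin_cases i
    exacts [a, b, c, d]
  have hppos : ∀ i, 0 < p i := all4 _ hIp hYp hFp hMp
  have hfp : f p = 0 := by
    funext i
    revert i
    refine all4 _ ?_ ?_ ?_ ?_
    · rw [f0, pe0, pe2, E0]; simp
    · rw [f1, pe0, pe1, pe2, Pi.zero_apply]; linarith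
    · rw [f2, pe1, pe2, Pi.zero_apply]; linarith
    · rw [f3, pe0, pe3, Pi.zero_apply]; linarith
  have hsol : ∀ x, IsSolOn f S x →
      AuxSol P (fun t => x t 0) (fun t => x t 1) (fun t => x t 2) (fun t => x t 3) := by
    intro x hx
    have hd := fun t ht i => hasDerivAt_pi.1 (hx.1 t ht) i
    refine ⟨fun t ht => ?_, fun t ht => ?_, fun t ht => ?_, fun t ht => ?_, fun t ht => (hx.2 t ht).1 0,
      fun t ht => (hx.2 t ht).1 1, fun t ht => (hx.2 t ht).1 2, fun t ht => (hx.2 t ht).1 3,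
      fun t ht => (hx.2 t ht).2⟩
    · have := hd t ht 0; rw [f0] at this; exact this
    · have := hd t ht 1; rw [f1] at this; exact this
    · have := hd t ht 2; rw [f2] at this; exact this
    · have := hd t ht 3; rw [f3] at this; exact this
  have hconv : ∀ x, IsSolOn f S x → Tendsto x atTop (𝓝 p) := by
    intro x hx
    have hs := hsol x hx
    rw [Metric.tendsto_nhds]
    intro ε hε
    filter_upwards [hs.upper (ε / 2) (by positivity), hs.lower (ε / 2) (by positivity)] with t h1 h2
    obtain ⟨a0, a1, a2, a3⟩ := h1
    obtain ⟨b0, b1, b2, b3⟩ := h2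
    simp only [P] at a0 a1 a2 a3 b0 b1 b2 b3
    rw [dist_pi_lt_iff hε]
    refine all4 _ ?_ ?_ ?_ ?_ <;> rw [Real.dist_eq, abs_lt] <;>
      simp only [pe0, pe1, pe2, pe3] <;> constructor <;> linarith
  have hstab : StableOn f S p := by
    intro ε hε
    obtain ⟨w0, w1, w2, w3, q0, q1, q2, q3, h⟩ := P.good
    obtain ⟨θ, hθ, c0, c1, c2, c3, hsub, hsup⟩ := h ε hε
    have z0 := mul_pos hθ q0
    have z1 := mul_pos hθ q1
    have z2 := mul_pos hθ q2
    have z3 := mul_pos hθ q3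
    refine ⟨min (min (θ * w0) (θ * w1)) (min (θ * w2) (θ * w3)), by positivity, fun x hx hx0 t ht => ?_⟩
    have hs := hsol x hx
    have hd : ∀ i, |x 0 i - p i| < min (min (θ * w0) (θ * w1)) (min (θ * w2) (θ * w3)) := fun i =>
      lt_of_le_of_lt (dist_le_pi_dist (x 0) p i) hx0
    have d0 := abs_lt.1 ((hd 0).trans_le ((min_le_left _ _).trans (min_le_left _ _)))
    have d1 := abs_lt.1 ((hd 1).trans_le ((min_le_left _ _).trans (min_le_right _ _)))
    have d2 := abs_lt.1 ((hd 2).trans_le ((min_le_right _ _).trans (min_le_left _ _)))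
    have d3 := abs_lt.1 ((hd 3).trans_le ((min_le_right _ _).trans (min_le_right _ _)))
    rw [pe0] at d0
    rw [pe1] at d1
    rw [pe2] at d2
    rw [pe3] at d3
    obtain ⟨a0, a1, a2, a3⟩ := hs.sub_inv hsub le_rfl (by simp only [P]; linarith)
      (by simp only [P]; linarith) (by simp only [P]; linarith) (by simp only [P]; linarith) t ht
    obtain ⟨b0, b1, b2, b3⟩ := hs.sup_inv hsup le_rfl (by simp only [P]; linarith)
      (by simp only [P]; linarith) (by simp only [P]; linarith) (by simp only [P]; linarith) t ht
    simp only [P] at a0 a1 a2 a3 b0 b1 b2 b3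
    rw [dist_pi_lt_iff hε]
    refine all4 _ ?_ ?_ ?_ ?_ <;> rw [Real.dist_eq, abs_lt] <;>
      simp only [pe0, pe1, pe2, pe3] <;> constructor <;> linarith
  refine ⟨?_, hfp, hppos, hfp, hstab, hconv⟩
  intro hst
  obtain ⟨d, hd, hst⟩ := hst (Istar / 2) (by positivity)
  -- a small multiple of the equilibrium
  obtain ⟨s, hs0, hs1, hsd⟩ : ∃ s : ℝ, 0 < s ∧ s ≤ 1 ∧ ∀ i, s * p i < d := by
    have sm : ∀ c : ℝ, ∀ᶠ θ in 𝓝[>] (0:ℝ), θ * c < d := by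
      intro c
      have : Tendsto (fun θ : ℝ => θ * c) (𝓝[>] 0) (𝓝 (0 * c)) :=
        ((continuous_id.mul continuous_const).tendsto 0).mono_left nhdsWithin_le_nhds
      rw [zero_mul] at this
      exact this.eventually (gt_mem_nhds hd)
    obtain ⟨s, h1, h2⟩ := ((eventually_all.2 fun i => sm (p i)).and
      (Ioc_mem_nhdsGT (show (0:ℝ) < 1 by norm_num))).exists
    exact ⟨s, h2.1, h2.2, h1⟩
  have hfc : ContDiff ℝ 1 f := by
    rw [contDiff_pi]
    refine all4 _ ?_ ?_ ?_ ?_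
    · simp only [f0]; fun_prop
    · simp only [f1]; fun_prop
    · simp only [f2]; fun_prop
    · simp only [f3]; fun_prop
  have hsp : ∀ i, s * p i ≤ p i := fun i => by
    have := mul_le_mul_of_nonneg_right hs1 (hppos i).le
    linarith
  have haa : 0 < r * νI := by positivity
  have hmm : 0 < (1 - r) * νI := by positivity
  have hsI : 1 / K * (s * Istar) ≤ q := by
    have := hsp 0
    rw [pe0] at this
    rw [← hIK]
    exact mul_le_mul_of_nonneg_left this (by positivity)
  obtain ⟨x, hx0, hx⟩ := aux_clamp_exists hfc (lo := fun i => s * p i) (hi := p)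
    (x0 := fun i => s * p i) hsp (fun i => ⟨le_rfl, hsp i⟩)
    (by
      intro x hx
      have g0 := (hx 0).1
      have g1 := (hx 1).1
      have g2 := (hx 2).1
      rw [pe0] at g0
      rw [pe1] at g1
      rw [pe2] at g2
      refine all4 _ ?_ ?_ ?_ ?_ <;> intro h
      · rw [pe0] at h
        rw [f0, h]
        have h1 : 0 ≤ b * (1 - 1 / K * (s * Istar)) := mul_nonneg hb.le (by linarith)
        have h2 := mul_le_mul_of_nonneg_left g2 h1
        have h3 : b * (1 - q) * (s * Fstar) ≤ b * (1 - 1 / K * (s * Istar)) * (s * Fstar) := by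
          refine mul_le_mul_of_nonneg_right (mul_le_mul_of_nonneg_left ?_ hb.le) (by positivity)
          linarith
        rw [hIK] at E0
        have h4 : b * (1 - q) * (s * Fstar) = (νI + μI) * (s * Istar) := by
          linear_combination s * E0
        linarith
      · rw [pe1] at h
        rw [f1, h]
        have h1 : s * (r * νI * Istar + δ * Fstar) = s * ((νY + μY) * Ystar) := by rw [E1]
        linarith [mul_le_mul_of_nonneg_left g0 haa.le, mul_le_mul_of_nonneg_left g2 hδ.le]
      · rw [pe2] at h
        rw [f2, h]
        have h1 : s * (νY * Ystar) = s * ((δ + μF) * Fstar) := by rw [E2]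
        linarith [mul_le_mul_of_nonneg_left g1 hνY.le]
      · rw [pe3] at h
        rw [f3, h]
        have h1 : s * ((1 - r) * νI * Istar) = s * (μM * Mstar) := by rw [E3]
        linarith [mul_le_mul_of_nonneg_left g0 hmm.le])
    (by
      intro x hx
      have g0 := (hx 0).2
      have g1 := (hx 1).2
      have g2 := (hx 2).2
      rw [pe0] at g0
      rw [pe1] at g1
      rw [pe2] at g2
      refine all4 _ ?_ ?_ ?_ ?_ <;> intro h
      · rw [pe0] at h
        rw [f0, h]
        have h1 : 0 ≤ b * (1 - 1 / K * Istar) := mul_nonneg hb.le (by linarith)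
        linarith [mul_le_mul_of_nonneg_left g2 h1]
      · rw [pe1] at h
        rw [f1, h]
        linarith [mul_le_mul_of_nonneg_left g0 haa.le, mul_le_mul_of_nonneg_left g2 hδ.le]
      · rw [pe2] at h
        rw [f2, h]
        linarith [mul_le_mul_of_nonneg_left g1 hνY.le]
      · rw [pe3] at h
        rw [f3, h]
        linarith [mul_le_mul_of_nonneg_left g0 hmm.le])
  have hxpos : ∀ t, 0 ≤ t → ∀ i, 0 < x t i := fun t ht i =>
    lt_of_lt_of_le (mul_pos hs0 (hppos i)) ((hx t ht).2 i).1
  have hxS : IsSolOn f S x := ⟨fun t ht => (hx t ht).1, fun t ht =>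
    ⟨fun i => (hxpos t ht i).le, fun h => (hxpos t ht 0).ne' h.1⟩⟩
  have hxO : IsSolOn f Orthant x := ⟨hxS.1, fun t ht => (hxS.2 t ht).1⟩
  have hbd := hst x hxO (by
    rw [dist_pi_lt_iff hd]
    intro i
    rw [hx0, Real.dist_eq, Pi.zero_apply, sub_zero, abs_of_pos (mul_pos hs0 (hppos i))]
    exact hsd i)
  have hlim := hconv x hxS
  have hlim0 : Tendsto (fun t => x t 0) atTop (𝓝 (p 0)) := (tendsto_pi_nhds.1 hlim) 0
  have : p 0 ≤ Istar / 2 := by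
    refine le_of_tendsto hlim0 ?_
    filter_upwards [eventually_ge_atTop (0:ℝ)] with t ht
    have h1 := (dist_le_pi_dist (x t) 0 0).trans_lt (hbd t ht)
    rw [Real.dist_eq, Pi.zero_apply, sub_zero] at h1
    exact (le_abs_self _).trans h1.le
  rw [pe0] at this
  linarith
end
end

section
/- The vector EE* = (I*,Y*,F*,M*) with I* = (1 - 1/N₀)K, Y* = rν_I(δ+μ_F)I*/((ν_Y+μ_Y)(δ+μ_F) - δν_Y), F* = rν_Iν_Y I*/((ν_Y+μ_Y)(δ+μ_F) - δν_Y), M* = (1-r)ν_I I*/μ_M is an equilibrium of the male-abundance system, i.e. it satisfies b(1 - I*/K)F* - (ν_I + μ_I)I* = 0, rν_I I* - (ν_Y + μ_Y)Y* + δF* = 0, ν_Y Y* - (δ + μ_F)F* = 0, and (1 - r)ν_I I* - μ_M M* = 0; moreover TE = (0,0,0,0) and EE* are the only solutions of this equilibrium system. -/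
noncomputable section

/-- `EE* = (I*, Y*, F*, M*)` satisfies the four equilibrium equations of the
male-abundance system, and `TE = (0,0,0,0)` and `EE*` are the only solutions of this
equilibrium system. -/
theorem endemicEquilibrium_equations_and_uniqueness
    (b K γ r νI μI νY μY δ μF μM N0 Istar Ystar Fstar Mstar : ℝ)
    (hb : 0 < b) (hK : 0 < K) (hγ : 0 < γ) (hr : 0 < r) (hr1 : r < 1)
    (hνI : 0 < νI) (hμI : 0 < μI) (hνY : 0 < νY) (hμY : 0 < μY)
    (hδ : 0 < δ) (hμF : 0 < μF) (hμM : 0 < μM)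
    (hN0 : N0 = b * r * νI * νY / ((μI + νI) * ((νY + μY) * (δ + μF) - δ * νY)))
    (hgt : 1 < N0)
    (hI : Istar = (1 - 1 / N0) * K)
    (hY : Ystar = r * νI * (δ + μF) * Istar / ((νY + μY) * (δ + μF) - δ * νY))
    (hF : Fstar = r * νI * νY * Istar / ((νY + μY) * (δ + μF) - δ * νY))
    (hM : Mstar = (1 - r) * νI * Istar / μM) :
    (b * (1 - Istar / K) * Fstar - (νI + μI) * Istar = 0 ∧
     r * νI * Istar - (νY + μY) * Ystar + δ * Fstar = 0 ∧
     νY * Ystar - (δ + μF) * Fstar = 0 ∧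
     (1 - r) * νI * Istar - μM * Mstar = 0) ∧
    ∀ I Y F M : ℝ,
      (b * (1 - I / K) * F - (νI + μI) * I = 0 ∧
       r * νI * I - (νY + μY) * Y + δ * F = 0 ∧
       νY * Y - (δ + μF) * F = 0 ∧
       (1 - r) * νI * I - μM * M = 0) →
      (I = 0 ∧ Y = 0 ∧ F = 0 ∧ M = 0) ∨
      (I = Istar ∧ Y = Ystar ∧ F = Fstar ∧ M = Mstar) := by
  have hDpos : 0 < (νY + μY) * (δ + μF) - δ * νY := by
    have : (νY + μY) * (δ + μF) - δ * νY = νY * μF + μY * δ + μY * μF := by ring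
    rw [this]; positivity
  obtain ⟨D, hD⟩ : ∃ D, D = (νY + μY) * (δ + μF) - δ * νY := ⟨_, rfl⟩
  rw [← hD] at hN0 hY hF hDpos
  have hD0 : D ≠ 0 := hDpos.ne'
  have hN : N0 ≠ 0 := by positivity
  have hS : μI + νI ≠ 0 := by positivity
  have hn : N0 * ((μI + νI) * D) = b * r * νI * νY := by
    rw [hN0]; field_simp
  have hYD : Ystar * D = r * νI * (δ + μF) * Istar := by rw [hY]; field_simp
  have hFD : Fstar * D = r * νI * νY * Istar := by rw [hF]; field_simp
  have hMM : Mstar * μM = (1 - r) * νI * Istar := by rw [hM]; field_simp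
  have hIK : (1 - Istar / K) * N0 = 1 := by rw [hI]; field_simp; ring
  refine ⟨⟨?_, ?_, ?_, ?_⟩, ?_⟩
  · apply mul_right_cancel₀ (mul_ne_zero hN hD0)
    linear_combination (b * Fstar * D) * hIK + b * hFD - Istar * hn
  · apply mul_right_cancel₀ hD0
    linear_combination (-(νY + μY)) * hYD + δ * hFD + r * νI * Istar * hD
  · apply mul_right_cancel₀ hD0
    linear_combination νY * hYD - (δ + μF) * hFD
  · linear_combination -hMM
  · rintro I Y F M ⟨h1, h2, h3, h4⟩
    have hYD' : Y * D = r * νI * (δ + μF) * I := by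
      linear_combination Y * hD - (δ + μF) * h2 - δ * h3
    have hFD' : F * D = r * νI * νY * I := by
      linear_combination F * hD - νY * h2 - (νY + μY) * h3
    have key : I * ((1 - I / K) * N0 - 1) = 0 := by
      apply mul_right_cancel₀ (mul_ne_zero hS hD0)
      linear_combination D * h1 - b * (1 - I / K) * hFD' + I * (1 - I / K) * hn
    rcases mul_eq_zero.mp key with h | h
    · left
      subst h
      refine ⟨rfl, ?_, ?_, ?_⟩
      · apply mul_right_cancel₀ hD0; linear_combination hYD'
      · apply mul_right_cancel₀ hD0; linear_combination hFD'
      · apply mul_right_cancel₀ hμM.ne'; linear_combination -h4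
    · right
      have e : I = Istar := by
        have h5 : I / K = Istar / K := by
          apply mul_right_cancel₀ hN
          linear_combination hIK - h
        field_simp at h5
        exact h5
      subst e
      refine ⟨rfl, ?_, ?_, ?_⟩
      · apply mul_right_cancel₀ hD0; linear_combination hYD' - hYD
      · apply mul_right_cancel₀ hD0; linear_combination hFD' - hFD
      · apply mul_right_cancel₀ hμM.ne'; linear_combination -h4 - hMM
end
end

section
/- For the male-scarcity system (with Y decoupled) du/dt = g(u), u = (I,F,M), g(u) = (b(1 - I/K)F - (ν_I + μ_I)I, ν_Y γ M - (δ + μ_F)F, (1 - r)ν_I I - μ_M M): if the basic offspring number N̂₀ = bγ(1-r)ν_Iν_Y / ((ν_I+μ_I)(δ+μ_F)μ_M) satisfies N̂₀ ≤ 1, then TE = (0,0,0) is a globally asymptotically stable equilibrium on ℝ³₊. -/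
open Filter Topology Set

noncomputable section

/-- `x` is a (forward) solution of `x' = g x` for `t ≥ 0` remaining in `S`. -/
def IsSolOn3 (g : (Fin 3 → ℝ) → (Fin 3 → ℝ)) (S : Set (Fin 3 → ℝ))
    (x : ℝ → Fin 3 → ℝ) : Prop :=
  (∀ t : ℝ, 0 ≤ t → HasDerivAt x (g (x t)) t) ∧ ∀ t : ℝ, 0 ≤ t → x t ∈ S

/-- The nonnegative orthant ℝ³₊. -/
def Orthant3 : Set (Fin 3 → ℝ) := {x | ∀ i, 0 ≤ x i}

/-- Lyapunov stability of `p` relative to forward solutions in `S`. -/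
def StableOn3 (g : (Fin 3 → ℝ) → (Fin 3 → ℝ)) (S : Set (Fin 3 → ℝ)) (p : Fin 3 → ℝ) : Prop :=
  ∀ ε > 0, ∃ d > 0, ∀ x : ℝ → Fin 3 → ℝ, IsSolOn3 g S x → dist (x 0) p < d →
    ∀ t : ℝ, 0 ≤ t → dist (x t) p < ε

/-- `p` is a globally asymptotically stable equilibrium of `g` on `S`. -/
def GASOn3 (g : (Fin 3 → ℝ) → (Fin 3 → ℝ)) (S : Set (Fin 3 → ℝ)) (p : Fin 3 → ℝ) : Prop :=
  g p = 0 ∧ StableOn3 g S p ∧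
    ∀ x : ℝ → Fin 3 → ℝ, IsSolOn3 g S x → Tendsto x atTop (𝓝 p)

/-- The vector field of the male-scarcity system with `Y` decoupled, `u = (I, F, M)`. -/
def mScarce3 (b K γ r νI μI νY δ μF μM : ℝ) : (Fin 3 → ℝ) → (Fin 3 → ℝ) := fun u =>
  ![b * (1 - u 0 / K) * u 1 - (νI + μI) * u 0,
    νY * γ * u 2 - (δ + μF) * u 1,
    (1 - r) * νI * u 0 - μM * u 2]

theorem aux_anti_s4 (V V' : ℝ → ℝ) (h : ∀ t, 0 ≤ t → HasDerivAt V (V' t) t)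
    (hn : ∀ t, 0 ≤ t → V' t ≤ 0) {s t : ℝ} (hs : 0 ≤ s) (hst : s ≤ t) : V t ≤ V s := by
  have := antitoneOn_of_deriv_nonpos (convex_Ici (0:ℝ)) (f := V)
    (fun t ht => (h t ht).continuousAt.continuousWithinAt)
    (fun t ht => by
      rw [interior_Ici] at ht
      exact (h t ht.le).differentiableAt.differentiableWithinAt)
    (fun t ht => by
      rw [interior_Ici] at ht
      rw [(h t ht.le).deriv]; exact hn t ht.le)
  exact this hs (hs.trans hst) hst

theorem aux_young (A q x y : ℝ) (hq : 0 < q) :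
    A * x * y ≤ q / 2 * x ^ 2 + A ^ 2 / (2 * q) * y ^ 2 := by
  have : q / 2 * x ^ 2 + A ^ 2 / (2 * q) * y ^ 2 - A * x * y = (q * x - A * y) ^ 2 / (2 * q) := by
    field_simp
    ring
  have h2 : 0 ≤ (q * x - A * y) ^ 2 / (2 * q) := by positivity
  linarith

theorem aux_cs (u v w q ε : ℝ) (hq : 0 < q) (hε : 0 < ε) :
    ∃ κ, 0 < κ ∧ ∀ x y z : ℝ, ε ≤ u * x + v * y + w * z → κ ≤ q * x ^ 2 + y ^ 2 + z ^ 2 := by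
  have hD : 0 < u ^ 2 / q + v ^ 2 + w ^ 2 + 1 := by positivity
  refine ⟨ε ^ 2 / (u ^ 2 / q + v ^ 2 + w ^ 2 + 1), by positivity, ?_⟩
  intro x y z h
  set D := u ^ 2 / q + v ^ 2 + w ^ 2 + 1 with hDe
  set l := ε / D with hl
  have hl0 : 0 < l := by positivity
  have hlD : l * D = ε := by rw [hl]; field_simp
  have e : ε ^ 2 / D = l * ε := by rw [hl]; ring
  rw [e]
  have a1 : 2 * l * (u * x) ≤ q * x ^ 2 + l ^ 2 * (u ^ 2 / q) := by
    have : q * x ^ 2 + l ^ 2 * (u ^ 2 / q) - 2 * l * (u * x) = (q * x - l * u) ^ 2 / q := by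
      field_simp
      ring
    have h2 : 0 ≤ (q * x - l * u) ^ 2 / q := by positivity
    linarith
  have a2 : 2 * l * (v * y) ≤ y ^ 2 + l ^ 2 * v ^ 2 := by linarith [sq_nonneg (y - l * v)]
  have a3 : 2 * l * (w * z) ≤ z ^ 2 + l ^ 2 * w ^ 2 := by linarith [sq_nonneg (z - l * w)]
  have a4 : l * ε = l ^ 2 * (u ^ 2 / q) + l ^ 2 * v ^ 2 + l ^ 2 * w ^ 2 + l ^ 2 := by
    rw [← hlD, hDe]; ring
  have a5 := mul_le_mul_of_nonneg_left h hl0.le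
  have a6 : 0 < l ^ 2 := by positivity
  linarith

set_option maxHeartbeats 1000000 in
theorem aux_core (a b c m p q k : ℝ) (ha : 0 < a) (hb : 0 < b) (hc : 0 < c) (hm : 0 < m)
    (hp : 0 < p) (hq : 0 < q) (hk : 0 < k) (hN : b * p * q ≤ a * c * m)
    (I F M : ℝ → ℝ)
    (hI : ∀ t, 0 ≤ t → HasDerivAt I (b * F t - k * I t * F t - a * I t) t)
    (hF : ∀ t, 0 ≤ t → HasDerivAt F (p * M t - c * F t) t)
    (hM : ∀ t, 0 ≤ t → HasDerivAt M (q * I t - m * M t) t)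
    (I0 : ∀ t, 0 ≤ t → 0 ≤ I t) (F0 : ∀ t, 0 ≤ t → 0 ≤ F t) (M0 : ∀ t, 0 ≤ t → 0 ≤ M t) :
    (∀ s t, 0 ≤ s → s ≤ t → c * m * I t + b * m * F t + b * p * M t
        ≤ c * m * I s + b * m * F s + b * p * M s) ∧
    ∀ ε > 0, ∃ T, 0 ≤ T ∧ c * m * I T + b * m * F T + b * p * M T < ε := by
  have hVd : ∀ t, 0 ≤ t → HasDerivAt (fun t => c * m * I t + b * m * F t + b * p * M t)
      (-(c * m * k) * (I t * F t) + (b * p * q - a * c * m) * I t) t := by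
    intro t ht
    exact ((((hI t ht).const_mul (c * m)).add ((hF t ht).const_mul (b * m))).add
      ((hM t ht).const_mul (b * p))).congr_deriv (by ring)
  have hV' : ∀ t, 0 ≤ t → -(c * m * k) * (I t * F t) + (b * p * q - a * c * m) * I t
      ≤ -(c * m * k) * (I t * F t) := by
    intro t ht
    have := mul_nonneg (sub_nonneg.2 hN) (I0 t ht)
    linarith
  have anti : ∀ s t, 0 ≤ s → s ≤ t → c * m * I t + b * m * F t + b * p * M t
        ≤ c * m * I s + b * m * F s + b * p * M s := by
    intro s t hs hst
    refine aux_anti_s4 _ _ hVd (fun t ht => (hV' t ht).trans ?_) hs hst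
    have := I0 t ht
    have := F0 t ht
    have : 0 ≤ (c * m * k) * (I t * F t) := by positivity
    linarith
  refine ⟨anti, ?_⟩
  intro ε hε
  by_contra! hcon
  -- bounds
  obtain ⟨B, hB0, hBI, hBF, hBM⟩ : ∃ B, 0 ≤ B ∧ (∀ t, 0 ≤ t → I t ≤ B) ∧
      (∀ t, 0 ≤ t → F t ≤ B) ∧ (∀ t, 0 ≤ t → M t ≤ B) := by
    set v := c * m * I 0 + b * m * F 0 + b * p * M 0 with hv
    have i0 := I0 0 le_rfl
    have f0 := F0 0 le_rfl
    have m0 := M0 0 le_rfl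
    have hv0 : 0 ≤ v := by positivity
    have e1 : 0 ≤ v / (c * m) := by positivity
    have e2 : 0 ≤ v / (b * m) := by positivity
    have e3 : 0 ≤ v / (b * p) := by positivity
    refine ⟨v / (c * m) + v / (b * m) + v / (b * p), by positivity, ?_, ?_, ?_⟩ <;> intro t ht <;>
    · have h := anti 0 t le_rfl ht
      have i1 := mul_nonneg (mul_pos hc hm).le (I0 t ht)
      have f1 := mul_nonneg (mul_pos hb hm).le (F0 t ht)
      have m1 := mul_nonneg (mul_pos hb hp).le (M0 t ht)
      first
      | (have : I t ≤ v / (c * m) := by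
           rw [le_div_iff₀ (by positivity)]; linarith
         linarith)
      | (have : F t ≤ v / (b * m) := by
           rw [le_div_iff₀ (by positivity)]; linarith
         linarith)
      | (have : M t ≤ v / (b * p) := by
           rw [le_div_iff₀ (by positivity)]; linarith
         linarith)
  obtain ⟨s2, hs2, hs2p⟩ : ∃ s2, 0 < s2 ∧ s2 * (p / 2) = (a + m) ^ 2 / (2 * q) + 1 :=
    ⟨((a + m) ^ 2 / (2 * q) + 1) / (p / 2), by positivity, by field_simp⟩
  obtain ⟨s3, hs3, hs3b⟩ : ∃ s3, 0 < s3 ∧ s3 * b = s2 * ((c + m) ^ 2 / (2 * p)) + 1 :=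
    ⟨(s2 * ((c + m) ^ 2 / (2 * p)) + 1) / b, by positivity, by field_simp⟩
  obtain ⟨A, hA, hAk⟩ : ∃ A, 0 < A ∧ A * (c * m * k) = k * B + s3 * (k * B + a + c) :=
    ⟨(k * B + s3 * (k * B + a + c)) / (c * m * k), by positivity, by field_simp⟩
  obtain ⟨κ, hκ, hκb⟩ : ∃ κ, 0 < κ ∧ ∀ x y z : ℝ, 0 ≤ x → 0 ≤ y → 0 ≤ z →
      ε ≤ c * m * x + b * m * y + b * p * z → κ ≤ q / 2 * x ^ 2 + y ^ 2 + z ^ 2 := by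
    obtain ⟨κ, hκ, h⟩ := aux_cs (c * m) (b * m) (b * p) (q / 2) ε (by positivity) hε
    exact ⟨κ, hκ, fun x y z _ _ _ => h x y z⟩
  let W : ℝ → ℝ := fun t => A * (c * m * I t + b * m * F t + b * p * M t)
    - I t * M t - s2 * (F t * M t) - s3 * (I t * F t) + κ * t
  have hWd : ∀ t, 0 ≤ t → HasDerivAt W
      (A * (-(c * m * k) * (I t * F t) + (b * p * q - a * c * m) * I t)
      - ((b * F t - k * I t * F t - a * I t) * M t + I t * (q * I t - m * M t))
      - s2 * ((p * M t - c * F t) * M t + F t * (q * I t - m * M t))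
      - s3 * ((b * F t - k * I t * F t - a * I t) * F t + I t * (p * M t - c * F t))
      + κ * 1) t := by
    intro t ht
    exact (((((hVd t ht).const_mul A).sub ((hI t ht).mul (hM t ht))).sub
      (((hF t ht).mul (hM t ht)).const_mul s2)).sub
      (((hI t ht).mul (hF t ht)).const_mul s3)).add ((hasDerivAt_id t).const_mul κ)
  have hWn : ∀ t, 0 ≤ t → W t ≤ W 0 := by
    intro t ht
    refine aux_anti_s4 W _ hWd ?_ le_rfl ht
    intro t ht
    have hV1 := mul_le_mul_of_nonneg_left (hV' t ht) hA.le
    have hk1 := hκb _ _ _ (I0 t ht) (F0 t ht) (M0 t ht) (hcon t ht)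
    have i0 := I0 t ht
    have f0 := F0 t ht
    have m0 := M0 t ht
    have iB := hBI t ht
    have fB := hBF t ht
    have mB := hBM t ht
    generalize I t = x at *
    generalize F t = y at *
    generalize M t = z at *
    have y1 := aux_young (a + m) q x z hq
    have y2 := mul_le_mul_of_nonneg_left (aux_young (c + m) p z y hp) hs2.le
    have z1 : k * x * y * z ≤ k * B * (x * y) := by
      have : 0 ≤ k * (x * y) * (B - z) := mul_nonneg (by positivity) (by linarith)
      linarith
    have z2 : s3 * (k * x * y * y) ≤ s3 * (k * B * (x * y)) := by
      have : 0 ≤ s3 * (k * (x * y)) * (B - y) := mul_nonneg (by positivity) (by linarith)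
      linarith
    have n1 : 0 ≤ b * y * z := by positivity
    have n2 : 0 ≤ s2 * (q * x * y) := by positivity
    have n3 : 0 ≤ s3 * (p * x * z) := by positivity
    have g1 := congrArg (· * z ^ 2) hs2p
    have g2 := congrArg (· * y ^ 2) hs3b
    have g3 := congrArg (· * (x * y)) hAk
    linarith
  have hWl : ∀ t, 0 ≤ t → -(B * B) - s2 * (B * B) - s3 * (B * B) + κ * t ≤ W t := by
    intro t ht
    have i0 := I0 t ht
    have f0 := F0 t ht
    have m0 := M0 t ht
    have u1 : I t * M t ≤ B * B := mul_le_mul (hBI t ht) (hBM t ht) m0 hB0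
    have u2 := mul_le_mul_of_nonneg_left (mul_le_mul (hBF t ht) (hBM t ht) m0 hB0) hs2.le
    have u3 := mul_le_mul_of_nonneg_left (mul_le_mul (hBI t ht) (hBF t ht) f0 hB0) hs3.le
    have : 0 ≤ A * (c * m * I t + b * m * F t + b * p * M t) := by positivity
    simp only [W]
    linarith
  set E := |W 0 + (B * B) + s2 * (B * B) + s3 * (B * B)| + 1 with hE
  have hE0 : 0 < E := by positivity
  have ht : 0 ≤ E / κ := by positivity
  have h1 := hWn _ ht
  have h2 := hWl _ ht
  rw [mul_div_cancel₀ _ hκ.ne'] at h2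
  have := le_abs_self (W 0 + (B * B) + s2 * (B * B) + s3 * (B * B))
  linarith

theorem aux_sys (b K γ r νI μI νY δ μF μM : ℝ)
    (hb : 0 < b) (hK : 0 < K) (hγ : 0 < γ) (hr1 : r < 1)
    (hνI : 0 < νI) (hμI : 0 < μI) (hνY : 0 < νY)
    (hδ : 0 < δ) (hμF : 0 < μF) (hμM : 0 < μM)
    (hN : b * γ * (1 - r) * νI * νY ≤ (νI + μI) * (δ + μF) * μM) :
    ∃ w W : ℝ, 0 < w ∧ 0 < W ∧ ∀ x : ℝ → Fin 3 → ℝ,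
      IsSolOn3 (mScarce3 b K γ r νI μI νY δ μF μM) Orthant3 x →
      ∃ V : ℝ → ℝ, (∀ t, 0 ≤ t → w * dist (x t) 0 ≤ V t ∧ V t ≤ W * dist (x t) 0) ∧
        (∀ s t, 0 ≤ s → s ≤ t → V t ≤ V s) ∧ ∀ ε > 0, ∃ T, 0 ≤ T ∧ V T < ε := by
  have hr' : 0 < 1 - r := by linarith
  set a := νI + μI with ha
  set c := δ + μF with hc
  set p := νY * γ with hp
  set q := (1 - r) * νI with hq
  have ha0 : 0 < a := by positivity
  have hc0 : 0 < c := by positivity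
  have hp0 : 0 < p := by positivity
  have hq0 : 0 < q := by positivity
  have c1 : 0 < c * μM := by positivity
  have c2 : 0 < b * μM := by positivity
  have c3 : 0 < b * p := by positivity
  refine ⟨min (c * μM) (min (b * μM) (b * p)), c * μM + b * μM + b * p,
    lt_min c1 (lt_min c2 c3), by positivity, ?_⟩
  intro x hx
  have hd : ∀ t, 0 ≤ t → ∀ i, HasDerivAt (fun t => x t i)
      (mScarce3 b K γ r νI μI νY δ μF μM (x t) i) t :=
    fun t ht => hasDerivAt_pi.1 (hx.1 t ht)
  have core := aux_core a b c μM p q (b / K) ha0 hb hc0 hμM hp0 hq0 (by positivity)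
    (by calc b * p * q = b * γ * (1 - r) * νI * νY := by rw [hp, hq]; ring
          _ ≤ _ := hN)
    (fun t => x t 0) (fun t => x t 1) (fun t => x t 2)
    (fun t ht => by
      convert hd t ht 0 using 1
      simp [mScarce3, ha]
      ring)
    (fun t ht => by
      convert hd t ht 1 using 1
      simp [mScarce3, hp, hc])
    (fun t ht => by
      convert hd t ht 2 using 1
      simp [mScarce3, hq])
    (fun t ht => hx.2 t ht 0) (fun t ht => hx.2 t ht 1) (fun t ht => hx.2 t ht 2)
  refine ⟨fun t => c * μM * x t 0 + b * μM * x t 1 + b * p * x t 2, ?_, core.1, core.2⟩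
  intro t ht
  have n0 := hx.2 t ht 0
  have n1 := hx.2 t ht 1
  have n2 := hx.2 t ht 2
  have d : ∀ i, x t i ≤ dist (x t) 0 := fun i => by
    have := dist_le_pi_dist (x t) 0 i
    rw [Real.dist_eq] at this
    simp only [Pi.zero_apply, sub_zero] at this
    exact (le_abs_self _).trans this
  constructor
  · set w := min (c * μM) (min (b * μM) (b * p)) with hw
    have hw0 : 0 < w := lt_min c1 (lt_min c2 c3)
    have w1 : w ≤ c * μM := min_le_left _ _
    have w2 : w ≤ b * μM := (min_le_right _ _).trans (min_le_left _ _)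
    have w3 : w ≤ b * p := (min_le_right _ _).trans (min_le_right _ _)
    have q1 := mul_le_mul_of_nonneg_right w1 n0
    have q2 := mul_le_mul_of_nonneg_right w2 n1
    have q3 := mul_le_mul_of_nonneg_right w3 n2
    have : dist (x t) 0 ≤ x t 0 + x t 1 + x t 2 := by
      rw [dist_pi_le_iff (by linarith)]
      intro i
      rw [Real.dist_eq]
      simp only [Pi.zero_apply, sub_zero]
      rw [abs_of_nonneg (hx.2 t ht i)]
      fin_cases i <;> simp <;> linarith
    have := mul_le_mul_of_nonneg_left this hw0.le
    simp only
    linarith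
  · have q1 := mul_le_mul_of_nonneg_left (d 0) c1.le
    have q2 := mul_le_mul_of_nonneg_left (d 1) c2.le
    have q3 := mul_le_mul_of_nonneg_left (d 2) c3.le
    simp only
    linarith

/-- If the basic offspring number `N̂₀ ≤ 1`, then `TE = (0,0,0)` is a globally
asymptotically stable equilibrium of the male-scarcity system on ℝ³₊. -/
theorem TE_GAS_of_scarcityOffspring_le_one
    (b K γ r νI μI νY μY δ μF μM Nhat0 : ℝ)
    (hb : 0 < b) (hK : 0 < K) (hγ : 0 < γ) (hr : 0 < r) (hr1 : r < 1)
    (hνI : 0 < νI) (hμI : 0 < μI) (hνY : 0 < νY) (hμY : 0 < μY)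
    (hδ : 0 < δ) (hμF : 0 < μF) (hμM : 0 < μM)
    (hN : Nhat0 = b * γ * (1 - r) * νI * νY / ((νI + μI) * (δ + μF) * μM))
    (hle : Nhat0 ≤ 1) :
    GASOn3 (mScarce3 b K γ r νI μI νY δ μF μM) Orthant3 0 := by
  have hr' : 0 < 1 - r := by linarith
  have hN' : b * γ * (1 - r) * νI * νY ≤ (νI + μI) * (δ + μF) * μM := by
    rw [hN, div_le_one (by positivity)] at hle
    exact hle
  obtain ⟨w, W, hw, hW, H⟩ := aux_sys b K γ r νI μI νY δ μF μM hb hK hγ hr1 hνI hμI hνY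
    hδ hμF hμM hN'
  refine ⟨?_, ?_, ?_⟩
  · ext i
    fin_cases i <;> simp [mScarce3]
  · intro ε hε
    refine ⟨w * ε / W, by positivity, ?_⟩
    intro x hx h0 t ht
    obtain ⟨V, hV, hanti, -⟩ := H x hx
    rw [lt_div_iff₀ hW] at h0
    have h1 := (hV t ht).1
    have h2 := hanti 0 t le_rfl ht
    have h3 := (hV 0 le_rfl).2
    have : w * dist (x t) 0 < w * ε := by linarith
    exact lt_of_mul_lt_mul_left this hw.le
  · intro x hx
    obtain ⟨V, hV, hanti, hlim⟩ := H x hx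
    rw [Metric.tendsto_atTop]
    intro ε hε
    obtain ⟨T, hT, hVT⟩ := hlim (w * ε) (by positivity)
    refine ⟨T, fun t ht => ?_⟩
    have h1 := (hV t (hT.trans ht)).1
    have h2 := hanti T t hT ht
    have : w * dist (x t) 0 < w * ε := by linarith
    exact lt_of_mul_lt_mul_left this hw.le
end
end

section
/- For the male-scarcity system du/dt = g(u), g(I,F,M) = (b(1 - I/K)F - (ν_I + μ_I)I, ν_Y γ M - (δ + μ_F)F, (1 - r)ν_I I - μ_M M): if N̂₀ = bγ(1-r)ν_Iν_Y / ((ν_I+μ_I)(δ+μ_F)μ_M) > 1, then TE = (0,0,0) is unstable and the system admits a positive equilibrium ÊE = (Î, F̂, M̂) with Î = (1 - 1/N̂₀)K, F̂ = γ(1-r)ν_Iν_Y K(1 - 1/N̂₀)/((δ+μ_F)μ_M), M̂ = (1-r)ν_I K(1 - 1/N̂₀)/μ_M, which is globally asymptotically stable on ℝ³₊ \ {u ∈ ℝ³₊ : I = F = 0}. -/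
open Filter Topology Set

noncomputable section

theorem aux_global_exists {E : Type*} [NormedAddCommGroup E] [NormedSpace ℝ E] [CompleteSpace E]
    (f : E → E) (L C : NNReal) (hL : LipschitzWith L f) (hC : ∀ x, ‖f x‖ ≤ C) (x0 : E) :
    ∃ α : ℝ → E, α 0 = x0 ∧ ∀ t, HasDerivAt α (f (α t)) t := by
  have hex : ∀ n : ℕ, ∃ α : ℝ → E, α 0 = x0 ∧
      ∀ t ∈ Ioo (-((n:ℝ)+1)) ((n:ℝ)+1), HasDerivAt α (f (α t)) t := by
    intro n
    have hn : (0:ℝ) ≤ n := Nat.cast_nonneg n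
    have h0 : (0:ℝ) ∈ Icc (-((n:ℝ)+1)) ((n:ℝ)+1) := ⟨by linarith, by linarith⟩
    have hp : IsPicardLindelof (fun _ ↦ f) (⟨0, h0⟩ : Icc (-((n:ℝ)+1)) ((n:ℝ)+1)) x0
        (C * ((n:NNReal)+1)) 0 C L := by
      apply IsPicardLindelof.of_time_independent
      · intro x _; exact hC x
      · exact hL.lipschitzOnWith
      · simp
    obtain ⟨α, h1, h2⟩ := hp.exists_eq_forall_mem_Icc_hasDerivWithinAt₀
    exact ⟨α, h1, fun t ht => (h2 t (Ioo_subset_Icc_self ht)).hasDerivAt (Icc_mem_nhds ht.1 ht.2)⟩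
  choose α hα0 hα using hex
  have huniq : ∀ m n : ℕ, m ≤ n → EqOn (α m) (α n) (Ioo (-((m:ℝ)+1)) ((m:ℝ)+1)) := by
    intro m n hmn
    have hmn' : (m:ℝ) ≤ n := by exact_mod_cast hmn
    have hm : (0:ℝ) ≤ m := Nat.cast_nonneg m
    apply ODE_solution_unique_of_mem_Ioo (v := fun _ => f) (s := fun _ => univ) (K := L) (t₀ := 0)
    · intro t _; exact hL.lipschitzOnWith
    · exact ⟨by linarith, by linarith⟩
    · intro t ht; exact ⟨hα m t ht, trivial⟩
    · intro t ht; exact ⟨hα n t ⟨by linarith [ht.1], by linarith [ht.2]⟩, trivial⟩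
    · rw [hα0, hα0]
  refine ⟨fun t => α ⌈|t|⌉₊ t, by simp [hα0], ?_⟩
  intro t
  set N := ⌈|t|⌉₊ + 1 with hN
  have hlt : |t| < (N:ℝ) := by
    have := Nat.le_ceil |t|
    rw [hN]; push_cast; linarith
  have heq : ∀ s ∈ Ioo (-(N:ℝ)) (N:ℝ), α ⌈|s|⌉₊ s = α N s := by
    intro s hs
    have hs' : |s| < N := abs_lt.2 hs
    apply huniq _ _ (Nat.ceil_le.2 hs'.le)
    have := Nat.le_ceil |s|
    exact abs_lt.1 (by linarith)
  have htm : t ∈ Ioo (-(N:ℝ)) (N:ℝ) := abs_lt.1 hlt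
  have hd := hα N t ⟨by linarith [htm.1], by linarith [htm.2]⟩
  have : (fun s => α ⌈|s|⌉₊ s) =ᶠ[𝓝 t] α N := by
    filter_upwards [Ioo_mem_nhds htm.1 htm.2] with s hs using heq s hs
  have h2 := hd.congr_of_eventuallyEq this
  simpa [heq t htm] using h2

/-- one-dimensional barrier -/
theorem aux_barrier (f f' : ℝ → ℝ) (c : ℝ) (hf : ∀ t, HasDerivAt f (f' t) t) (h0 : f 0 ≤ c)
    (h : ∀ t, c ≤ f t → f' t ≤ 0) : ∀ t, 0 ≤ t → f t ≤ c := by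
  intro t ht
  by_contra! hlt
  have hcont : Continuous f := continuous_iff_continuousAt.2 fun t => (hf t).continuousAt
  let A := {s | s ∈ Icc 0 t ∧ f s ≤ c}
  have hAc : IsCompact A :=
    isCompact_Icc.inter_right (isClosed_le hcont continuous_const)
  obtain ⟨s, ⟨hs, hsc⟩, hmax⟩ := hAc.exists_isMaxOn ⟨0, ⟨le_rfl, ht⟩, h0⟩ continuousOn_id
  have hanti : AntitoneOn f (Icc s t) := by
    apply antitoneOn_of_hasDerivWithinAt_nonpos (convex_Icc s t) hcont.continuousOn
      (f' := f') (fun x _ => (hf x).hasDerivWithinAt)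
    intro x hx
    rw [interior_Icc] at hx
    apply h
    by_contra! hx2
    have := hmax (show x ∈ A from ⟨⟨by linarith [hx.1, hs.1], hx.2.le⟩, hx2.le⟩)
    simp at this
    linarith [hx.1]
  have := hanti ⟨le_rfl, hs.2⟩ ⟨hs.2, le_rfl⟩ hs.2
  linarith

/-- scalar form of the existence of a solution with small positive initial data -/
theorem aux_exists_s5 (a b c m p q K : ℝ) (ha : 0 < a) (hb : 0 < b) (hc : 0 < c) (hm : 0 < m)
    (hp : 0 < p) (hq : 0 < q) (hK : 0 < K) (d : ℝ) (hd : 0 < d) :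
    ∃ x : ℝ → Fin 3 → ℝ, (∀ t, 0 ≤ t → HasDerivAt x
      (![b * (1 - x t 0 / K) * x t 1 - a * x t 0, p * x t 2 - c * x t 1,
        q * x t 0 - m * x t 2]) t) ∧ (∀ t, 0 ≤ t → ∀ i, 0 ≤ x t i) ∧
      (∀ t, 0 ≤ t → 0 < x t 0) ∧ dist (x 0) 0 < d := by
  set Mm := q * K / m with hMm
  set Fm := p * Mm / c with hFm
  have hMp : 0 < Mm := by positivity
  have hFp : 0 < Fm := by positivity
  let top : Fin 3 → ℝ := ![K, Fm, Mm]
  have htop : ∀ i, 0 < top i := by intro i; fin_cases i <;> simp [top, hK, hFp, hMp]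
  let G : (Fin 3 → ℝ) → (Fin 3 → ℝ) := fun u =>
    ![b * (1 - u 0 / K) * u 1 - a * u 0, p * u 2 - c * u 1, q * u 0 - m * u 2]
  have hG : ContDiff ℝ 1 G := by
    rw [contDiff_pi]
    intro i
    fin_cases i <;> simp [G] <;> fun_prop
  let P : (Fin 3 → ℝ) → (Fin 3 → ℝ) := fun u i => max 0 (min (u i) (top i))
  have hPB : ∀ u, P u ∈ Icc (0 : Fin 3 → ℝ) top := by
    intro u
    exact ⟨fun i => le_max_left _ _, fun i => max_le (htop i).le (min_le_right _ _)⟩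
  have hPL : LipschitzWith 1 P := by
    have hi : ∀ i, LipschitzWith 1 (fun u => P u i) := by
      intro i
      have h1 : LipschitzWith 1 (fun u : Fin 3 → ℝ => u i) := LipschitzWith.eval i
      exact (h1.min_const (top i)).const_max 0
    apply LipschitzWith.of_dist_le_mul
    intro u v
    rw [dist_pi_le_iff (by positivity)]
    intro i
    exact (hi i).dist_le_mul u v
  have hcomp : IsCompact (Icc (0 : Fin 3 → ℝ) top) := isCompact_Icc
  obtain ⟨L, hL⟩ := hG.contDiffOn.exists_lipschitzOnWith (s := Icc (0 : Fin 3 → ℝ) top)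
    one_ne_zero (convex_Icc _ _) hcomp
  obtain ⟨C, hC⟩ := hcomp.exists_bound_of_continuousOn hG.continuous.continuousOn
  have hGL : LipschitzWith (L * 1) (G ∘ P) := by
    rw [← lipschitzOnWith_univ]
    exact hL.comp hPL.lipschitzOnWith (fun u _ => hPB u)
  set ε := min (d/2) K with hε
  have hεp : 0 < ε := lt_min (by linarith) hK
  obtain ⟨x, hx0, hx⟩ := aux_global_exists (G ∘ P) (L * 1) C.toNNReal hGL
    (fun u => (hC _ (hPB u)).trans (Real.le_coe_toNNReal C)) ![ε, 0, 0]
  have hxi : ∀ i t, HasDerivAt (fun t => x t i) (G (P (x t)) i) t := by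
    intro i t
    exact (hasDerivAt_pi.1 (hx t)) i
  have hup : ∀ i t, 0 ≤ t → x t i ≤ top i := by
    intro i
    apply aux_barrier _ _ _ (hxi i)
    · rw [hx0]
      fin_cases i
      · have : ε ≤ K := min_le_right _ _
        simpa [top] using this
      · simpa [top] using hFp.le
      · simpa [top] using hMp.le
    · intro t hti
      have hPi : P (x t) i = top i := by
        simp only [P]; rw [min_eq_right hti]; exact max_eq_right (htop i).le
      have hB := hPB (x t)
      have l0 := hB.1 0
      have l1 := hB.1 1
      have l2 := hB.1 2
      have u0 := hB.2 0
      have u1 := hB.2 1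
      have u2 := hB.2 2
      simp only [top, Pi.zero_apply, Matrix.cons_val] at l0 l1 l2 u0 u1 u2
      fin_cases i
      · simp [top] at hPi
        simp [G, hPi, hK.ne']
        positivity
      · simp [top] at hPi
        simp [G, hPi]
        have : c * Fm = p * Mm := by rw [hFm]; field_simp
        nlinarith
      · simp [top] at hPi
        simp [G, hPi]
        have : m * Mm = q * K := by rw [hMm]; field_simp
        nlinarith
  have hlo : ∀ i t, 0 ≤ t → 0 ≤ x t i := by
    intro i t ht
    have := aux_barrier (fun t => - x t i) (fun t => - G (P (x t)) i) 0 (fun t => (hxi i t).neg)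
      ?_ ?_ t ht
    · simpa using this
    · rw [hx0]
      fin_cases i <;> simp [hεp.le]
    · intro t hti
      have hti' : x t i ≤ 0 := by linarith
      have hPi : P (x t) i = 0 := by
        simp only [P]; exact max_eq_left ((min_le_left _ _).trans hti')
      have hB := hPB (x t)
      have l0 := hB.1 0
      have l1 := hB.1 1
      have l2 := hB.1 2
      simp only [Pi.zero_apply] at l0 l1 l2
      fin_cases i
      · simp at hPi
        simp [G, hPi]
        positivity
      · simp at hPi
        simp [G, hPi]
        positivity
      · simp at hPi
        simp [G, hPi]
        positivity
  have hPx : ∀ t, 0 ≤ t → P (x t) = x t := by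
    intro t ht
    funext i
    simp only [P]
    rw [min_eq_left (hup i t ht), max_eq_right (hlo i t ht)]
  refine ⟨x, ?_, fun t ht i => hlo i t ht, ?_, ?_⟩
  · intro t ht
    have := hx t
    simp only [Function.comp, hPx t ht] at this
    exact this
  · intro t ht
    have hder : ∀ s, HasDerivAt (fun s => x s 0 * Real.exp (a * s))
        (G (P (x s)) 0 * Real.exp (a * s) + x s 0 * (Real.exp (a * s) * a)) s := by
      intro s
      have he : HasDerivAt (fun s => Real.exp (a * s)) (Real.exp (a * s) * a) s := by
        simpa using ((hasDerivAt_id s).const_mul a).exp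
      exact (hxi 0 s).mul he
    have hmono : MonotoneOn (fun s => x s 0 * Real.exp (a * s)) (Icc 0 t) := by
      apply monotoneOn_of_hasDerivWithinAt_nonneg (convex_Icc 0 t)
        (fun s _ => (hder s).continuousAt.continuousWithinAt)
        (fun s _ => (hder s).hasDerivWithinAt)
      intro s hs
      rw [interior_Icc] at hs
      have hs0 := hs.1.le
      rw [hPx s hs0]
      have e := Real.exp_pos (a * s)
      have h1 := hlo 1 s hs0
      have h2 : x s 0 ≤ K := hup 0 s hs0
      have h3 : 0 ≤ 1 - x s 0 / K := by
        rw [sub_nonneg]; exact (div_le_one hK).2 h2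
      have : G (x s) 0 * Real.exp (a * s) + x s 0 * (Real.exp (a * s) * a)
        = b * (1 - x s 0 / K) * x s 1 * Real.exp (a * s) := by
        simp [G]; ring
      rw [this]
      positivity
    have := hmono ⟨le_rfl, ht⟩ ⟨ht, le_rfl⟩ ht
    simp [hx0] at this
    have h4 : 0 < x t 0 * Real.exp (a * t) := by linarith
    exact pos_of_mul_pos_left h4 (Real.exp_pos _).le
  · rw [hx0, dist_pi_lt_iff hd]
    intro i
    fin_cases i
    · simp [abs_of_pos hεp]
      exact (min_le_left _ _).trans_lt (by linarith)
    · simpa using hd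
    · simpa using hd

def auxPhi (s : ℝ) : ℝ := s - 1 - Real.log s

theorem auxPhi_nonneg {s : ℝ} (hs : 0 < s) : 0 ≤ auxPhi s := by
  have := Real.log_le_sub_one_of_pos hs
  unfold auxPhi; linarith

theorem auxPhi_ge {s : ℝ} (hs : 0 < s) : (Real.sqrt s - 1)^2 ≤ auxPhi s := by
  have h1 := Real.log_le_sub_one_of_pos (Real.sqrt_pos.2 hs)
  rw [Real.log_sqrt hs.le] at h1
  have h2 := Real.sq_sqrt hs.le
  unfold auxPhi; nlinarith

theorem auxPhi_pos {s : ℝ} (hs : 0 < s) (h : s ≠ 1) : 0 < auxPhi s := by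
  have := Real.log_lt_sub_one_of_pos hs h
  unfold auxPhi; linarith

theorem auxPhi_small (ε : ℝ) (hε : 0 < ε) : ∃ η > 0, ∀ s, 0 < s → auxPhi s < η → |s - 1| < ε := by
  have hc : ContinuousAt (fun v : ℝ => v^2) 1 := by fun_prop
  obtain ⟨η, hη, h⟩ := Metric.continuousAt_iff.1 hc ε hε
  refine ⟨η^2, by positivity, fun s hs hlt => ?_⟩
  have h1 : |Real.sqrt s - 1| < η := abs_lt_of_sq_lt_sq ((auxPhi_ge hs).trans_lt hlt) hη.le
  have h2 := h (x := Real.sqrt s) (by rwa [Real.dist_eq])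
  simpa [Real.dist_eq, Real.sq_sqrt hs.le] using h2

theorem auxPhi_lower {s C : ℝ} (hs : 0 < s) (h : auxPhi s ≤ C) : Real.exp (-(C+1)) ≤ s := by
  rw [← Real.le_log_iff_exp_le hs]
  unfold auxPhi at h; linarith

theorem auxPhi_upper {s C : ℝ} (hs : 0 < s) (h : auxPhi s ≤ C) : s ≤ 2 * (C + 1) := by
  have h1 := Real.log_le_sub_one_of_pos (half_pos hs)
  rw [Real.log_div hs.ne' two_ne_zero] at h1
  have h2 := Real.log_le_sub_one_of_pos (show (0:ℝ) < 2 by norm_num)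
  unfold auxPhi at h; linarith

def auxV (a c m : ℝ) (x y z : ℝ) : ℝ := auxPhi x / a + auxPhi y / c + auxPhi z / m

def auxW (k x y z : ℝ) : ℝ :=
  auxPhi (y / x) + auxPhi (z / y) + auxPhi (x / z) + k * y * (x - 1)^2 / x

theorem auxW_nonneg {k x y z : ℝ} (hk : 0 < k) (hx : 0 < x) (hy : 0 < y) (hz : 0 < z) :
    0 ≤ auxW k x y z := by
  have h1 := auxPhi_nonneg (div_pos hy hx)
  have h2 := auxPhi_nonneg (div_pos hz hy)
  have h3 := auxPhi_nonneg (div_pos hx hz)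
  have h4 : 0 ≤ k * y * (x - 1)^2 / x := by positivity
  unfold auxW; linarith

theorem auxW_pos {k x y z : ℝ} (hk : 0 < k) (hx : 0 < x) (hy : 0 < y) (hz : 0 < z)
    (h : ¬ (x = 1 ∧ y = 1 ∧ z = 1)) : 0 < auxW k x y z := by
  have h1 := auxPhi_nonneg (div_pos hy hx)
  have h2 := auxPhi_nonneg (div_pos hz hy)
  have h3 := auxPhi_nonneg (div_pos hx hz)
  have h4 : 0 ≤ k * y * (x - 1)^2 / x := by positivity
  unfold auxW
  by_cases hx1 : x = 1
  · by_cases hy1 : y = 1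
    · have hz1 : z ≠ 1 := fun hz1 => h ⟨hx1, hy1, hz1⟩
      have : 0 < auxPhi (z / y) := auxPhi_pos (div_pos hz hy) (by simpa [hy1] using hz1)
      linarith
    · have : 0 < auxPhi (y / x) := auxPhi_pos (div_pos hy hx) (by simpa [hx1] using hy1)
      linarith
  · have : 0 < k * y * (x - 1)^2 / x := by
      have : x - 1 ≠ 0 := sub_ne_zero.2 hx1
      positivity
    linarith

theorem auxPhi_hasDerivAt {f : ℝ → ℝ} {f' t : ℝ} (hf : HasDerivAt f f' t) (hp : 0 < f t) :
    HasDerivAt (fun t => auxPhi (f t)) (f' - f' / f t) t := by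
  exact (hf.sub_const 1).sub (hf.log hp.ne')

theorem auxV_deriv (a c m k : ℝ) (ha : 0 < a) (hc : 0 < c) (hm : 0 < m)
    (x y z : ℝ → ℝ) (t : ℝ)
    (hx : HasDerivAt x (a * ((y t - x t) + k * y t * (1 - x t))) t)
    (hy : HasDerivAt y (c * (z t - y t)) t)
    (hz : HasDerivAt z (m * (x t - z t)) t) (px : 0 < x t) (py : 0 < y t) (pz : 0 < z t) :
    HasDerivAt (fun t => auxV a c m (x t) (y t) (z t)) (- auxW k (x t) (y t) (z t)) t := by
  have := (((auxPhi_hasDerivAt hx px).div_const a).add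
    ((auxPhi_hasDerivAt hy py).div_const c)).add ((auxPhi_hasDerivAt hz pz).div_const m)
  convert! this using 1
  unfold auxW auxPhi
  rw [Real.log_div py.ne' px.ne', Real.log_div pz.ne' py.ne', Real.log_div px.ne' pz.ne']
  field_simp
  ring

theorem auxV_anti (a c m k : ℝ) (ha : 0 < a) (hc : 0 < c) (hm : 0 < m) (hk : 0 < k)
    (x y z : ℝ → ℝ) (t0 : ℝ)
    (hx : ∀ t, t0 ≤ t → HasDerivAt x (a * ((y t - x t) + k * y t * (1 - x t))) t)
    (hy : ∀ t, t0 ≤ t → HasDerivAt y (c * (z t - y t)) t)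
    (hz : ∀ t, t0 ≤ t → HasDerivAt z (m * (x t - z t)) t)
    (px : ∀ t, t0 ≤ t → 0 < x t) (py : ∀ t, t0 ≤ t → 0 < y t) (pz : ∀ t, t0 ≤ t → 0 < z t) :
    AntitoneOn (fun t => auxV a c m (x t) (y t) (z t)) (Ici t0) := by
  have hd : ∀ t, t0 ≤ t → _ := fun t ht => auxV_deriv a c m k ha hc hm x y z t
    (hx t ht) (hy t ht) (hz t ht) (px t ht) (py t ht) (pz t ht)
  apply antitoneOn_of_hasDerivWithinAt_nonpos (convex_Ici t0)
    (fun s hs => (hd s hs).continuousAt.continuousWithinAt)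
    (fun s hs => (hd s (interior_subset hs)).hasDerivWithinAt)
  intro s hs
  have hs := interior_subset hs
  have := auxW_nonneg hk (px s hs) (py s hs) (pz s hs)
  linarith

theorem auxV_bounds {a c m x y z C : ℝ} (ha : 0 < a) (hc : 0 < c) (hm : 0 < m)
    (px : 0 < x) (py : 0 < y) (pz : 0 < z) (h : auxV a c m x y z ≤ C) :
    auxPhi x ≤ a * C ∧ auxPhi y ≤ c * C ∧ auxPhi z ≤ m * C := by
  have h1 := div_nonneg (auxPhi_nonneg px) ha.le
  have h2 := div_nonneg (auxPhi_nonneg py) hc.le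
  have h3 := div_nonneg (auxPhi_nonneg pz) hm.le
  unfold auxV at h
  refine ⟨?_, ?_, ?_⟩
  · rw [mul_comm, ← div_le_iff₀ ha]; linarith
  · rw [mul_comm, ← div_le_iff₀ hc]; linarith
  · rw [mul_comm, ← div_le_iff₀ hm]; linarith

theorem auxV_small (a c m : ℝ) (ha : 0 < a) (hc : 0 < c) (hm : 0 < m) (ε : ℝ) (hε : 0 < ε) :
    ∃ η > 0, ∀ x y z, 0 < x → 0 < y → 0 < z → auxV a c m x y z < η →
      |x - 1| < ε ∧ |y - 1| < ε ∧ |z - 1| < ε := by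
  obtain ⟨η, hη, h⟩ := auxPhi_small ε hε
  set S := a + c + m with hS
  have hSp : 0 < S := by positivity
  refine ⟨η / (2 * S), by positivity, fun x y z px py pz hlt => ?_⟩
  obtain ⟨h1, h2, h3⟩ := auxV_bounds ha hc hm px py pz hlt.le
  have key : ∀ w, 0 < w → w ≤ S → w * (η / (2 * S)) < η := by
    intro w hw hwS
    have : w * (η / (2 * S)) ≤ S * (η / (2 * S)) := by gcongr
    have h2 : S * (η / (2 * S)) = η / 2 := by field_simp
    linarith
  exact ⟨h x px (h1.trans_lt (key a ha (by linarith))),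
    h y py (h2.trans_lt (key c hc (by linarith))), h z pz (h3.trans_lt (key m hm (by linarith)))⟩

theorem auxV_event (a c m k : ℝ) (ha : 0 < a) (hc : 0 < c) (hm : 0 < m) (hk : 0 < k)
    (x y z : ℝ → ℝ) (t0 : ℝ)
    (hx : ∀ t, t0 ≤ t → HasDerivAt x (a * ((y t - x t) + k * y t * (1 - x t))) t)
    (hy : ∀ t, t0 ≤ t → HasDerivAt y (c * (z t - y t)) t)
    (hz : ∀ t, t0 ≤ t → HasDerivAt z (m * (x t - z t)) t)
    (px : ∀ t, t0 ≤ t → 0 < x t) (py : ∀ t, t0 ≤ t → 0 < y t) (pz : ∀ t, t0 ≤ t → 0 < z t)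
    (η : ℝ) (hη : 0 < η) :
    ∃ T, t0 ≤ T ∧ auxV a c m (x T) (y T) (z T) < η := by
  by_contra! hcon
  have hanti := auxV_anti a c m k ha hc hm hk x y z t0 hx hy hz px py pz
  set v := fun t => auxV a c m (x t) (y t) (z t) with hv
  set C := v t0 with hC
  let B : Set (ℝ × ℝ × ℝ) := Icc (Real.exp (-(a*C+1))) (2*(a*C+1)) ×ˢ
    (Icc (Real.exp (-(c*C+1))) (2*(c*C+1)) ×ˢ Icc (Real.exp (-(m*C+1))) (2*(m*C+1)))
  have hBpos : ∀ u ∈ B, 0 < u.1 ∧ 0 < u.2.1 ∧ 0 < u.2.2 := by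
    rintro ⟨p, q, r⟩ ⟨h1, h2, h3⟩
    exact ⟨(Real.exp_pos _).trans_le h1.1, (Real.exp_pos _).trans_le h2.1,
      (Real.exp_pos _).trans_le h3.1⟩
  have hBc : IsCompact B := isCompact_Icc.prod (isCompact_Icc.prod isCompact_Icc)
  have hVc : ContinuousOn (fun u : ℝ × ℝ × ℝ => auxV a c m u.1 u.2.1 u.2.2) B := by
    unfold auxV auxPhi
    have h1 : ∀ u ∈ B, u.1 ≠ 0 := fun u hu => (hBpos u hu).1.ne'
    have h2 : ∀ u ∈ B, u.2.1 ≠ 0 := fun u hu => (hBpos u hu).2.1.ne'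
    have h3 : ∀ u ∈ B, u.2.2 ≠ 0 := fun u hu => (hBpos u hu).2.2.ne'
    fun_prop (disch := assumption)
  have hWc : ContinuousOn (fun u : ℝ × ℝ × ℝ => auxW k u.1 u.2.1 u.2.2) B := by
    unfold auxW auxPhi
    have h1 : ∀ u ∈ B, u.1 ≠ 0 := fun u hu => (hBpos u hu).1.ne'
    have h2 : ∀ u ∈ B, u.2.1 ≠ 0 := fun u hu => (hBpos u hu).2.1.ne'
    have h3 : ∀ u ∈ B, u.2.2 ≠ 0 := fun u hu => (hBpos u hu).2.2.ne'
    have h4 : ∀ u ∈ B, u.2.1 / u.1 ≠ 0 := fun u hu => div_ne_zero (h2 u hu) (h1 u hu)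
    have h5 : ∀ u ∈ B, u.2.2 / u.2.1 ≠ 0 := fun u hu => div_ne_zero (h3 u hu) (h2 u hu)
    have h6 : ∀ u ∈ B, u.1 / u.2.2 ≠ 0 := fun u hu => div_ne_zero (h1 u hu) (h3 u hu)
    fun_prop (disch := assumption)
  let A : Set (ℝ × ℝ × ℝ) := B ∩ (fun u => auxV a c m u.1 u.2.1 u.2.2) ⁻¹' Ici η
  have hAc : IsCompact A :=
    hBc.of_isClosed_subset (hVc.preimage_isClosed_of_isClosed hBc.isClosed isClosed_Ici)
      inter_subset_left
  have hmem : ∀ t, t0 ≤ t → (x t, y t, z t) ∈ A := by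
    intro t ht
    have hle : v t ≤ C := hanti (mem_Ici.2 le_rfl) (mem_Ici.2 ht) ht
    obtain ⟨h1, h2, h3⟩ := auxV_bounds ha hc hm (px t ht) (py t ht) (pz t ht) hle
    exact ⟨⟨⟨auxPhi_lower (px t ht) h1, auxPhi_upper (px t ht) h1⟩,
      ⟨auxPhi_lower (py t ht) h2, auxPhi_upper (py t ht) h2⟩,
      ⟨auxPhi_lower (pz t ht) h3, auxPhi_upper (pz t ht) h3⟩⟩, hcon t ht⟩
  obtain ⟨u, hu, hmin⟩ := hAc.exists_isMinOn ⟨_, hmem t0 le_rfl⟩ (hWc.mono inter_subset_left)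
  set w := auxW k u.1 u.2.1 u.2.2 with hw
  have hwp : 0 < w := by
    obtain ⟨p1, p2, p3⟩ := hBpos u hu.1
    apply auxW_pos hk p1 p2 p3
    rintro ⟨e1, e2, e3⟩
    have : η ≤ auxV a c m u.1 u.2.1 u.2.2 := hu.2
    rw [e1, e2, e3] at this
    simp [auxV, auxPhi] at this
    linarith
  have hd : ∀ t, t0 ≤ t → HasDerivAt (fun t => v t + w * t)
      (- auxW k (x t) (y t) (z t) + w) t := fun t ht => by
    have h1 := auxV_deriv a c m k ha hc hm x y z t
      (hx t ht) (hy t ht) (hz t ht) (px t ht) (py t ht) (pz t ht)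
    have h2 : HasDerivAt (fun t => w * t) w t := by simpa using (hasDerivAt_id t).const_mul w
    exact h1.add h2
  have hanti2 : AntitoneOn (fun t => v t + w * t) (Ici t0) := by
    apply antitoneOn_of_hasDerivWithinAt_nonpos (convex_Ici t0)
      (fun s hs => (hd s hs).continuousAt.continuousWithinAt)
      (fun s hs => (hd s (interior_subset hs)).hasDerivWithinAt)
    intro s hs
    have := hmin (hmem s (interior_subset hs))
    simp only [mem_ofPred_eq] at this
    linarith
  have hCη : η ≤ C := hcon t0 le_rfl
  have hT : t0 ≤ t0 + C / w := by
    have : 0 ≤ C / w := div_nonneg (by linarith) hwp.le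
    linarith
  have h1 := hanti2 (mem_Ici.2 le_rfl) (mem_Ici.2 hT) hT
  have h2 : η ≤ v (t0 + C / w) := hcon _ hT
  have h3 : w * (t0 + C / w) = w * t0 + C := by field_simp
  simp only [h3] at h1
  linarith

theorem aux_conv (a c m k : ℝ) (ha : 0 < a) (hc : 0 < c) (hm : 0 < m) (hk : 0 < k)
    (x y z : ℝ → ℝ) (t0 : ℝ)
    (hx : ∀ t, t0 ≤ t → HasDerivAt x (a * ((y t - x t) + k * y t * (1 - x t))) t)
    (hy : ∀ t, t0 ≤ t → HasDerivAt y (c * (z t - y t)) t)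
    (hz : ∀ t, t0 ≤ t → HasDerivAt z (m * (x t - z t)) t)
    (px : ∀ t, t0 ≤ t → 0 < x t) (py : ∀ t, t0 ≤ t → 0 < y t) (pz : ∀ t, t0 ≤ t → 0 < z t)
    (ε : ℝ) (hε : 0 < ε) :
    ∃ T, ∀ t, T ≤ t → |x t - 1| < ε ∧ |y t - 1| < ε ∧ |z t - 1| < ε := by
  obtain ⟨η, hη, h⟩ := auxV_small a c m ha hc hm ε hε
  obtain ⟨T, hT, hV⟩ := auxV_event a c m k ha hc hm hk x y z t0 hx hy hz px py pz η hη
  refine ⟨T, fun t ht => ?_⟩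
  have ht0 := hT.trans ht
  apply h _ _ _ (px t ht0) (py t ht0) (pz t ht0)
  exact (auxV_anti a c m k ha hc hm hk x y z t0 hx hy hz px py pz hT ht0 ht).trans_lt hV

theorem aux_stab (a c m k : ℝ) (ha : 0 < a) (hc : 0 < c) (hm : 0 < m) (hk : 0 < k)
    (ε : ℝ) (hε : 0 < ε) :
    ∃ d > 0, d < 1 ∧ ∀ (x y z : ℝ → ℝ),
    (∀ t, 0 ≤ t → HasDerivAt x (a * ((y t - x t) + k * y t * (1 - x t))) t) →
    (∀ t, 0 ≤ t → HasDerivAt y (c * (z t - y t)) t) →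
    (∀ t, 0 ≤ t → HasDerivAt z (m * (x t - z t)) t) →
    (∀ t, 0 ≤ t → 0 < x t) → (∀ t, 0 ≤ t → 0 < y t) → (∀ t, 0 ≤ t → 0 < z t) →
    |x 0 - 1| < d → |y 0 - 1| < d → |z 0 - 1| < d →
    ∀ t, 0 ≤ t → |x t - 1| < ε ∧ |y t - 1| < ε ∧ |z t - 1| < ε := by
  obtain ⟨η, hη, h⟩ := auxV_small a c m ha hc hm ε hε
  have hcont : ContinuousAt (fun u : ℝ × ℝ × ℝ => auxV a c m u.1 u.2.1 u.2.2) (1, 1, 1) := by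
    unfold auxV auxPhi
    have h1 : ((1, 1, 1) : ℝ × ℝ × ℝ).1 ≠ 0 := by simp
    have h2 : ((1, 1, 1) : ℝ × ℝ × ℝ).2.1 ≠ 0 := by simp
    have h3 : ((1, 1, 1) : ℝ × ℝ × ℝ).2.2 ≠ 0 := by simp
    fun_prop (disch := assumption)
  obtain ⟨d, hd, hd2⟩ := Metric.continuousAt_iff.1 hcont η hη
  refine ⟨min d (1/2), by positivity, (min_le_right _ _).trans_lt (by norm_num), ?_⟩
  intro x y z hx hy hz px py pz x0 y0 z0 t ht
  apply h _ _ _ (px t ht) (py t ht) (pz t ht)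
  have hle := auxV_anti a c m k ha hc hm hk x y z 0 hx hy hz px py pz (mem_Ici.2 le_rfl) ht ht
  have h4 := hd2 (x := (x 0, y 0, z 0)) (by
    simp only [Prod.dist_eq, Real.dist_eq]
    have := min_le_left d (1/2)
    exact max_lt (by linarith) (max_lt (by linarith) (by linarith)))
  rw [Real.dist_eq] at h4
  have h5 : auxV a c m 1 1 1 = 0 := by simp [auxV, auxPhi]
  simp only [h5, sub_zero] at h4
  exact hle.trans_lt ((le_abs_self _).trans_lt h4)

theorem aux_pos {f : ℝ → ℝ} {f' t : ℝ} (ht : 0 < t) (hf : HasDerivAt f f' t)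
    (h : ∀ s, 0 ≤ s → 0 ≤ f s) (h0 : f t = 0) : f' = 0 := by
  have hmin : IsLocalMin f t := by
    filter_upwards [Ioi_mem_nhds ht] with s hs
    rw [h0]; exact h s (le_of_lt hs)
  exact hmin.hasDerivAt_eq_zero hf

/-- If `N̂₀ > 1` then `TE = (0,0,0)` is unstable and the male-scarcity system admits the
positive equilibrium `ÊE = (Î, F̂, M̂)`, which is globally asymptotically stable on
ℝ³₊ \ {u ∈ ℝ³₊ : I = F = 0}. -/
theorem scarcityEndemicEquilibrium_GAS_of_offspring_gt_one
    (b K γ r νI μI νY μY δ μF μM Nhat0 Ihat Fhat Mhat : ℝ)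
    (hb : 0 < b) (hK : 0 < K) (hγ : 0 < γ) (hr : 0 < r) (hr1 : r < 1)
    (hνI : 0 < νI) (hμI : 0 < μI) (hνY : 0 < νY) (hμY : 0 < μY)
    (hδ : 0 < δ) (hμF : 0 < μF) (hμM : 0 < μM)
    (hN : Nhat0 = b * γ * (1 - r) * νI * νY / ((νI + μI) * (δ + μF) * μM))
    (hgt : 1 < Nhat0)
    (hI : Ihat = (1 - 1 / Nhat0) * K)
    (hF : Fhat = γ * (1 - r) * νI * νY * (1 - 1 / Nhat0) * K / ((δ + μF) * μM))
    (hM : Mhat = (1 - r) * νI * (1 - 1 / Nhat0) * K / μM) :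
    ¬ StableOn3 (mScarce3 b K γ r νI μI νY δ μF μM) Orthant3 0 ∧
    mScarce3 b K γ r νI μI νY δ μF μM ![Ihat, Fhat, Mhat] = 0 ∧
    (∀ i, 0 < ![Ihat, Fhat, Mhat] i) ∧
    GASOn3 (mScarce3 b K γ r νI μI νY δ μF μM)
      (Orthant3 \ {u | u 0 = 0 ∧ u 1 = 0}) ![Ihat, Fhat, Mhat] := by
  have hr' : 0 < 1 - r := by linarith
  set a := νI + μI with ha_def
  set c := δ + μF with hc_def
  have ha : 0 < a := by positivity
  have hc : 0 < c := by positivity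
  have hN0 : 0 < Nhat0 := by linarith
  have hNe : Nhat0 * (a * c * μM) = b * γ * (1 - r) * νI * νY := by
    rw [hN]; field_simp
  have hθ : 0 < 1 - 1 / Nhat0 := by
    rw [sub_pos]; exact (div_lt_one hN0).2 hgt
  have hIp : 0 < Ihat := by rw [hI]; positivity
  have hFp : 0 < Fhat := by rw [hF]; positivity
  have hMp : 0 < Mhat := by rw [hM]; positivity
  have hk : 0 < Nhat0 - 1 := by linarith
  have e1 : b * Fhat = a * Nhat0 * Ihat := by
    have : b * Fhat = (b * γ * (1 - r) * νI * νY) * (1 - 1 / Nhat0) * K / (c * μM) := by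
      rw [hF]; ring
    rw [this, ← hNe, hI]; field_simp
  have e2 : νY * γ * Mhat = c * Fhat := by
    rw [hM, hF]; field_simp
  have e3 : (1 - r) * νI * Ihat = μM * Mhat := by
    rw [hM, hI]; field_simp
  have e4 : Nhat0 * Ihat = (Nhat0 - 1) * K := by
    rw [hI]; field_simp
  have hIK : Nhat0 * (Ihat / K) = Nhat0 - 1 := by
    rw [← mul_div_assoc, e4]; field_simp
  set S : Set (Fin 3 → ℝ) := Orthant3 \ {u | u 0 = 0 ∧ u 1 = 0} with hS
  -- positivity
  have hposall : ∀ x : ℝ → Fin 3 → ℝ, IsSolOn3 (mScarce3 b K γ r νI μI νY δ μF μM) S x →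
      ∀ t, 0 < t → ∀ i, 0 < x t i := by
    intro x hx t ht
    have hd := hasDerivAt_pi.1 (hx.1 t ht.le)
    have hnn : ∀ i s, 0 ≤ s → 0 ≤ x s i := fun i s hs => (hx.2 s hs).1 i
    have hd0 := hd 0
    have hd1 := hd 1
    have hd2 := hd 2
    simp only [mScarce3, Matrix.cons_val] at hd0 hd1 hd2
    have p0 : 0 < x t 0 := by
      rcases (hnn 0 t ht.le).lt_or_eq with h | h
      · exact h
      · exfalso
        have := aux_pos ht hd0 (hnn 0) h.symm
        rw [← h] at this
        have h1 : x t 1 = 0 := by simpa [hb.ne'] using this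
        exact (hx.2 t ht.le).2 ⟨h.symm, h1⟩
    have p2 : 0 < x t 2 := by
      rcases (hnn 2 t ht.le).lt_or_eq with h | h
      · exact h
      · exfalso
        have := aux_pos ht hd2 (hnn 2) h.symm
        rw [← h] at this
        have h1 : 0 < (1 - r) * νI * x t 0 := by positivity
        linarith
    have p1 : 0 < x t 1 := by
      rcases (hnn 1 t ht.le).lt_or_eq with h | h
      · exact h
      · exfalso
        have := aux_pos ht hd1 (hnn 1) h.symm
        rw [← h] at this
        have h1 : 0 < νY * γ * x t 2 := by positivity
        linarith
    intro i
    fin_cases i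
    · exact p0
    · exact p1
    · exact p2
  -- scaled derivatives
  have hders : ∀ x : ℝ → Fin 3 → ℝ, IsSolOn3 (mScarce3 b K γ r νI μI νY δ μF μM) S x →
      ∀ t, 0 ≤ t →
      HasDerivAt (fun t => x t 0 / Ihat) (a * ((x t 1 / Fhat - x t 0 / Ihat)
        + (Nhat0 - 1) * (x t 1 / Fhat) * (1 - x t 0 / Ihat))) t ∧
      HasDerivAt (fun t => x t 1 / Fhat) (c * (x t 2 / Mhat - x t 1 / Fhat)) t ∧
      HasDerivAt (fun t => x t 2 / Mhat) (μM * (x t 0 / Ihat - x t 2 / Mhat)) t := by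
    intro x hx t ht
    have hd := hasDerivAt_pi.1 (hx.1 t ht)
    have hd0 := (hd 0).div_const Ihat
    have hd1 := (hd 1).div_const Fhat
    have hd2 := (hd 2).div_const Mhat
    simp only [mScarce3, Matrix.cons_val] at hd0 hd1 hd2
    obtain ⟨X, hX⟩ : ∃ X, x t 0 = Ihat * X := ⟨x t 0 / Ihat, by field_simp⟩
    obtain ⟨Y, hY⟩ : ∃ Y, x t 1 = Fhat * Y := ⟨x t 1 / Fhat, by field_simp⟩
    obtain ⟨Z, hZ⟩ : ∃ Z, x t 2 = Mhat * Z := ⟨x t 2 / Mhat, by field_simp⟩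
    have eX : Ihat * X / Ihat = X := by field_simp
    have eY : Fhat * Y / Fhat = Y := by field_simp
    have eZ : Mhat * Z / Mhat = Z := by field_simp
    rw [← ha_def, hX, hY] at hd0
    rw [← hc_def, hY, hZ] at hd1
    rw [hX, hZ] at hd2
    rw [hX, hY, hZ, eX, eY, eZ]
    refine ⟨?_, ?_, ?_⟩
    · convert! hd0 using 1
      rw [eq_div_iff hIp.ne']
      have : b * (1 - Ihat * X / K) * (Fhat * Y) = (b * Fhat) * Y * (1 - (Ihat / K) * X) := by ring
      rw [this, e1]
      linear_combination (a * Ihat * Y * X) * hIK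
    · convert! hd1 using 1
      rw [eq_div_iff hFp.ne']
      linear_combination (-Z) * e2
    · convert! hd2 using 1
      rw [eq_div_iff hMp.ne']
      linear_combination (-X) * e3
  have hequil : mScarce3 b K γ r νI μI νY δ μF μM ![Ihat, Fhat, Mhat] = 0 := by
    funext i
    fin_cases i
    · simp [mScarce3]
      linear_combination (1 - Ihat / K) * e1 - a * Ihat * hIK
    · simp [mScarce3]
      linear_combination e2
    · simp [mScarce3]
      linear_combination e3
  have hstab : StableOn3 (mScarce3 b K γ r νI μI νY δ μF μM) S ![Ihat, Fhat, Mhat] := by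
    intro ε hε
    set Q := Ihat + Fhat + Mhat with hQ
    have hQp : 0 < Q := by positivity
    obtain ⟨d, hd, hd1, h⟩ := aux_stab a c μM (Nhat0 - 1) ha hc hμM hk (ε / Q) (by positivity)
    set R := min Ihat (min Fhat Mhat) with hR
    have hRp : 0 < R := by positivity
    have R0 : R ≤ Ihat := min_le_left _ _
    have R1 : R ≤ Fhat := (min_le_right _ _).trans (min_le_left _ _)
    have R2 : R ≤ Mhat := (min_le_right _ _).trans (min_le_right _ _)
    refine ⟨d * R, by positivity, fun x hx hx0 t ht => ?_⟩
    rw [dist_pi_lt_iff (by positivity)] at hx0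
    have c0 := hx0 0
    have c1 := hx0 1
    have c2 := hx0 2
    simp only [Matrix.cons_val, Real.dist_eq] at c0 c1 c2
    have scale : ∀ u p : ℝ, 0 < p → u / p - 1 = (u - p) / p := by
      intro u p hp; field_simp
    have hsm : ∀ u p : ℝ, 0 < p → R ≤ p → |u - p| < d * R → |u / p - 1| < d := by
      intro u p hp hRp' hu
      rw [scale u p hp, abs_div, abs_of_pos hp, div_lt_iff₀ hp]
      exact hu.trans_le (by gcongr)
    have s0 := hsm _ _ hIp R0 c0
    have s1 := hsm _ _ hFp R1 c1
    have s2 := hsm _ _ hMp R2 c2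
    have hpos : ∀ u : ℝ, |u - 1| < d → 0 < u := by
      intro u hu; have := (abs_lt.1 hu).1; linarith
    have pp : ∀ (i : Fin 3) (p : ℝ), 0 < p → |x 0 i / p - 1| < d → ∀ t, 0 ≤ t → 0 < x t i / p := by
      intro i p hp hi t ht
      rcases ht.lt_or_eq with h | h
      · exact div_pos (hposall x hx t h i) hp
      · rw [← h]; exact hpos _ hi
    obtain ⟨f0, f1, f2⟩ := h (fun t => x t 0 / Ihat) (fun t => x t 1 / Fhat) (fun t => x t 2 / Mhat)
      (fun t ht => (hders x hx t ht).1) (fun t ht => (hders x hx t ht).2.1)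
      (fun t ht => (hders x hx t ht).2.2) (pp 0 _ hIp s0) (pp 1 _ hFp s1) (pp 2 _ hMp s2)
      s0 s1 s2 t ht
    have hfin : ∀ u p : ℝ, 0 < p → p ≤ Q → |u / p - 1| < ε / Q → |u - p| < ε := by
      intro u p hp hpQ hu
      rw [scale u p hp, abs_div, abs_of_pos hp, div_lt_iff₀ hp] at hu
      have : ε / Q * p ≤ ε / Q * Q := by gcongr
      have h2 : ε / Q * Q = ε := by field_simp
      linarith
    have q0 : Ihat ≤ Q := by linarith
    have q1 : Fhat ≤ Q := by linarith
    have q2 : Mhat ≤ Q := by linarith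
    rw [dist_pi_lt_iff hε]
    intro i
    fin_cases i
    · exact hfin _ _ hIp q0 f0
    · exact hfin _ _ hFp q1 f1
    · exact hfin _ _ hMp q2 f2
  have hconv : ∀ x : ℝ → Fin 3 → ℝ, IsSolOn3 (mScarce3 b K γ r νI μI νY δ μF μM) S x →
      Tendsto x atTop (𝓝 ![Ihat, Fhat, Mhat]) := by
    intro x hx
    have hc3 := aux_conv a c μM (Nhat0 - 1) ha hc hμM hk (fun t => x t 0 / Ihat)
      (fun t => x t 1 / Fhat) (fun t => x t 2 / Mhat) 1
      (fun t ht => (hders x hx t (by linarith)).1) (fun t ht => (hders x hx t (by linarith)).2.1)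
      (fun t ht => (hders x hx t (by linarith)).2.2)
      (fun t ht => div_pos (hposall x hx t (by linarith) 0) hIp)
      (fun t ht => div_pos (hposall x hx t (by linarith) 1) hFp)
      (fun t ht => div_pos (hposall x hx t (by linarith) 2) hMp)
    have hone : ∀ f : ℝ → ℝ, ∀ p : ℝ, 0 < p →
        (∀ ε > 0, ∃ T, ∀ t, T ≤ t → |f t / p - 1| < ε) → Tendsto f atTop (𝓝 p) := by
      intro f p hp h
      have h1 : Tendsto (fun t => f t / p) atTop (𝓝 1) := by
        rw [Metric.tendsto_atTop]
        intro ε hε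
        obtain ⟨T, hT⟩ := h ε hε
        exact ⟨T, fun t ht => by rw [Real.dist_eq]; exact hT t ht⟩
      have h2 := h1.mul_const p
      rw [one_mul] at h2
      refine h2.congr (fun t => ?_)
      field_simp
    rw [tendsto_pi_nhds]
    intro i
    fin_cases i
    · exact hone _ _ hIp fun ε hε => (hc3 ε hε).imp fun T hT t ht => (hT t ht).1
    · exact hone _ _ hFp fun ε hε => (hc3 ε hε).imp fun T hT t ht => (hT t ht).2.1
    · exact hone _ _ hMp fun ε hε => (hc3 ε hε).imp fun T hT t ht => (hT t ht).2.2
  refine ⟨?_, hequil, ?_, hequil, hstab, hconv⟩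
  · intro hst
    obtain ⟨d, hd, h⟩ := hst (Ihat / 2) (by positivity)
    obtain ⟨x, h1, h2, h3, h4⟩ := aux_exists_s5 a b c μM (νY * γ) ((1 - r) * νI) K ha hb hc hμM
      (by positivity) (by positivity) hK d hd
    have hx1 : IsSolOn3 (mScarce3 b K γ r νI μI νY δ μF μM) Orthant3 x := ⟨h1, h2⟩
    have hx2 : IsSolOn3 (mScarce3 b K γ r νI μI νY δ μF μM) S x :=
      ⟨h1, fun t ht => ⟨h2 t ht, fun hh => (h3 t ht).ne' hh.1⟩⟩
    have hlim := (tendsto_pi_nhds.1 (hconv x hx2)) 0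
    simp only [Matrix.cons_val] at hlim
    have hle : Ihat ≤ Ihat / 2 := by
      apply le_of_tendsto hlim
      filter_upwards [eventually_ge_atTop 0] with t ht
      have h5 := h x hx1 h4 t ht
      have h6 := (dist_le_pi_dist (x t) 0 0).trans h5.le
      rw [Real.dist_eq] at h6
      simpa using (le_abs_self _).trans h6
    linarith
  · intro i
    fin_cases i
    · exact hIp
    · exact hFp
    · exact hMp
end
end

section
/- In the full male-scarcity system dI/dt = b(1 - I/K)F - (ν_I + μ_I)I, dY/dt = rν_I I - ν_Y γ M + δF - μ_Y Y, dF/dt = ν_Y γ M - (δ + μ_F)F, dM/dt = (1 - r)ν_I I - μ_M M, the Y-component of the non-trivial equilibrium corresponding to ÊE is Ŷ = [rν_I(δ+μ_F)μ_M - ν_Yγ(1-r)ν_Iμ_F] (1 - 1/N̂₀) K / [μ_Y(δ+μ_F)μ_M], i.e. this value of Ŷ together with Î, F̂, M̂ makes all four right-hand sides vanish. -/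
noncomputable section

/-- In the full male-scarcity system, the value
`Ŷ = [rν_I(δ+μ_F)μ_M - ν_Yγ(1-r)ν_Iμ_F](1 - 1/N̂₀)K / [μ_Y(δ+μ_F)μ_M]`, together with
`Î, F̂, M̂`, makes all four right-hand sides of the system vanish. -/
theorem scarcity_Yhat_equilibrium
    (b K γ r νI μI νY μY δ μF μM Nhat0 Ihat Fhat Mhat Yhat : ℝ)
    (hb : 0 < b) (hK : 0 < K) (hγ : 0 < γ) (hr : 0 < r) (hr1 : r < 1)
    (hνI : 0 < νI) (hμI : 0 < μI) (hνY : 0 < νY) (hμY : 0 < μY)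
    (hδ : 0 < δ) (hμF : 0 < μF) (hμM : 0 < μM)
    (hN : Nhat0 = b * γ * (1 - r) * νI * νY / ((νI + μI) * (δ + μF) * μM))
    (hI : Ihat = (1 - 1 / Nhat0) * K)
    (hF : Fhat = γ * (1 - r) * νI * νY * Ihat / ((δ + μF) * μM))
    (hM : Mhat = (1 - r) * νI * Ihat / μM)
    (hY : Yhat = (r * νI * (δ + μF) * μM - νY * γ * (1 - r) * νI * μF) *
      (1 - 1 / Nhat0) * K / (μY * (δ + μF) * μM)) :
    b * (1 - Ihat / K) * Fhat - (νI + μI) * Ihat = 0 ∧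
    r * νI * Ihat - νY * γ * Mhat + δ * Fhat - μY * Yhat = 0 ∧
    νY * γ * Mhat - (δ + μF) * Fhat = 0 ∧
    (1 - r) * νI * Ihat - μM * Mhat = 0 := by
  have h1r : 0 < 1 - r := by linarith
  have hd : 0 < δ + μF := by linarith
  have hn : 0 < νI + μI := by linarith
  have hN0 : 0 < Nhat0 := by rw [hN]; positivity
  have hIK : 1 - Ihat / K = 1 / Nhat0 := by
    rw [hI]; field_simp; ring
  have hbF : b * Fhat = (νI + μI) * Nhat0 * Ihat := by
    rw [hF, hN]; field_simp
  have hY2 : Yhat = (r * νI * (δ + μF) * μM - νY * γ * (1 - r) * νI * μF) *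
      Ihat / (μY * (δ + μF) * μM) := by
    rw [hY, hI]; ring
  refine ⟨?_, ?_, ?_, ?_⟩
  · have e : b * (1 - Ihat / K) * Fhat = (1 / Nhat0) * (b * Fhat) := by
      rw [hIK]; ring
    rw [e, hbF]; field_simp; ring
  · rw [hY2, hF, hM]; field_simp; ring
  · rw [hF, hM]; field_simp; ring
  · rw [hM]; field_simp; ring
end
end

section
/- Assume N₀ > 1. Then the inequality N̂₀/N₀ > 1 holds if and only if γ > r(δ+μ_F)μ_M / [(1-r)((ν_Y+μ_Y)(δ+μ_F) - δν_Y)]; moreover the latter inequality is implied by the male-abundance assumption Y* < γM*. Consequently, under the assumptions N₀ > 1 and Y* < γM*, one has N̂₀ > 1. -/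
noncomputable section

/-- Assume `N₀ > 1`. Then `N̂₀/N₀ > 1` iff
`γ > r(δ+μ_F)μ_M / [(1-r)((ν_Y+μ_Y)(δ+μ_F) - δν_Y)]`; the latter inequality is implied
by the male-abundance assumption `Y* < γM*`; consequently, under `N₀ > 1` and
`Y* < γM*`, one has `N̂₀ > 1`. -/
theorem scarcityOffspring_gt_one_of_maleAbundance
    (b K γ r νI μI νY μY δ μF μM N0 Nhat0 Istar Ystar Mstar : ℝ)
    (hb : 0 < b) (hK : 0 < K) (hγ : 0 < γ) (hr : 0 < r) (hr1 : r < 1)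
    (hνI : 0 < νI) (hμI : 0 < μI) (hνY : 0 < νY) (hμY : 0 < μY)
    (hδ : 0 < δ) (hμF : 0 < μF) (hμM : 0 < μM)
    (hN0 : N0 = b * r * νI * νY / ((μI + νI) * ((νY + μY) * (δ + μF) - δ * νY)))
    (hNhat : Nhat0 = b * γ * (1 - r) * νI * νY / ((νI + μI) * (δ + μF) * μM))
    (hgt : 1 < N0)
    (hIs : Istar = (1 - 1 / N0) * K)
    (hYs : Ystar = r * νI * (δ + μF) * Istar / ((νY + μY) * (δ + μF) - δ * νY))
    (hMs : Mstar = (1 - r) * νI * Istar / μM) :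
    (1 < Nhat0 / N0 ↔
      r * (δ + μF) * μM / ((1 - r) * ((νY + μY) * (δ + μF) - δ * νY)) < γ) ∧
    (Ystar < γ * Mstar →
      r * (δ + μF) * μM / ((1 - r) * ((νY + μY) * (δ + μF) - δ * νY)) < γ) ∧
    (Ystar < γ * Mstar → 1 < Nhat0) := by
  have hD : 0 < (νY + μY) * (δ + μF) - δ * νY := by
    have : (νY + μY) * (δ + μF) - δ * νY = νY * μF + μY * (δ + μF) := by ring
    rw [this]; positivity
  generalize (νY + μY) * (δ + μF) - δ * νY = D at *
  have hs : 0 < 1 - r := by linarith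
  generalize 1 - r = s at *
  have hF : 0 < δ + μF := by linarith
  generalize δ + μF = F at *
  have hA : 0 < μI + νI := by linarith
  have hN : 0 < N0 := by linarith
  have hI : 0 < Istar := by
    have h1 : 1 / N0 < 1 := by rw [div_lt_one hN]; exact hgt
    rw [hIs]; exact mul_pos (by linarith) hK
  have hT : 0 < r * F * μM / (s * D) := by positivity
  have hM : 0 < Mstar := by rw [hMs]; positivity
  have hY : Ystar = r * F * μM / (s * D) * Mstar := by
    rw [hYs, hMs]; field_simp
  have hq : Nhat0 * (r * F * μM / (s * D)) = γ * N0 := by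
    rw [hNhat, hN0, add_comm νI μI]; field_simp
  generalize r * F * μM / (s * D) = T at *
  have key : 1 < Nhat0 / N0 ↔ T < γ := by
    rw [one_lt_div hN]
    constructor
    · intro h
      have h1 : N0 * T < Nhat0 * T := mul_lt_mul_of_pos_right h hT
      rw [hq] at h1
      by_contra hc
      push Not at hc
      nlinarith
    · intro h
      have h1 : T * N0 < γ * N0 := mul_lt_mul_of_pos_right h hN
      rw [← hq] at h1
      by_contra hc
      push Not at hc
      nlinarith
  have h2 : Ystar < γ * Mstar → T < γ := by
    intro h
    rw [hY] at h
    exact lt_of_mul_lt_mul_right h hM.le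
  refine ⟨key, h2, fun h => ?_⟩
  have h3 := key.mpr (h2 h)
  rw [one_lt_div hN] at h3
  linarith
end
end

section
/- Under the assumptions N₀ > 1 and Y* < γM*, the non-trivial equilibrium of the male-scarcity system satisfies Ŷ < γM̂; that is, Ŷ - γM̂ = (ν_I Î/μ_M)( rμ_M/μ_Y - γ(1-r)(ν_Yμ_F + μ_Y(δ+μ_F))/(μ_Y(μ_F+δ)) ) < 0. -/
noncomputable section

/-- Under `N₀ > 1` and `Y* < γM*`, the non-trivial equilibrium of the male-scarcity
system satisfies `Ŷ < γM̂`; indeed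
`Ŷ - γM̂ = (ν_I Î/μ_M)(rμ_M/μ_Y - γ(1-r)(ν_Yμ_F + μ_Y(δ+μ_F))/(μ_Y(μ_F+δ))) < 0`. -/
theorem Yhat_lt_gammaMhat
    (b K γ r νI μI νY μY δ μF μM N0 Nhat0 Istar Ystar Mstar Ihat Mhat Yhat : ℝ)
    (hb : 0 < b) (hK : 0 < K) (hγ : 0 < γ) (hr : 0 < r) (hr1 : r < 1)
    (hνI : 0 < νI) (hμI : 0 < μI) (hνY : 0 < νY) (hμY : 0 < μY)
    (hδ : 0 < δ) (hμF : 0 < μF) (hμM : 0 < μM)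
    (hN0 : N0 = b * r * νI * νY / ((μI + νI) * ((νY + μY) * (δ + μF) - δ * νY)))
    (hNhat : Nhat0 = b * γ * (1 - r) * νI * νY / ((νI + μI) * (δ + μF) * μM))
    (hgtN0 : 1 < N0)
    (hgtNhat : 1 < Nhat0)
    (hIs : Istar = (1 - 1 / N0) * K)
    (hYs : Ystar = r * νI * (δ + μF) * Istar / ((νY + μY) * (δ + μF) - δ * νY))
    (hMs : Mstar = (1 - r) * νI * Istar / μM)
    (habund : Ystar < γ * Mstar)
    (hIh : Ihat = (1 - 1 / Nhat0) * K)
    (hMh : Mhat = (1 - r) * νI * Ihat / μM)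
    (hYh : Yhat = (r * νI * (δ + μF) * μM - νY * γ * (1 - r) * νI * μF) * Ihat /
      (μY * (δ + μF) * μM)) :
    Yhat - γ * Mhat = (νI * Ihat / μM) *
      (r * μM / μY - γ * (1 - r) * (νY * μF + μY * (δ + μF)) / (μY * (μF + δ))) ∧
    Yhat - γ * Mhat < 0 := by
  have hIsp : 0 < Istar := by
    rw [hIs]
    have : 1 / N0 < 1 := by
      rw [div_lt_one (by linarith)]; exact hgtN0
    exact mul_pos (by linarith) hK
  have hIhp : 0 < Ihat := by
    rw [hIh]
    have : 1 / Nhat0 < 1 := by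
      rw [div_lt_one (by linarith)]; exact hgtNhat
    exact mul_pos (by linarith) hK
  have hDe : (νY + μY) * (δ + μF) - δ * νY = νY * μF + μY * (δ + μF) := by ring
  have hD : 0 < νY * μF + μY * (δ + μF) := by positivity
  have key : r * (δ + μF) * μM < γ * (1 - r) * (νY * μF + μY * (δ + μF)) := by
    rw [hYs, hMs, hDe, ← mul_div_assoc, div_lt_div_iff₀ hD hμM] at habund
    have hp : 0 < νI * Istar := mul_pos hνI hIsp
    refine lt_of_mul_lt_mul_left ?_ hp.le
    linarith
  have e : Yhat - γ * Mhat = νI * Ihat / (μY * (δ + μF) * μM) *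
      (r * (δ + μF) * μM - γ * (1 - r) * (νY * μF + μY * (δ + μF))) := by
    rw [hYh, hMh]
    have : δ + μF ≠ 0 := by positivity
    field_simp
    ring
  constructor
  · rw [e, add_comm μF δ]
    have : δ + μF ≠ 0 := by positivity
    field_simp
  · rw [e]
    exact mul_neg_of_pos_of_neg (by positivity) (by linarith)
end
end
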